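/- arXiv:2307.08021 — 2 statements merged into one kernel-verified Lean document; each statement's English description precedes it below -/
import Mathlib

section
/- Suppose (X_1,T_1) is invertible and X_1 is zero-dimensional, let U_i be open covers of X_i, f ∈ C(X_1,ℝ), and write h = P_W^a(T_1, X_1, {U_i}_{i=1}^k, f) (assumed positive). Then for every l ∈ ℕ there exists μ ∈ M(X_1,T_1) such that for all partitions β_i ∈ (⋁_{j=i}^k τ_{j−1}^{−1}U_j)^*, i=1,…,k, one has Σ_{i=1}^k a_i H_μ(⋁_{h'=0}^{l−1} T_1^{−h'} β_i) ≥ l·( h − 2·w_f(⋁_{i=1}^k τ_{i−1}^{−1}U_i) − ∫ f dμ ) − 1 − k·(Σ_{i=1}^k a_i)·log 2. -/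
open MeasureTheory Set Filter Topology
open scoped ENNReal symmDiff

namespace WTP

variable {k : ℕ}

/-- cumulative weight `a 1 + … + a i` (zero-indexed: `a 0 + … + a i`). -/
noncomputable def cw (a : Fin k → ℝ) (i : Fin k) : ℝ := ∑ j ∈ Finset.Iic i, a j

/-- Birkhoff sum `S_n f = ∑_{l<n} f ∘ T^l`. -/
noncomputable def birk {X : Type*} (T : X → X) (f : X → ℝ) (n : ℕ) (x : X) : ℝ :=
  ∑ l ∈ Finset.range n, f (T^[l] x)

/-- a (finite) open cover of a topological space. -/
def IsOpenCover {X : Type*} [TopologicalSpace X] (𝒰 : Set (Set X)) : Prop :=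
  𝒰.Finite ∧ (∀ U ∈ 𝒰, IsOpen U) ∧ ⋃₀ 𝒰 = Set.univ

/-- pullback of a cover along a map. -/
def pullCov {X Y : Type*} (g : X → Y) (𝒰 : Set (Set Y)) : Set (Set X) :=
  (fun U => g ⁻¹' U) '' 𝒰

/-- the quantity `exp(−s·n + (1/a₁)·sup_{x∈A} S_{⌈a₁ n⌉} f(x))`, as an element of `ℝ≥0∞`. -/
noncomputable def pterm {X : Type*} (T1 : X → X) (f : X → ℝ) (a1 s : ℝ) (n : ℕ)
    (A : Set X) : ℝ≥0∞ :=
  ENNReal.ofReal (Real.exp (-(s * n) + (1 / a1) * sSup (birk T1 f ⌈a1 * (n : ℝ)⌉₊ '' A)))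

/-- the weighted Bowen ball `B_n^𝐚(x, ε)`. -/
def wBowen {X : Fin k → Type*} [∀ i, MetricSpace (X i)] {X1 : Type*}
    (T : ∀ i, X i → X i) (τ : ∀ i, X1 → X i) (a : Fin k → ℝ)
    (n : ℕ) (x : X1) (ε : ℝ) : Set X1 :=
  {y | ∀ i : Fin k, ∀ j < ⌈cw a i * (n : ℝ)⌉₊,
      dist ((T i)^[j] (τ i x)) ((T i)^[j] (τ i y)) < ε}

section Bowen

variable [NeZero k] {X : Fin k → Type*} [∀ i, MetricSpace (X i)] {X1 : Type*}
  [MeasurableSpace X1]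

/-- `Λ^{𝐚,s}_{N,ε}(Z,f)`. -/
noncomputable def lamBowenN (T1 : X1 → X1) (T : ∀ i, X i → X i) (τ : ∀ i, X1 → X i)
    (a : Fin k → ℝ) (f : X1 → ℝ) (s ε : ℝ) (N : ℕ) (Z : Set X1) : ℝ≥0∞ :=
  ⨅ (D : Set (ℕ × Set X1)) (_ : D.Countable)
    (_ : ∀ p ∈ D, N ≤ p.1 ∧ MeasurableSet p.2 ∧ ∃ x : X1, p.2 ⊆ wBowen T τ a p.1 x ε)
    (_ : Z ⊆ ⋃ p ∈ D, p.2),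
    ∑' p : D, pterm T1 f (a 0) s p.1.1 p.1.2

/-- `Λ^{𝐚,s}_{ε}(Z,f) = lim_{N→∞} Λ^{𝐚,s}_{N,ε}(Z,f)` (an increasing limit). -/
noncomputable def lamBowen (T1 : X1 → X1) (T : ∀ i, X i → X i) (τ : ∀ i, X1 → X i)
    (a : Fin k → ℝ) (f : X1 → ℝ) (s ε : ℝ) (Z : Set X1) : ℝ≥0∞ :=
  ⨆ N : ℕ, lamBowenN T1 T τ a f s ε N Z

/-- `P^𝐚(T₁, Z, ε, f) = inf {s : Λ^{𝐚,s}_ε(Z,f) = 0}`. -/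
noncomputable def PBowenEps (T1 : X1 → X1) (T : ∀ i, X i → X i) (τ : ∀ i, X1 → X i)
    (a : Fin k → ℝ) (Z : Set X1) (f : X1 → ℝ) (ε : ℝ) : EReal :=
  sInf (Real.toEReal '' {s : ℝ | lamBowen T1 T τ a f s ε Z = 0})

/-- the 𝐚-weighted topological pressure `P^𝐚(T₁, Z, f) = lim_{ε→0} P^𝐚(T₁, Z, ε, f)`
(an increasing limit as `ε` decreases to `0`). -/
noncomputable def PBowen (T1 : X1 → X1) (T : ∀ i, X i → X i) (τ : ∀ i, X1 → X i)
    (a : Fin k → ℝ) (Z : Set X1) (f : X1 → ℝ) : EReal :=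
  ⨆ ε : {e : ℝ // 0 < e}, PBowenEps T1 T τ a Z f ε.1

/-- `W^{𝐚,s}_{N,ε}(Z,f)`. -/
noncomputable def wBowenWN (T1 : X1 → X1) (T : ∀ i, X i → X i) (τ : ∀ i, X1 → X i)
    (a : Fin k → ℝ) (f : X1 → ℝ) (s ε : ℝ) (N : ℕ) (Z : Set X1) : ℝ≥0∞ :=
  ⨅ (D : Set (ℕ × Set X1 × ℝ≥0∞)) (_ : D.Countable)
    (_ : ∀ p ∈ D, N ≤ p.1 ∧ MeasurableSet p.2.1 ∧ 0 < p.2.2 ∧ p.2.2 ≠ ⊤ ∧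
        ∃ x : X1, p.2.1 ⊆ wBowen T τ a p.1 x ε)
    (_ : ∀ z ∈ Z, 1 ≤ ∑' p : D, (p.1.2.1).indicator (fun _ => p.1.2.2) z),
    ∑' p : D, p.1.2.2 * pterm T1 f (a 0) s p.1.1 p.1.2.1

/-- `W^{𝐚,s}_{ε}(Z,f)`. -/
noncomputable def wBowenW (T1 : X1 → X1) (T : ∀ i, X i → X i) (τ : ∀ i, X1 → X i)
    (a : Fin k → ℝ) (f : X1 → ℝ) (s ε : ℝ) (Z : Set X1) : ℝ≥0∞ :=
  ⨆ N : ℕ, wBowenWN T1 T τ a f s ε N Z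

/-- `P_W^𝐚(T₁, Z, ε, f)`. -/
noncomputable def PWBowenEps (T1 : X1 → X1) (T : ∀ i, X i → X i) (τ : ∀ i, X1 → X i)
    (a : Fin k → ℝ) (Z : Set X1) (f : X1 → ℝ) (ε : ℝ) : EReal :=
  sInf (Real.toEReal '' {s : ℝ | wBowenW T1 T τ a f s ε Z = 0})

/-- the average 𝐚-weighted topological pressure `P_W^𝐚(T₁, Z, f)`. -/
noncomputable def PWBowen (T1 : X1 → X1) (T : ∀ i, X i → X i) (τ : ∀ i, X1 → X i)
    (a : Fin k → ℝ) (Z : Set X1) (f : X1 → ℝ) : EReal :=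
  ⨆ ε : {e : ℝ // 0 < e}, PWBowenEps T1 T τ a Z f ε.1

end Bowen

section Local

variable [NeZero k] {X1 : Type*} [MeasurableSpace X1]

/-- the cover `⋁_{i=1}^k (τ_{i-1}^{-1} 𝒰_i)_0^{⌈(a_1+…+a_i) n⌉ - 1}` on the first space, where
`𝒱 i` is the pulled back cover `τ_{i-1}^{-1} 𝒰_i`. -/
def jointFiber (T1 : X1 → X1) (a : Fin k → ℝ) (𝒱 : Fin k → Set (Set X1)) (n : ℕ) :
    Set (Set X1) :=
  {A | ∃ V : Fin k → ℕ → Set X1,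
      (∀ i, ∀ l < ⌈cw a i * (n : ℝ)⌉₊, V i l ∈ 𝒱 i) ∧
      A = ⋂ i : Fin k, ⋂ l ∈ Finset.range ⌈cw a i * (n : ℝ)⌉₊, (T1^[l]) ⁻¹' V i l}

/-- `Λ^{𝐚,s}_{N,{𝒰_i}}(Z,f)`. -/
noncomputable def lamLocN (T1 : X1 → X1) (a : Fin k → ℝ) (𝒱 : Fin k → Set (Set X1))
    (f : X1 → ℝ) (s : ℝ) (N : ℕ) (Z : Set X1) : ℝ≥0∞ :=
  ⨅ (D : Set (ℕ × Set X1)) (_ : D.Countable)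
    (_ : ∀ p ∈ D, N ≤ p.1 ∧ MeasurableSet p.2 ∧ ∃ A ∈ jointFiber T1 a 𝒱 p.1, p.2 ⊆ A)
    (_ : Z ⊆ ⋃ p ∈ D, p.2),
    ∑' p : D, pterm T1 f (a 0) s p.1.1 p.1.2

/-- `Λ^{𝐚,s}_{{𝒰_i}}(Z,f)`. -/
noncomputable def lamLoc (T1 : X1 → X1) (a : Fin k → ℝ) (𝒱 : Fin k → Set (Set X1))
    (f : X1 → ℝ) (s : ℝ) (Z : Set X1) : ℝ≥0∞ :=
  ⨆ N : ℕ, lamLocN T1 a 𝒱 f s N Z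

/-- the local 𝐚-weighted topological pressure `P^𝐚(T₁, Z, {𝒰_i}, f)`, expressed through the
pulled-back covers `𝒱 i = τ_{i-1}^{-1} 𝒰_i`. -/
noncomputable def PLoc (T1 : X1 → X1) (a : Fin k → ℝ) (𝒱 : Fin k → Set (Set X1))
    (Z : Set X1) (f : X1 → ℝ) : EReal :=
  sInf (Real.toEReal '' {s : ℝ | lamLoc T1 a 𝒱 f s Z = 0})

/-- `W^{𝐚,s}_{N,{𝒰_i}}(Z,f)`. -/
noncomputable def wLocN (T1 : X1 → X1) (a : Fin k → ℝ) (𝒱 : Fin k → Set (Set X1))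
    (f : X1 → ℝ) (s : ℝ) (N : ℕ) (Z : Set X1) : ℝ≥0∞ :=
  ⨅ (D : Set (ℕ × Set X1 × ℝ≥0∞)) (_ : D.Countable)
    (_ : ∀ p ∈ D, N ≤ p.1 ∧ MeasurableSet p.2.1 ∧ 0 < p.2.2 ∧ p.2.2 ≠ ⊤ ∧
        ∃ A ∈ jointFiber T1 a 𝒱 p.1, p.2.1 ⊆ A)
    (_ : ∀ z ∈ Z, 1 ≤ ∑' p : D, (p.1.2.1).indicator (fun _ => p.1.2.2) z),
    ∑' p : D, p.1.2.2 * pterm T1 f (a 0) s p.1.1 p.1.2.1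

/-- `W^{𝐚,s}_{{𝒰_i}}(Z,f)`. -/
noncomputable def wLoc (T1 : X1 → X1) (a : Fin k → ℝ) (𝒱 : Fin k → Set (Set X1))
    (f : X1 → ℝ) (s : ℝ) (Z : Set X1) : ℝ≥0∞ :=
  ⨆ N : ℕ, wLocN T1 a 𝒱 f s N Z

/-- the local average 𝐚-weighted topological pressure `P_W^𝐚(T₁, Z, {𝒰_i}, f)`. -/
noncomputable def PWLoc (T1 : X1 → X1) (a : Fin k → ℝ) (𝒱 : Fin k → Set (Set X1))
    (Z : Set X1) (f : X1 → ℝ) : EReal :=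
  sInf (Real.toEReal '' {s : ℝ | wLoc T1 a 𝒱 f s Z = 0})

end Local

/-- iterated join `(𝒰)_0^{n-1} = ⋁_{l=0}^{n-1} T^{-l} 𝒰` of a cover. -/
def covJoinT {X : Type*} (T : X → X) (𝒰 : Set (Set X)) (n : ℕ) : Set (Set X) :=
  {A | ∃ u : ℕ → Set X, (∀ l < n, u l ∈ 𝒰) ∧
      A = ⋂ l ∈ Finset.range n, (T^[l]) ⁻¹' u l}

/-- the join `⋁_{j=i}^{k} 𝒱 j` of covers of a single space (in applications
`𝒱 j = τ_{j-1}^{-1} 𝒰_j`). -/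
def joinFrom {X1 : Type*} (𝒱 : Fin k → Set (Set X1)) (i : Fin k) : Set (Set X1) :=
  {A | ∃ V : Fin k → Set X1, (∀ j, i ≤ j → V j ∈ 𝒱 j) ∧ A = ⋂ j ∈ Finset.Ici i, V j}

/-- a finite measurable partition (indexed). -/
def IsPart {X : Type*} [MeasurableSpace X] {ι : Type*} (β : ι → Set X) : Prop :=
  (∀ i, MeasurableSet (β i)) ∧ (∀ i j, i ≠ j → Disjoint (β i) (β j)) ∧ ⋃ i, β i = Set.univ

/-- the static entropy `H_μ(β) = -∑ μ(B) log μ(B)` of a finite (indexed) partition. -/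
noncomputable def entH {X : Type*} [MeasurableSpace X] {ι : Type*} [Fintype ι]
    (μ : Measure X) (β : ι → Set X) : ℝ :=
  ∑ i, Real.negMulLog (μ (β i)).toReal

/-- the dynamical join `⋁_{l=0}^{n-1} T^{-l} β` of a partition. -/
def dynJoin {X : Type*} (T : X → X) {ι : Type*} (β : ι → Set X) (n : ℕ) :
    (Fin n → ι) → Set X :=
  fun c => ⋂ l : Fin n, (T^[(l : ℕ)]) ⁻¹' β (c l)

/-- the measure-theoretic entropy `h_μ(T, β) = lim_n (1/n) H_μ(⋁_{l<n} T^{-l}β)` of `T`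
relative to a finite partition. -/
noncomputable def hPart {X : Type*} [MeasurableSpace X] {ι : Type*} [Fintype ι]
    (μ : Measure X) (T : X → X) (β : ι → Set X) : EReal :=
  Filter.liminf (fun n : ℕ => ((entH μ (dynJoin T β n) / n : ℝ) : EReal)) Filter.atTop

/-- the Kolmogorov–Sinai entropy `h_μ(T)`. -/
noncomputable def hKS {X : Type*} [MeasurableSpace X] (μ : Measure X) (T : X → X) : EReal :=
  ⨆ p : (Σ m : ℕ, {β : Fin m → Set X // IsPart β}), hPart μ T p.2.1

/-- `H_μ(𝒰) = inf {H_μ(β) : β a finite measurable partition refining 𝒰}`. -/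
noncomputable def covH {X : Type*} [MeasurableSpace X] (μ : Measure X)
    (𝒰 : Set (Set X)) : ℝ :=
  sInf {h : ℝ | ∃ (m : ℕ) (β : Fin m → Set X), IsPart β ∧
      (∀ i, ∃ U ∈ 𝒰, β i ⊆ U) ∧ h = entH μ β}

/-- the local measure-theoretic entropy `h_μ(T, 𝒰) = lim_n (1/n) H_μ((𝒰)_0^{n-1})` of `T`
relative to an open cover. -/
noncomputable def hCov {X : Type*} [MeasurableSpace X] (μ : Measure X) (T : X → X)
    (𝒰 : Set (Set X)) : EReal :=
  Filter.liminf (fun n : ℕ => ((covH μ (covJoinT T 𝒰 n) / n : ℝ) : EReal)) Filter.atTop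

/-- `h⁺_μ(T,𝒰) = inf {h_μ(T,β) : β a finite measurable partition refining 𝒰}`. -/
noncomputable def hCovPlus {X : Type*} [MeasurableSpace X] (μ : Measure X) (T : X → X)
    (𝒰 : Set (Set X)) : EReal :=
  ⨅ p : (Σ m : ℕ, {β : Fin m → Set X // IsPart β ∧ ∀ i, ∃ U ∈ 𝒰, β i ⊆ U}),
    hPart μ T p.2.1

/-- the join `⋁_{j=i}^{k} γ j` of partitions of a single space (in applications
`γ j = τ_{j-1}^{-1} α_j`). -/
def partJoinFrom {X1 : Type*} {ι : Fin k → Type*} (γ : ∀ j, ι j → Set X1) (i : Fin k) :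
    (∀ j : {j : Fin k // i ≤ j}, ι j) → Set X1 :=
  fun c => ⋂ j : {j : Fin k // i ≤ j}, γ j (c j)

/-- the partition `⋁_{i=1}^k (γ_i)_0^{⌈(a_1+…+a_i)N⌉-1}` on the first space, where
`γ i = τ_{i-1}^{-1} α_i`. -/
def bigPartJoin {X1 : Type*} (T1 : X1 → X1) (a : Fin k → ℝ) {ι : Fin k → Type*}
    (γ : ∀ i, ι i → Set X1) (N : ℕ) :
    (∀ i : Fin k, Fin ⌈cw a i * (N : ℝ)⌉₊ → ι i) → Set X1 :=
  fun c => ⋂ i : Fin k, ⋂ l : Fin ⌈cw a i * (N : ℝ)⌉₊, (T1^[(l : ℕ)]) ⁻¹' γ i (c i l)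

/-- conditional entropy `H_μ(γ|β) = H_μ(γ ∨ β) - H_μ(β)`. -/
noncomputable def condEnt {X : Type*} [MeasurableSpace X] {ι κ : Type*} [Fintype ι] [Fintype κ]
    (μ : Measure X) (γ : ι → Set X) (β : κ → Set X) : ℝ :=
  entH μ (fun p : ι × κ => γ p.1 ∩ β p.2) - entH μ β

/-- the oscillation `w_f(⋁_{i=1}^k τ_{i-1}^{-1} 𝒰_i)` of `f` on the joined cover, where
`𝒱 i = τ_{i-1}^{-1} 𝒰_i`. -/
noncomputable def wfJoin {X1 : Type*} (f : X1 → ℝ) (𝒱 : Fin k → Set (Set X1)) : ℝ :=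
  sSup {d : ℝ | ∃ V : Fin k → Set X1, (∀ i, V i ∈ 𝒱 i) ∧
      ∃ x ∈ ⋂ i, V i, ∃ y ∈ ⋂ i, V i, d = |f x - f y|}

/-- the topological support of a measure. -/
def msupp {X : Type*} [TopologicalSpace X] [MeasurableSpace X] (μ : Measure X) : Set X :=
  {x | ∀ U : Set X, IsOpen U → x ∈ U → 0 < μ U}

/-! ### Entropy of finite-valued maps -/

section LabelEntropy

variable {Y : Type*} [MeasurableSpace Y]

/-- The entropy of a finite-valued map `φ`, i.e. of the partition into its fibres. -/
noncomputable def labelEnt {ι : Type*} [Fintype ι] (ν : Measure Y) (φ : Y → ι) : ℝ :=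
  ∑ t, Real.negMulLog (ν.real (φ ⁻¹' {t}))

variable {ι : Type*} [Fintype ι] [MeasurableSpace ι] [MeasurableSingletonClass ι]
  (ν : Measure Y) [IsProbabilityMeasure ν]

omit [IsProbabilityMeasure ν] in
lemma integrable_comp_label [IsFiniteMeasure ν] {φ : Y → ι} (hφ : Measurable φ) (g : ι → ℝ) :
    Integrable (fun x => g (φ x)) ν :=
  (Integrable.of_finite (μ := ν.map φ) (f := g)).comp_measurable hφ

omit [IsProbabilityMeasure ν] in
lemma integral_comp_label [IsFiniteMeasure ν] {φ : Y → ι} (hφ : Measurable φ) (g : ι → ℝ) :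
    ∫ x, g (φ x) ∂ν = ∑ t, ν.real (φ ⁻¹' {t}) * g t := by
  rw [← integral_map (f := g) hφ.aemeasurable
    (measurable_of_finite g).aestronglyMeasurable, integral_fintype Integrable.of_finite]
  refine Finset.sum_congr rfl fun t _ => ?_
  rw [smul_eq_mul, map_measureReal_apply hφ (measurableSet_singleton t)]

lemma labelEnt_eq_integral {φ : Y → ι} (hφ : Measurable φ) :
    labelEnt ν φ = ∫ x, -Real.log (ν.real (φ ⁻¹' {φ x})) ∂ν := by
  rw [integral_comp_label ν hφ (fun t => -Real.log (ν.real (φ ⁻¹' {t})))]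
  refine Finset.sum_congr rfl fun t _ => ?_
  rw [Real.negMulLog]; ring

lemma sum_fiber_real {φ : Y → ι} (hφ : Measurable φ) : ∑ t, ν.real (φ ⁻¹' {t}) = 1 := by
  simpa using (integral_comp_label ν hφ (fun _ => (1 : ℝ))).symm

omit [MeasurableSpace ι] [MeasurableSingletonClass ι] in
lemma ae_fiber_pos (φ : Y → ι) : ∀ᵐ x ∂ν, 0 < ν.real (φ ⁻¹' {φ x}) := by
  have h : ∀ t : ι, ∀ᵐ x ∂ν, φ x = t → 0 < ν.real (φ ⁻¹' {t}) := by
    intro t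
    rcases (measureReal_nonneg (μ := ν) (s := φ ⁻¹' {t})).eq_or_lt with h0 | h0
    · have h1 : ν (φ ⁻¹' {t}) = 0 := (measureReal_eq_zero_iff).1 h0.symm
      filter_upwards [measure_eq_zero_iff_ae_notMem.1 h1] with x hx hxt
      exact absurd hxt hx
    · exact Eventually.of_forall fun _ _ => h0
  filter_upwards [ae_all_iff.2 h] with x hx
  exact hx _ rfl

/-- Gibbs' inequality. -/
lemma labelEnt_le_integral {φ : Y → ι} (hφ : Measurable φ) (q : ι → ℝ) (hq : ∀ t, 0 ≤ q t)
    (hq1 : ∑ t, q t ≤ 1) (hpos : ∀ᵐ x ∂ν, 0 < q (φ x)) :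
    labelEnt ν φ ≤ ∫ x, -Real.log (q (φ x)) ∂ν := by
  rw [integral_comp_label ν hφ (fun t => -Real.log (q t)), labelEnt, ← sub_nonpos,
    ← Finset.sum_sub_distrib]
  have key : ∀ t, Real.negMulLog (ν.real (φ ⁻¹' {t})) - ν.real (φ ⁻¹' {t}) * -Real.log (q t)
      ≤ q t - ν.real (φ ⁻¹' {t}) := by
    intro t
    rcases (measureReal_nonneg (μ := ν) (s := φ ⁻¹' {t})).eq_or_lt with h0 | h0
    · simp [← h0, hq t]
    · have hqt : 0 < q t := by
        by_contra hcon
        have : ν (φ ⁻¹' {t}) = 0 := by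
          rw [measure_eq_zero_iff_ae_notMem]
          filter_upwards [hpos] with x hx hxt
          rw [show φ x = t from hxt] at hx
          exact hcon hx
        rw [measureReal_def, this] at h0
        simp at h0
      have hl := Real.log_le_sub_one_of_pos (div_pos hqt h0)
      rw [Real.log_div hqt.ne' h0.ne'] at hl
      have h2 := mul_le_mul_of_nonneg_left hl h0.le
      have h3 : ν.real (φ ⁻¹' {t}) * (q t / ν.real (φ ⁻¹' {t}) - 1)
          = q t - ν.real (φ ⁻¹' {t}) := by field_simp
      rw [Real.negMulLog]
      linarith
  refine (Finset.sum_le_sum fun t _ => key t).trans ?_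
  rw [Finset.sum_sub_distrib, sum_fiber_real ν hφ]
  linarith

lemma labelEnt_le_log_card [Nonempty ι] {φ : Y → ι} (hφ : Measurable φ) :
    labelEnt ν φ ≤ Real.log (Fintype.card ι) := by
  have hc : (0 : ℝ) < Fintype.card ι := by exact_mod_cast Fintype.card_pos
  refine (labelEnt_le_integral ν hφ (fun _ => (Fintype.card ι : ℝ)⁻¹) (fun _ => by positivity)
    ?_ (Eventually.of_forall fun _ => by positivity)).trans ?_
  · simp [hc.ne']
  · simp

omit [MeasurableSpace ι] [MeasurableSingletonClass ι] in
lemma labelEnt_nonneg (φ : Y → ι) : 0 ≤ labelEnt ν φ :=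
  Finset.sum_nonneg fun _ _ => Real.negMulLog_nonneg measureReal_nonneg measureReal_le_one

/-- A function of a finite-valued map has at most its entropy. -/
lemma labelEnt_comp_le {κ : Type*} [Fintype κ] [MeasurableSpace κ] [MeasurableSingletonClass κ]
    {φ : Y → ι} (hφ : Measurable φ) (e : ι → κ) :
    labelEnt ν (fun x => e (φ x)) ≤ labelEnt ν φ := by
  have hm : Measurable fun x => e (φ x) := (measurable_of_finite e).comp hφ
  rw [labelEnt_eq_integral ν hφ, labelEnt_eq_integral ν hm]
  refine integral_mono_ae
    (integrable_comp_label ν hm fun t => -Real.log (ν.real ((fun x => e (φ x)) ⁻¹' {t})))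
    (integrable_comp_label ν hφ fun t => -Real.log (ν.real (φ ⁻¹' {t}))) ?_
  filter_upwards [ae_fiber_pos ν φ] with x hx
  refine neg_le_neg (Real.log_le_log hx (measureReal_mono ?_))
  intro y hy
  simp only [mem_preimage, mem_singleton_iff] at hy ⊢
  rw [hy]

/-- Subadditivity of entropy for finite joins. -/
lemma labelEnt_pi_le {J : Type*} [Fintype J] [DecidableEq J] {κ : J → Type*} [∀ j, Fintype (κ j)]
    [∀ j, MeasurableSpace (κ j)] [∀ j, MeasurableSingletonClass (κ j)]
    {φ : ∀ j, Y → κ j} (hφ : ∀ j, Measurable (φ j)) :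
    labelEnt ν (fun x j => φ j x) ≤ ∑ j, labelEnt ν (φ j) := by
  have hm : Measurable fun x j => φ j x := measurable_pi_lambda _ hφ
  have hae : ∀ᵐ x ∂ν, ∀ j, 0 < ν.real (φ j ⁻¹' {φ j x}) :=
    ae_all_iff.2 fun j => ae_fiber_pos ν (φ j)
  refine (labelEnt_le_integral ν hm (fun c => ∏ j, ν.real (φ j ⁻¹' {c j}))
    (fun c => Finset.prod_nonneg fun _ _ => measureReal_nonneg) ?_ ?_).trans ?_
  · rw [← Fintype.piFinset_univ, ← Finset.prod_univ_sum (fun _ => Finset.univ)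
      (fun j t => ν.real (φ j ⁻¹' {t}))]
    simp [sum_fiber_real ν (hφ _)]
  · filter_upwards [hae] with x hx
    exact Finset.prod_pos fun j _ => hx j
  · have h1 : ∫ x, -Real.log (∏ j, ν.real (φ j ⁻¹' {φ j x})) ∂ν
        = ∫ x, ∑ j, -Real.log (ν.real (φ j ⁻¹' {φ j x})) ∂ν := by
      refine integral_congr_ae ?_
      filter_upwards [hae] with x hx
      rw [Real.log_prod fun j _ => (hx j).ne', Finset.sum_neg_distrib]
    rw [h1, integral_finsetSum _ fun j _ =>
      integrable_comp_label ν (hφ j) fun t => -Real.log (ν.real (φ j ⁻¹' {t}))]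
    exact (Finset.sum_congr rfl fun j _ => (labelEnt_eq_integral ν (hφ j)).symm).le

lemma labelEnt_prod_le {κ : Type*} [Fintype κ] [MeasurableSpace κ] [MeasurableSingletonClass κ]
    {φ : Y → ι} {ψ : Y → κ} (hφ : Measurable φ) (hψ : Measurable ψ) :
    labelEnt ν (fun x => (φ x, ψ x)) ≤ labelEnt ν φ + labelEnt ν ψ := by
  have hm : Measurable fun x => (φ x, ψ x) := hφ.prodMk hψ
  have hae : ∀ᵐ x ∂ν, 0 < ν.real (φ ⁻¹' {φ x}) ∧ 0 < ν.real (ψ ⁻¹' {ψ x}) :=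
    (ae_fiber_pos ν φ).and (ae_fiber_pos ν ψ)
  refine (labelEnt_le_integral ν hm
    (fun c => ν.real (φ ⁻¹' {c.1}) * ν.real (ψ ⁻¹' {c.2}))
    (fun c => mul_nonneg measureReal_nonneg measureReal_nonneg) ?_ ?_).trans ?_
  · rw [Fintype.sum_prod_type]
    simp_rw [← Finset.mul_sum]
    simp [sum_fiber_real ν hφ, sum_fiber_real ν hψ]
  · filter_upwards [hae] with x hx
    exact mul_pos hx.1 hx.2
  · rw [labelEnt_eq_integral ν hφ, labelEnt_eq_integral ν hψ, ← integral_add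
      (integrable_comp_label ν hφ fun t => -Real.log (ν.real (φ ⁻¹' {t})))
      (integrable_comp_label ν hψ fun t => -Real.log (ν.real (ψ ⁻¹' {t})))]
    refine (integral_congr_ae ?_).le
    filter_upwards [hae] with x hx
    rw [Real.log_mul hx.1.ne' hx.2.ne', neg_add]

end LabelEntropy

/-! ### Entropy of itineraries -/

section Itinerary

variable {Y : Type*} {ι : Type*}

/-- The `φ`-itinerary of `x` during the times `m, …, m + L - 1`. -/
def itin (S : Y → Y) (φ : Y → ι) (m L : ℕ) (x : Y) : Fin L → ι :=
  fun h => φ (S^[m + h] x)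

variable [MeasurableSpace Y] [Fintype ι] [MeasurableSpace ι]

omit [Fintype ι] in
lemma measurable_itin {S : Y → Y} {φ : Y → ι} (hS : Measurable S) (hφ : Measurable φ)
    (m L : ℕ) : Measurable (itin S φ m L) :=
  measurable_pi_lambda _ fun h => hφ.comp (hS.iterate (m + h))

variable [MeasurableSingletonClass ι] (ν : Measure Y) [IsProbabilityMeasure ν]
  {S : Y → Y} {φ : Y → ι} (hS : Measurable S) (hφ : Measurable φ)

include hS hφ

lemma labelEnt_itin_add (m A B : ℕ) :
    labelEnt ν (itin S φ m (A + B))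
      ≤ labelEnt ν (itin S φ m A) + labelEnt ν (itin S φ (m + A) B) := by
  refine le_trans ?_ (labelEnt_prod_le ν (measurable_itin hS hφ m A)
    (measurable_itin hS hφ (m + A) B))
  have h := labelEnt_comp_le ν
    ((measurable_itin hS hφ m A).prodMk (measurable_itin hS hφ (m + A) B))
    (fun p => (Fin.append p.1 p.2 : Fin (A + B) → ι))
  have he : itin S φ m (A + B) = fun x => Fin.append (itin S φ m A x) (itin S φ (m + A) B x) := by
    funext x i
    refine Fin.addCases (fun i => ?_) (fun i => ?_) i
    · simp [itin, Fin.append_left]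
    · simp [itin, Fin.append_right, add_assoc]
  rw [he]
  exact h

lemma labelEnt_itin_le [Nonempty ι] (m L : ℕ) :
    labelEnt ν (itin S φ m L) ≤ L * Real.log (Fintype.card ι) := by
  classical
  refine (labelEnt_le_log_card ν (measurable_itin hS hφ m L)).trans ?_
  simp

lemma labelEnt_itin_mul_le (m l Q : ℕ) :
    labelEnt ν (itin S φ m (Q * l))
      ≤ ∑ q ∈ Finset.range Q, labelEnt ν (itin S φ (m + q * l) l) := by
  induction Q with
  | zero =>
    have : labelEnt ν (itin S φ m (0 * l)) ≤ Real.log (Fintype.card (Fin (0 * l) → ι)) := by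
      have : IsEmpty (Fin (0 * l)) := by rw [zero_mul]; infer_instance
      exact labelEnt_le_log_card ν (measurable_itin hS hφ m (0 * l))
    simpa using this
  | succ Q ih =>
    rw [Finset.sum_range_succ, Nat.succ_mul]
    exact (labelEnt_itin_add ν hS hφ m (Q * l) l).trans (by gcongr)

/-- The entropy of a long itinerary is controlled by the average entropy of its windows
of length `l`. -/
lemma mul_labelEnt_itin_le [Nonempty ι] (m l L : ℕ) :
    l * labelEnt ν (itin S φ m L) ≤ (∑ j ∈ Finset.range L, labelEnt ν (itin S φ (m + j) l))
      + 3 * (l : ℝ) ^ 2 * Real.log (Fintype.card ι) := by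
  have hlog : 0 ≤ Real.log (Fintype.card ι) :=
    Real.log_nonneg (by exact_mod_cast Fintype.card_pos)
  have hsum : ∀ s : Finset ℕ, 0 ≤ ∑ j ∈ s, labelEnt ν (itin S φ (m + j) l) :=
    fun s => Finset.sum_nonneg fun _ _ => labelEnt_nonneg ν _
  rcases Nat.lt_or_ge L l with hL | hL
  · have h1 := labelEnt_itin_le ν hS hφ m L
    have h2 : (L : ℝ) * Real.log (Fintype.card ι) ≤ l * Real.log (Fintype.card ι) := by
      gcongr
    have h3 := mul_le_mul_of_nonneg_left (h1.trans h2) (Nat.cast_nonneg (α := ℝ) l)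
    have h4 := hsum (Finset.range L)
    have h5 : 0 ≤ (l : ℝ) ^ 2 * Real.log (Fintype.card ι) := by positivity
    nlinarith
  · rcases Nat.eq_zero_or_pos l with rfl | hl
    · simpa using hsum (Finset.range L)
    set Q := L / l - 1 with hQ
    have hQ1 : Q + 1 = L / l := by
      have : 1 ≤ L / l := (Nat.one_le_div_iff hl).2 hL
      omega
    have hQl : (Q + 1) * l ≤ L := by rw [hQ1]; exact Nat.div_mul_le_self L l
    have hQu : L < (Q + 2) * l := by
      rw [show Q + 2 = L / l + 1 by omega, mul_comm]
      exact Nat.lt_mul_div_succ L hl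
    have hQl' : Q * l + l ≤ L := by linarith
    have hQu' : L < Q * l + 2 * l := by linarith
    have hr : ∀ r ∈ Finset.range l, labelEnt ν (itin S φ m L)
        ≤ (∑ q ∈ Finset.range Q, labelEnt ν (itin S φ (m + (r + q * l)) l))
          + 3 * l * Real.log (Fintype.card ι) := by
      intro r hr
      have hrl : r < l := Finset.mem_range.1 hr
      obtain ⟨E, hE⟩ : ∃ E, L = r + (Q * l + E) := ⟨L - r - Q * l, by omega⟩
      have hE2 : E ≤ 2 * l := by omega
      have h1 := labelEnt_itin_add ν hS hφ m r (Q * l + E)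
      have h2 := labelEnt_itin_add ν hS hφ (m + r) (Q * l) E
      have h3 := labelEnt_itin_mul_le ν hS hφ (m + r) l Q
      have h4 := labelEnt_itin_le ν hS hφ m r
      have h5 := labelEnt_itin_le ν hS hφ (m + r + Q * l) E
      have h6 : (r : ℝ) * Real.log (Fintype.card ι) ≤ l * Real.log (Fintype.card ι) := by
        gcongr
      have h7 : (E : ℝ) * Real.log (Fintype.card ι) ≤ (2 * l) * Real.log (Fintype.card ι) := by
        gcongr
        exact_mod_cast hE2
      rw [← hE] at h1
      simp only [← add_assoc] at h1 h2 h3 ⊢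
      linarith
    have hsw : ∀ P : ℕ, ∑ r ∈ Finset.range l, ∑ q ∈ Finset.range P,
        labelEnt ν (itin S φ (m + (r + q * l)) l)
        = ∑ j ∈ Finset.range (P * l), labelEnt ν (itin S φ (m + j) l) := by
      intro P
      induction P with
      | zero => simp
      | succ P ih =>
        simp_rw [Finset.sum_range_succ]
        rw [Finset.sum_add_distrib, ih, Nat.succ_mul, Finset.sum_range_add]
        simp [add_comm]
    have h1 := Finset.sum_le_sum hr
    rw [Finset.sum_add_distrib, hsw] at h1
    simp only [Finset.sum_const, Finset.card_range, nsmul_eq_mul] at h1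
    have h2 : ∑ j ∈ Finset.range (Q * l), labelEnt ν (itin S φ (m + j) l)
        ≤ ∑ j ∈ Finset.range L, labelEnt ν (itin S φ (m + j) l) :=
      Finset.sum_le_sum_of_subset_of_nonneg (Finset.range_subset_range.2 (by omega))
        fun _ _ _ => labelEnt_nonneg ν _
    calc _ ≤ _ := h1
      _ ≤ _ := by nlinarith

end Itinerary

/-! ### Logarithmic averages -/

section LogAverage

lemma sum_telescope_ite (m R : ℕ) :
    ∑ n ∈ Finset.range R, (if m ≤ n then 1 / (((n : ℝ) + 1) * (n + 2)) else 0)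
      = if m ≤ R then 1 / ((m : ℝ) + 1) - 1 / ((R : ℝ) + 1) else 0 := by
  induction R with
  | zero =>
    rcases Nat.eq_zero_or_pos m with rfl | hm
    · simp
    · simp [hm.ne']
  | succ R ih =>
    rw [Finset.sum_range_succ, ih]
    rcases Nat.lt_trichotomy m (R + 1) with h | h | h
    · rw [if_pos (by omega), if_pos (by omega), if_pos (by omega)]
      push_cast
      field_simp
      ring
    · subst h
      simp
    · rw [if_neg (by omega), if_neg (by omega), if_neg (by omega), add_zero]

lemma sum_inv_succ_sq_le (J : ℕ) : ∑ j ∈ Finset.range J, 1 / ((j : ℝ) + 1) ^ 2 ≤ 2 := by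
  have h : ∀ j ∈ Finset.range J, 1 / ((j : ℝ) + 1) ^ 2
      ≤ 2 * (if 0 ≤ j then 1 / (((j : ℝ) + 1) * (j + 2)) else 0) := by
    intro j _
    rw [if_pos (Nat.zero_le j), mul_one_div, div_le_div_iff₀ (by positivity) (by positivity)]
    nlinarith [Nat.cast_nonneg (α := ℝ) j]
  refine (Finset.sum_le_sum h).trans ?_
  rw [← Finset.mul_sum, sum_telescope_ite, if_pos (Nat.zero_le J)]
  have : 0 ≤ 1 / ((J : ℝ) + 1) := by positivity
  simp only [Nat.cast_zero, zero_add, div_one]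
  linarith

lemma abs_logWeight_sub_le {t : ℝ} (ht : 0 < t) (R j : ℕ) :
    |(if ⌊(j : ℝ) / t⌋₊ ≤ R then 1 / ((⌊(j : ℝ) / t⌋₊ : ℝ) + 1) - 1 / ((R : ℝ) + 1) else 0)
        - (if j < R then t / ((j : ℝ) + 1) else 0)|
      ≤ (1 + t) ^ 2 * (1 / ((j : ℝ) + 1) ^ 2) + (1 + t) / ((R : ℝ) + 1) := by
  set m := ⌊(j : ℝ) / t⌋₊ with hm
  have hm1 : (j : ℝ) < t * (m + 1) := by
    have := Nat.lt_floor_add_one ((j : ℝ) / t)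
    rw [div_lt_iff₀ ht] at this
    linarith
  have hm2 : t * m ≤ j := by
    have := Nat.floor_le (a := (j : ℝ) / t) (by positivity)
    rw [← hm, le_div_iff₀ ht] at this
    linarith
  have hj0 : (0 : ℝ) ≤ j := Nat.cast_nonneg j
  have hm0 : (0 : ℝ) ≤ m := Nat.cast_nonneg m
  have hR0 : (0 : ℝ) ≤ R := Nat.cast_nonneg R
  have hmj : (j : ℝ) + 1 ≤ (1 + t) * (m + 1) := by nlinarith
  have hmain : |1 / ((m : ℝ) + 1) - t / ((j : ℝ) + 1)| ≤ (1 + t) ^ 2 * (1 / ((j : ℝ) + 1) ^ 2) := by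
    rw [div_sub_div _ _ (by positivity) (by positivity), abs_div, mul_one_div,
      abs_of_pos (show 0 < ((m : ℝ) + 1) * (j + 1) by positivity),
      div_le_div_iff₀ (by positivity) (by positivity)]
    have h1 : |1 * ((j : ℝ) + 1) - (m + 1) * t| ≤ 1 + t := by
      rw [abs_le]; constructor <;> nlinarith
    have h2 : ((j : ℝ) + 1) ^ 2 ≤ (1 + t) * ((m + 1) * (j + 1)) := by nlinarith
    calc _ ≤ (1 + t) * ((1 + t) * ((m + 1) * ((j : ℝ) + 1))) :=
          mul_le_mul h1 h2 (by positivity) (by positivity)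
      _ = _ := by ring
  have hR1 : 0 < 1 / ((R : ℝ) + 1) := by positivity
  have hR2 : (1 + t) / ((R : ℝ) + 1) = 1 / ((R : ℝ) + 1) + t * (1 / ((R : ℝ) + 1)) := by ring
  have hR3 : 0 < t * (1 / ((R : ℝ) + 1)) := by positivity
  have hjt : t / ((j : ℝ) + 1) = t * (1 / ((j : ℝ) + 1)) := by ring
  rw [hR2]
  rw [abs_le] at hmain ⊢
  have hmp : 0 < 1 / ((m : ℝ) + 1) := by positivity
  have hjp : 0 < t / ((j : ℝ) + 1) := by positivity
  have hjR : ¬ j < R → t / ((j : ℝ) + 1) ≤ t * (1 / ((R : ℝ) + 1)) := by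
    intro h
    rw [hjt]
    have : (R : ℝ) ≤ j := by exact_mod_cast not_lt.1 h
    gcongr
  have hmR : ¬ m ≤ R → 1 / ((m : ℝ) + 1) ≤ 1 / ((R : ℝ) + 1) := by
    intro h
    have : (R : ℝ) ≤ m := by exact_mod_cast (not_le.1 h).le
    gcongr
  have hsq : 0 ≤ (1 + t) ^ 2 * (1 / ((j : ℝ) + 1) ^ 2) := by positivity
  have hmR' : m ≤ R → 1 / ((R : ℝ) + 1) ≤ 1 / ((m : ℝ) + 1) := by
    intro h
    have : (m : ℝ) ≤ R := by exact_mod_cast h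
    gcongr
  split_ifs with h1 h2 h2
  · constructor <;> linarith [hmR' h1]
  · constructor <;> linarith [hmR' h1, hjR h2]
  · constructor <;> linarith [hmR h1]
  · constructor <;> linarith [hmR h1]

/-- Averages over `[0, t n)`, themselves averaged logarithmically in `n`, agree up to a bounded
error with `t` times the logarithmic average. -/
lemma exists_abs_logAverage_sub_le {t : ℝ} (ht : 0 ≤ t) :
    ∃ C : ℝ, ∀ (B : ℝ) (b : ℕ → ℝ), (∀ j, |b j| ≤ B) → ∀ R : ℕ,
      |∑ n ∈ Finset.range R, 1 / (((n : ℝ) + 1) * (n + 2)) *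
          ∑ j ∈ Finset.range ⌈t * ((n + 1 : ℕ) : ℝ)⌉₊, b j
        - t * ∑ j ∈ Finset.range R, b j / ((j : ℝ) + 1)| ≤ C * B := by
  rcases ht.eq_or_lt with rfl | ht
  · refine ⟨0, fun B b _ R => ?_⟩
    simp
  refine ⟨2 * (1 + t) ^ 2 + (1 + t) * (t + 2), fun B b hb R => ?_⟩
  have hB : 0 ≤ B := (abs_nonneg _).trans (hb 0)
  set J := ⌈t * (R : ℝ)⌉₊ + R with hJ
  have hinner : ∀ n ∈ Finset.range R, 1 / (((n : ℝ) + 1) * (n + 2)) *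
      ∑ j ∈ Finset.range ⌈t * ((n + 1 : ℕ) : ℝ)⌉₊, b j
      = ∑ j ∈ Finset.range J,
        b j * (if ⌊(j : ℝ) / t⌋₊ ≤ n then 1 / (((n : ℝ) + 1) * (n + 2)) else 0) := by
    intro n hn
    have hset : Finset.range ⌈t * ((n + 1 : ℕ) : ℝ)⌉₊
        = (Finset.range J).filter fun j : ℕ => ⌊(j : ℝ) / t⌋₊ ≤ n := by
      ext j
      have hiff : j < ⌈t * ((n + 1 : ℕ) : ℝ)⌉₊ ↔ ⌊(j : ℝ) / t⌋₊ ≤ n := by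
        rw [Nat.lt_ceil, ← Nat.lt_succ_iff, Nat.floor_lt (by positivity), div_lt_iff₀ ht,
          mul_comm]
      rw [Finset.mem_filter, Finset.mem_range, Finset.mem_range, ← hiff]
      refine ⟨fun h => ⟨h.trans_le ?_, h⟩, fun h => h.2⟩
      refine le_trans (Nat.ceil_mono ?_) (Nat.le_add_right _ _)
      have : ((n + 1 : ℕ) : ℝ) ≤ R := by exact_mod_cast Finset.mem_range.1 hn
      gcongr
    rw [hset, Finset.sum_filter, Finset.mul_sum]
    refine Finset.sum_congr rfl fun j _ => ?_
    split_ifs <;> ring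
  have hright : t * ∑ j ∈ Finset.range R, b j / ((j : ℝ) + 1)
      = ∑ j ∈ Finset.range J, b j * (if j < R then t / ((j : ℝ) + 1) else 0) := by
    have hset : Finset.range R = (Finset.range J).filter fun j : ℕ => j < R := by
      ext j
      simp only [Finset.mem_filter, Finset.mem_range]
      omega
    rw [hset, Finset.sum_filter, Finset.mul_sum]
    refine Finset.sum_congr rfl fun j _ => ?_
    split_ifs <;> ring
  rw [Finset.sum_congr rfl hinner, Finset.sum_comm, hright]
  simp_rw [← Finset.mul_sum]
  simp_rw [sum_telescope_ite]
  rw [← Finset.sum_sub_distrib]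
  simp_rw [← mul_sub]
  refine (Finset.abs_sum_le_sum_abs _ _).trans ?_
  have hterm : ∀ j ∈ Finset.range J, |b j * ((if ⌊(j : ℝ) / t⌋₊ ≤ R
        then 1 / ((⌊(j : ℝ) / t⌋₊ : ℝ) + 1) - 1 / ((R : ℝ) + 1) else 0)
        - (if j < R then t / ((j : ℝ) + 1) else 0))|
      ≤ B * ((1 + t) ^ 2 * (1 / ((j : ℝ) + 1) ^ 2) + (1 + t) / ((R : ℝ) + 1)) := by
    intro j _
    rw [abs_mul]
    exact mul_le_mul (hb j) (abs_logWeight_sub_le ht R j) (abs_nonneg _) hB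
  refine (Finset.sum_le_sum hterm).trans ?_
  rw [← Finset.mul_sum, Finset.sum_add_distrib, ← Finset.mul_sum, mul_comm]
  refine mul_le_mul_of_nonneg_right ?_ hB
  have h1 := mul_le_mul_of_nonneg_left (sum_inv_succ_sq_le J) (sq_nonneg (1 + t))
  have h2 : ∑ _j ∈ Finset.range J, (1 + t) / ((R : ℝ) + 1) ≤ (1 + t) * (t + 2) := by
    rw [Finset.sum_const, Finset.card_range, nsmul_eq_mul, mul_div_assoc', mul_comm (J : ℝ),
      mul_div_assoc]
    refine mul_le_mul_of_nonneg_left ?_ (by positivity)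
    rw [div_le_iff₀ (by positivity)]
    have h3 : (⌈t * (R : ℝ)⌉₊ : ℝ) < t * R + 1 := Nat.ceil_lt_add_one (by positivity)
    have h4 : (J : ℝ) = ⌈t * (R : ℝ)⌉₊ + R := by rw [hJ]; push_cast; rfl
    rw [h4]
    have hR0 : (0 : ℝ) ≤ R := Nat.cast_nonneg R
    nlinarith
  linarith

lemma abs_sum_succ_sub_div_le {B : ℝ} {b : ℕ → ℝ} (hb : ∀ j, |b j| ≤ B) (R : ℕ) :
    |∑ j ∈ Finset.range R, (b j - b (j + 1)) / ((j : ℝ) + 1)| ≤ 3 * B := by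
  have hB : 0 ≤ B := (abs_nonneg _).trans (hb 0)
  have key : |∑ j ∈ Finset.range R, (b j - b (j + 1)) / ((j : ℝ) + 1) + b R / ((R : ℝ) + 1)|
      ≤ B * (2 - 1 / ((R : ℝ) + 1)) := by
    induction R with
    | zero => simpa using (hb 0).trans (by linarith)
    | succ R ih =>
      have hd : (0 : ℝ) ≤ 1 / ((R : ℝ) + 1) - 1 / ((R : ℝ) + 2) := by
        rw [sub_nonneg]
        gcongr
        norm_num
      have hstep : |b (R + 1) * (1 / ((R : ℝ) + 1) - 1 / ((R : ℝ) + 2))|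
          ≤ B * (1 / ((R : ℝ) + 1) - 1 / ((R : ℝ) + 2)) := by
        rw [abs_mul, abs_of_nonneg hd]
        exact mul_le_mul_of_nonneg_right (hb _) hd
      rw [Finset.sum_range_succ]
      push_cast
      have e1 : (R : ℝ) + 1 + 1 = R + 2 := by ring
      rw [e1]
      rw [abs_le] at ih hstep ⊢
      have e2 : (b R - b (R + 1)) / ((R : ℝ) + 1) = b R / ((R : ℝ) + 1)
        - b (R + 1) * (1 / ((R : ℝ) + 1)) := by ring
      have e3 : b (R + 1) / ((R : ℝ) + 2) = b (R + 1) * (1 / ((R : ℝ) + 2)) := by ring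
      rw [e2, e3]
      constructor <;> nlinarith
  have hlast : |b R / ((R : ℝ) + 1)| ≤ B := by
    rw [abs_div, abs_of_pos (show (0 : ℝ) < (R : ℝ) + 1 by positivity)]
    exact div_le_of_le_mul₀ (by positivity) hB
      ((hb R).trans (le_mul_of_one_le_right hB (by linarith [Nat.cast_nonneg (α := ℝ) R])))
  have hpos : 0 ≤ B * (1 / ((R : ℝ) + 1)) := by positivity
  rw [abs_le] at key hlast ⊢
  constructor <;> linarith

lemma sum_inv_mul_le (R : ℕ) :
    ∑ n ∈ Finset.range R, 1 / (((n : ℝ) + 1) * (n + 2)) ≤ 1 := by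
  have h := sum_telescope_ite 0 R
  simp only [Nat.zero_le, if_true, Nat.cast_zero, zero_add, div_one] at h
  rw [h]
  have : 0 ≤ 1 / ((R : ℝ) + 1) := by positivity
  linarith

end LogAverage

/-! ### A Frostman-type lemma -/

section Frostman

/-- Riesz representation of positive functionals on `C(Y, ℝ)` for compact `Y`. -/
lemma exists_measure_of_nonneg_functional {Y : Type*} [TopologicalSpace Y] [T2Space Y]
    [CompactSpace Y] [MeasurableSpace Y] [BorelSpace Y] (L : C(Y, ℝ) →ₗ[ℝ] ℝ)
    (hL : ∀ g : C(Y, ℝ), 0 ≤ g → 0 ≤ L g) :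
    ∃ ν : Measure Y, IsFiniteMeasure ν ∧ ∀ g : C(Y, ℝ), ∫ x, g x ∂ν = L g := by
  let Λ₀ : CompactlySupportedContinuousMap Y ℝ →ₗ[ℝ] ℝ :=
    { toFun := fun g => L g.toContinuousMap
      map_add' := fun g h => L.map_add g.toContinuousMap h.toContinuousMap
      map_smul' := fun c g => L.map_smul c g.toContinuousMap }
  let Λ : CompactlySupportedContinuousMap Y ℝ →ₚ[ℝ] ℝ :=
    PositiveLinearMap.mk₀ Λ₀ fun g hg => hL _ fun x => hg x
  refine ⟨RealRMK.rieszMeasure Λ, inferInstance, fun g => ?_⟩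
  exact RealRMK.integral_rieszMeasure Λ (CompactlySupportedContinuousMap.continuousMapEquiv g)

variable {Y : Type*} [TopologicalSpace Y] [T2Space Y] [CompactSpace Y] [MeasurableSpace Y]
  [BorelSpace Y] {Q : Type*} (A : Q → Set Y) (w : Q → ℝ)

/-- If every finite fractional cover by the sets `A q` with costs `w q` has total cost at least
`δ`, then some probability measure satisfies `ν (A q) ≤ w q / δ` for all clopen `A q`. -/
lemma exists_measure_le_of_fractionalCover (hw : ∀ q, 0 ≤ w q)
    (hfin : ∃ F : Finset Q, ∀ x, ∃ q ∈ F, x ∈ A q) {δ : ℝ} (hδ : 0 < δ)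
    (hcov : ∀ c : Q →₀ ℝ, (∀ q, 0 ≤ c q) →
      (∀ x, 1 ≤ Finsupp.linearCombination ℝ (fun q => (A q).indicator (fun _ => (1 : ℝ)) x) c) →
      δ ≤ Finsupp.linearCombination ℝ w c) :
    ∃ ν : Measure Y, IsProbabilityMeasure ν ∧
      ∀ q, IsClopen (A q) → ν.real (A q) ≤ δ⁻¹ * w q := by
  classical
  have hne : Nonempty Y := by
    by_contra h
    rw [not_nonempty_iff] at h
    have := hcov 0 (fun _ => le_rfl) (fun x => (h.false x).elim)
    simp only [map_zero] at this
    linarith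
  have hnonneg : ∀ {v : Q → ℝ}, (∀ q, 0 ≤ v q) → ∀ c : Q →₀ ℝ, (∀ q, 0 ≤ c q) →
      0 ≤ Finsupp.linearCombination ℝ v c := by
    intro v hv c hc
    rw [Finsupp.linearCombination_apply]
    exact Finset.sum_nonneg fun q _ => mul_nonneg (hc q) (hv q)
  let ev : Y → (Q →₀ ℝ) →ₗ[ℝ] ℝ := fun x =>
    Finsupp.linearCombination ℝ (fun q => (A q).indicator (fun _ => (1 : ℝ)) x)
  let cost : (Q →₀ ℝ) →ₗ[ℝ] ℝ := Finsupp.linearCombination ℝ w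
  let S : C(Y, ℝ) → Set ℝ := fun g =>
    {r | ∃ c : Q →₀ ℝ, (∀ q, 0 ≤ c q) ∧ (∀ x, g x ≤ ev x c) ∧ cost c = r}
  have hSne : ∀ g, (S g).Nonempty := by
    intro g
    obtain ⟨F, hF⟩ := hfin
    refine ⟨_, ∑ q ∈ F, Finsupp.single q ‖g‖, fun q => ?_, fun x => ?_, rfl⟩
    · rw [Finsupp.finsetSum_apply]
      refine Finset.sum_nonneg fun q' _ => ?_
      rw [Finsupp.single_apply]
      split_ifs <;> simp
    · obtain ⟨q, hq, hx⟩ := hF x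
      have h1 : ev x (∑ q ∈ F, Finsupp.single q ‖g‖)
          = ∑ q ∈ F, ‖g‖ * (A q).indicator (fun _ => (1 : ℝ)) x := by
        simp [ev, Finsupp.linearCombination_single]
      rw [h1]
      have h2 : ‖g‖ * (A q).indicator (fun _ => (1 : ℝ)) x
          ≤ ∑ q ∈ F, ‖g‖ * (A q).indicator (fun _ => (1 : ℝ)) x :=
        Finset.single_le_sum (f := fun q => ‖g‖ * (A q).indicator (fun _ => (1 : ℝ)) x)
          (fun q' _ => mul_nonneg (norm_nonneg g)
            (indicator_nonneg (fun _ _ => zero_le_one) x)) hq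
      rw [indicator_of_mem hx, mul_one] at h2
      exact ((le_abs_self _).trans (g.norm_coe_le_norm x)).trans h2
  have hS0 : ∀ g, ∀ r ∈ S g, 0 ≤ r := by
    rintro g r ⟨c, hc, -, rfl⟩
    exact hnonneg hw c hc
  have hSb : ∀ g, BddBelow (S g) := fun g => ⟨0, fun r hr => hS0 g r hr⟩
  let p : C(Y, ℝ) → ℝ := fun g => sInf (S g)
  have hp0 : ∀ g, 0 ≤ p g := fun g => Real.sInf_nonneg (hS0 g)
  have hp_smul_le : ∀ t : ℝ, 0 < t → ∀ g, p (t • g) ≤ t * p g := by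
    intro t ht g
    rw [← div_le_iff₀' ht]
    refine le_csInf (hSne g) ?_
    rintro r ⟨c, hc, hx, rfl⟩
    rw [div_le_iff₀' ht]
    refine csInf_le (hSb _) ⟨t • c, fun q => mul_nonneg ht.le (hc q), fun x => ?_, ?_⟩
    · rw [map_smul]
      exact mul_le_mul_of_nonneg_left (hx x) ht.le
    · rw [map_smul, smul_eq_mul]
  have hp_smul : ∀ t : ℝ, 0 < t → ∀ g, p (t • g) = t * p g := by
    intro t ht g
    refine le_antisymm (hp_smul_le t ht g) ?_
    have h := hp_smul_le t⁻¹ (inv_pos.2 ht) (t • g)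
    rw [smul_smul, inv_mul_cancel₀ ht.ne', one_smul] at h
    rwa [← le_inv_mul_iff₀ ht]
  have hp_add : ∀ g h, p (g + h) ≤ p g + p h := by
    intro g h
    rw [← csInf_add (hSne g) (hSb g) (hSne h) (hSb h)]
    refine csInf_le_csInf (hSb _) ((hSne g).add (hSne h)) ?_
    rintro _ ⟨_, ⟨c, hc, hx, rfl⟩, _, ⟨c', hc', hx', rfl⟩, rfl⟩
    refine ⟨c + c', fun q => add_nonneg (hc q) (hc' q), fun x => ?_, map_add _ _ _⟩
    rw [map_add]
    exact add_le_add (hx x) (hx' x)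
  have hp1 : δ ≤ p 1 := by
    refine le_csInf (hSne 1) ?_
    rintro r ⟨c, hc, hx, rfl⟩
    exact hcov c hc fun x => by simpa using hx x
  have hone : (1 : C(Y, ℝ)) ≠ 0 := one_ne_zero
  obtain ⟨L, hL1, hLp⟩ := exists_extension_of_le_sublinear
    (LinearPMap.mkSpanSingleton (K := ℝ) (1 : C(Y, ℝ)) (p 1) hone) p hp_smul hp_add (by
      rintro ⟨g, hg⟩
      obtain ⟨t, rfl⟩ := Submodule.mem_span_singleton.1 hg
      rw [show (LinearPMap.mkSpanSingleton (K := ℝ) (1 : C(Y, ℝ)) (p 1) hone) ⟨t • 1, hg⟩ = t * p 1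
        from LinearPMap.mkSpanSingleton'_apply _ _ _ t hg]
      rcases lt_or_ge 0 t with ht | ht
      · exact (hp_smul t ht 1).ge
      · exact (mul_nonpos_of_nonpos_of_nonneg ht (hp0 1)).trans (hp0 _))
  have hL1' : L 1 = p 1 := by
    have h := hL1 ⟨(1 : C(Y, ℝ)), Submodule.mem_span_singleton_self _⟩
    rwa [LinearPMap.mkSpanSingleton_apply] at h
  have hLpos : ∀ g : C(Y, ℝ), 0 ≤ g → 0 ≤ L g := by
    intro g hg
    have h1 : p (-g) ≤ 0 := by
      refine csInf_le (hSb _) ⟨0, fun _ => le_rfl, fun x => ?_, map_zero _⟩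
      rw [map_zero]
      simpa using hg x
    have h2 := (hLp (-g)).trans h1
    rw [map_neg] at h2
    linarith
  obtain ⟨ν, hν, hint⟩ := exists_measure_of_nonneg_functional L hLpos
  have huniv : ν.real univ = p 1 := by
    rw [← hL1', ← hint 1]
    simp
  have hreal : ∀ q, IsClopen (A q) → ν.real (A q) ≤ w q := by
    intro q hq
    let g : C(Y, ℝ) := ⟨(A q).indicator fun _ => 1, hq.continuous_indicator continuous_const⟩
    have h1 : ν.real (A q) = L g := by
      rw [← hint g]
      exact (integral_indicator_one hq.isOpen.measurableSet).symm
    rw [h1]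
    refine (hLp g).trans (csInf_le (hSb _)
      ⟨Finsupp.single q 1, fun q' => ?_, fun x => ?_, ?_⟩)
    · rw [Finsupp.single_apply]
      split_ifs <;> simp
    · simp [ev, g, Finsupp.linearCombination_single]
    · simp [cost, Finsupp.linearCombination_single]
  have hp1pos : 0 < p 1 := hδ.trans_le hp1
  have hν0 : ν ≠ 0 := by
    rintro rfl
    simp at huniv
    linarith
  have : NeZero ν := ⟨hν0⟩
  refine ⟨(ν univ)⁻¹ • ν, inferInstance, fun q hq => ?_⟩
  rw [measureReal_ennreal_smul_apply, ENNReal.toReal_inv, ← measureReal_def, huniv]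
  exact mul_le_mul (inv_anti₀ hδ hp1) (hreal q hq) measureReal_nonneg (by positivity)

end Frostman

/-! ### The covers defining the local pressure -/

section LocalPressure

lemma cw_nonneg {a : Fin k → ℝ} (ha : ∀ i, 0 ≤ a i) (i : Fin k) : 0 ≤ cw a i :=
  Finset.sum_nonneg fun j _ => ha j

lemma IsOpenCover.pullCov {X Y : Type*} [TopologicalSpace X] [TopologicalSpace Y] {g : X → Y}
    (hg : Continuous g) {𝒰 : Set (Set Y)} (h : IsOpenCover 𝒰) : IsOpenCover (pullCov g 𝒰) := by
  refine ⟨h.1.image _, ?_, ?_⟩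
  · rintro _ ⟨U, hU, rfl⟩
    exact (h.2.1 U hU).preimage hg
  · refine eq_univ_of_forall fun x => ?_
    obtain ⟨U, hU, hx⟩ := mem_sUnion.1 (h.2.2 ▸ mem_univ (g x) : g x ∈ ⋃₀ 𝒰)
    exact ⟨_, ⟨U, hU, rfl⟩, hx⟩

variable {Y : Type*} {S : Y → Y} {a : Fin k → ℝ} {𝒱 : Fin k → Set (Set Y)}

lemma jointFiber_subset_range (n : ℕ) :
    jointFiber S a 𝒱 n ⊆ range fun v : ∀ i, Fin ⌈cw a i * (n : ℝ)⌉₊ → 𝒱 i =>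
      ⋂ i, ⋂ l : Fin ⌈cw a i * (n : ℝ)⌉₊, (S^[(l : ℕ)]) ⁻¹' (v i l : Set Y) := by
  rintro _ ⟨V, hV, rfl⟩
  refine ⟨fun i l => ⟨V i l, hV i l l.2⟩, ?_⟩
  ext x
  simp only [mem_iInter, mem_preimage, Finset.mem_range]
  exact ⟨fun h i l hl => h i ⟨l, hl⟩, fun h i l => h i l l.2⟩

lemma finite_jointFiber (h𝒱 : ∀ i, (𝒱 i).Finite) (n : ℕ) : (jointFiber S a 𝒱 n).Finite := by
  have : ∀ i, Finite (𝒱 i) := h𝒱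
  exact (finite_range _).subset (jointFiber_subset_range n)

lemma ncard_jointFiber_le (h𝒱 : ∀ i, (𝒱 i).Finite) {K : ℕ} (hK : ∀ i, (𝒱 i).ncard ≤ K) (n : ℕ) :
    (jointFiber S a 𝒱 n).ncard ≤ K ^ ∑ i, ⌈cw a i * (n : ℝ)⌉₊ := by
  have : ∀ i, Finite (𝒱 i) := h𝒱
  refine (ncard_le_ncard (jointFiber_subset_range n) (finite_range _)).trans ?_
  rw [← image_univ]
  refine (ncard_image_le finite_univ).trans ?_
  rw [ncard_univ, Nat.card_pi, ← Finset.prod_pow_eq_pow_sum]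
  refine Finset.prod_le_prod' fun i _ => ?_
  rw [Nat.card_fun, Nat.card_fin]
  exact Nat.pow_le_pow_left (hK i) _

lemma exists_mem_jointFiber (h𝒱 : ∀ i, ⋃₀ 𝒱 i = univ) (n : ℕ) (x : Y) :
    ∃ A ∈ jointFiber S a 𝒱 n, x ∈ A := by
  have h : ∀ i l, ∃ V ∈ 𝒱 i, S^[l] x ∈ V := fun i l =>
    mem_sUnion.1 (h𝒱 i ▸ mem_univ (S^[l] x))
  choose V hV hx using h
  refine ⟨_, ⟨V, fun i l _ => hV i l, rfl⟩, ?_⟩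
  simp only [mem_iInter, mem_preimage]
  exact fun i l _ => hx i l

lemma isOpen_of_mem_jointFiber [TopologicalSpace Y] (hS : Continuous S)
    (h𝒱 : ∀ i, ∀ U ∈ 𝒱 i, IsOpen U) {n : ℕ} {A : Set Y} (hA : A ∈ jointFiber S a 𝒱 n) :
    IsOpen A := by
  obtain ⟨V, hV, rfl⟩ := hA
  exact isOpen_iInter_of_finite fun i => isOpen_biInter_finset fun l hl =>
    (h𝒱 i _ (hV i l (Finset.mem_range.1 hl))).preimage (hS.iterate l)

lemma abs_birk_le {f : Y → ℝ} {B : ℝ} (hB : ∀ x, |f x| ≤ B) (n : ℕ) (x : Y) :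
    |birk S f n x| ≤ n * B := by
  refine (Finset.abs_sum_le_sum_abs _ _).trans ((Finset.sum_le_sum fun l _ => hB _).trans ?_)
  simp

lemma pterm_le [NeZero k] {f : Y → ℝ} {B : ℝ} (hB0 : 0 ≤ B) (hB : ∀ x, |f x| ≤ B)
    (ha1 : 0 < a 0) (s : ℝ)
    (n : ℕ) (A : Set Y) :
    pterm S f (a 0) s n A ≤ ENNReal.ofReal (Real.exp ((B - s) * n + B / a 0)) := by
  refine ENNReal.ofReal_le_ofReal (Real.exp_le_exp.2 ?_)
  have h1 : sSup (birk S f ⌈a 0 * (n : ℝ)⌉₊ '' A) ≤ ⌈a 0 * (n : ℝ)⌉₊ * B := by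
    refine Real.sSup_le ?_ (by positivity)
    rintro _ ⟨x, -, rfl⟩
    exact (le_abs_self _).trans (abs_birk_le hB _ _)
  have h2 : (⌈a 0 * (n : ℝ)⌉₊ : ℝ) ≤ a 0 * n + 1 := (Nat.ceil_lt_add_one (by positivity)).le
  have h3 : 1 / a 0 * sSup (birk S f ⌈a 0 * (n : ℝ)⌉₊ '' A) ≤ 1 / a 0 * ((a 0 * n + 1) * B) :=
    mul_le_mul_of_nonneg_left (h1.trans (mul_le_mul_of_nonneg_right h2 hB0)) (by positivity)
  have h4 : 1 / a 0 * ((a 0 * n + 1) * B) = B * n + B / a 0 := by field_simp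
  linarith

variable [TopologicalSpace Y] [MeasurableSpace Y] [BorelSpace Y]

lemma wLocN_le [NeZero k] (hS : Continuous S) (h𝒱 : ∀ i, IsOpenCover (𝒱 i))
    {f : Y → ℝ} {s : ℝ} {N n : ℕ}
    (hn : N ≤ n) {C : ℝ≥0∞} (hC : ∀ A, pterm S f (a 0) s n A ≤ C) :
    wLocN S a 𝒱 f s N univ ≤ (jointFiber S a 𝒱 n).ncard * C := by
  have hfin := finite_jointFiber (S := S) (a := a) (fun i => (h𝒱 i).1) n
  let g : Set Y → ℕ × Set Y × ℝ≥0∞ := fun A => (n, A, 1)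
  have hg : InjOn g (jointFiber S a 𝒱 n) := fun A _ A' _ h => congrArg (fun p => p.2.1) h
  refine (iInf₂_le (g '' jointFiber S a 𝒱 n) (hfin.image g).countable).trans ?_
  refine (iInf₂_le ?_ ?_).trans ?_
  · rintro _ ⟨A, hA, rfl⟩
    exact ⟨hn, (isOpen_of_mem_jointFiber hS (fun i => (h𝒱 i).2.1) hA).measurableSet, one_pos,
      ENNReal.one_ne_top, A, hA, subset_rfl⟩
  · intro x _
    obtain ⟨A, hA, hx⟩ := exists_mem_jointFiber (S := S) (a := a) (fun i => (h𝒱 i).2.2) n x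
    refine le_trans ?_ (ENNReal.le_tsum ⟨g A, A, hA, rfl⟩)
    simp [g, hx]
  · rw [tsum_image (fun p : ℕ × Set Y × ℝ≥0∞ => p.2.2 * pterm S f (a 0) s p.1 p.2.1) hg]
    have : Fintype (jointFiber S a 𝒱 n) := hfin.fintype
    rw [tsum_fintype]
    refine (Finset.sum_le_sum (g := fun _ => C) fun (A : jointFiber S a 𝒱 n) _ =>
      (one_mul (pterm S f (a 0) s n (A : Set Y))).trans_le (hC A)).trans ?_
    rw [Finset.sum_const, nsmul_eq_mul, Finset.card_univ, ← Nat.card_eq_fintype_card,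
      Nat.card_coe_set_eq]

lemma exists_wLoc_eq_zero [NeZero k] (hS : Continuous S) (h𝒱 : ∀ i, IsOpenCover (𝒱 i))
    (ha1 : 0 < a 0)
    (ha : ∀ i, 0 ≤ a i) {f : Y → ℝ} {B : ℝ} (hB : ∀ x, |f x| ≤ B) :
    ∃ s, wLoc S a 𝒱 f s univ = 0 := by
  obtain ⟨B, hB0, hB⟩ : ∃ B, 0 ≤ B ∧ ∀ x, |f x| ≤ B :=
    ⟨max B 0, le_max_right _ _, fun x => (hB x).trans (le_max_left _ _)⟩
  let K : ℕ := 1 + ∑ i, (𝒱 i).ncard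
  have hK : ∀ i, (𝒱 i).ncard ≤ K := fun i =>
    (Finset.single_le_sum (f := fun i => (𝒱 i).ncard) (fun _ _ => Nat.zero_le _)
      (Finset.mem_univ i)).trans (Nat.le_add_left _ _)
  have hK1 : (1 : ℝ) ≤ K := by simp [K]; positivity
  have hKlog : 0 ≤ Real.log K := Real.log_nonneg hK1
  let s : ℝ := B + Real.log K * ∑ i, cw a i + 1
  let c : ℝ := B / a 0 + Real.log K * k
  have hcard : ∀ n : ℕ, ((jointFiber S a 𝒱 n).ncard : ℝ)
      ≤ Real.exp (Real.log K * (∑ i, cw a i) * n + Real.log K * k) := by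
    intro n
    have h1 : ((∑ i, ⌈cw a i * (n : ℝ)⌉₊ : ℕ) : ℝ) ≤ (∑ i, cw a i) * n + k := by
      push_cast
      calc ∑ i, (⌈cw a i * (n : ℝ)⌉₊ : ℝ) ≤ ∑ i, (cw a i * n + 1) :=
            Finset.sum_le_sum fun i _ => (Nat.ceil_lt_add_one
              (mul_nonneg (cw_nonneg ha i) n.cast_nonneg)).le
        _ = _ := by simp [Finset.sum_add_distrib, Finset.sum_mul]
    calc ((jointFiber S a 𝒱 n).ncard : ℝ) ≤ (K : ℝ) ^ ∑ i, ⌈cw a i * (n : ℝ)⌉₊ := by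
          exact_mod_cast ncard_jointFiber_le (fun i => (h𝒱 i).1) hK n
      _ = Real.exp (Real.log K * (∑ i, ⌈cw a i * (n : ℝ)⌉₊ : ℕ)) := by
          rw [mul_comm, Real.exp_nat_mul, Real.exp_log (by linarith)]
      _ ≤ _ := Real.exp_le_exp.2 ((mul_le_mul_of_nonneg_left h1 hKlog).trans_eq (by ring))
  have hle : ∀ N n : ℕ, N ≤ n → wLocN S a 𝒱 f s N univ
      ≤ ENNReal.ofReal (Real.exp (c - n)) := by
    intro N n hn
    refine (wLocN_le hS h𝒱 hn (pterm_le hB0 hB ha1 s n)).trans ?_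
    rw [← ENNReal.ofReal_natCast, ← ENNReal.ofReal_mul (by positivity)]
    refine ENNReal.ofReal_le_ofReal ?_
    refine (mul_le_mul_of_nonneg_right (hcard n) (Real.exp_nonneg _)).trans ?_
    rw [← Real.exp_add]
    refine Real.exp_le_exp.2 (le_of_eq ?_)
    simp only [s, c]
    ring
  refine ⟨s, ?_⟩
  refine le_antisymm (iSup_le fun N => ?_) bot_le
  have hlim : Tendsto (fun n : ℕ => ENNReal.ofReal (Real.exp (c - n))) atTop (𝓝 0) := by
    rw [← ENNReal.ofReal_zero]
    refine (ENNReal.continuous_ofReal.tendsto 0).comp (Real.tendsto_exp_atBot.comp ?_)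
    exact tendsto_atBot_add_const_left atTop c
      (tendsto_neg_atTop_atBot.comp tendsto_natCast_atTop_atTop)
  exact ge_of_tendsto hlim ((eventually_ge_atTop N).mono fun n hn => hle N n hn)

/-- Below the local average weighted pressure there is a measure satisfying a Frostman estimate. -/
lemma exists_measure_of_lt_PWLoc [NeZero k] [T2Space Y] [CompactSpace Y] (hS : Continuous S)
    (h𝒱 : ∀ i, IsOpenCover (𝒱 i)) {f : Y → ℝ} {s : ℝ}
    (hs : (s : EReal) < PWLoc S a 𝒱 univ f) :
    ∃ (δ : ℝ) (N : ℕ) (ν : Measure Y), 0 < δ ∧ IsProbabilityMeasure ν ∧ ∀ n, N ≤ n →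
      ∀ A, IsClopen A → (∃ J ∈ jointFiber S a 𝒱 n, A ⊆ J) →
        ν.real A ≤ δ⁻¹ *
          Real.exp (-(s * n) + (1 / a 0) * sSup (birk S f ⌈a 0 * (n : ℝ)⌉₊ '' A)) := by
  have h0 : wLoc S a 𝒱 f s univ ≠ 0 := fun h =>
    absurd hs (not_lt.2 (sInf_le ⟨s, h, rfl⟩))
  obtain ⟨N, hN⟩ : ∃ N, wLocN S a 𝒱 f s N univ ≠ 0 := by
    by_contra! h
    exact h0 (by simp [wLoc, h])
  let W := wLocN S a 𝒱 f s N univ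
  have hW1 : min W 1 ≠ ⊤ := ne_top_of_le_ne_top ENNReal.one_ne_top (min_le_right _ _)
  have hδ : 0 < (min W 1).toReal :=
    ENNReal.toReal_pos (lt_min (pos_iff_ne_zero.2 hN) one_pos).ne' hW1
  let Q := {q : ℕ × Set Y // N ≤ q.1 ∧ MeasurableSet q.2 ∧ ∃ J ∈ jointFiber S a 𝒱 q.1, q.2 ⊆ J}
  let w : Q → ℝ := fun q =>
    Real.exp (-(s * q.1.1) + (1 / a 0) * sSup (birk S f ⌈a 0 * (q.1.1 : ℝ)⌉₊ '' q.1.2))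
  have hfin := finite_jointFiber (S := S) (a := a) (fun i => (h𝒱 i).1) N
  have hcover : ∃ F : Finset Q, ∀ x, ∃ q ∈ F, x ∈ q.1.2 := by
    have hF : {q : Q | q.1 ∈ (fun A => (N, A)) '' jointFiber S a 𝒱 N}.Finite :=
      (hfin.image _).preimage Subtype.val_injective.injOn
    refine ⟨hF.toFinset, fun x => ?_⟩
    obtain ⟨A, hA, hx⟩ := exists_mem_jointFiber (S := S) (a := a) (fun i => (h𝒱 i).2.2) N x
    exact ⟨⟨(N, A), le_rfl,
      (isOpen_of_mem_jointFiber hS (fun i => (h𝒱 i).2.1) hA).measurableSet, A, hA, subset_rfl⟩,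
      hF.mem_toFinset.2 ⟨A, hA, rfl⟩, hx⟩
  have hcost : ∀ c : Q →₀ ℝ, (∀ q, 0 ≤ c q) →
      (∀ x, 1 ≤ Finsupp.linearCombination ℝ
        (fun q : Q => q.1.2.indicator (fun _ => (1 : ℝ)) x) c) →
      (min W 1).toReal ≤ Finsupp.linearCombination ℝ w c := by
    intro c hc hx
    have hsum0 : 0 ≤ ∑ q ∈ c.support, c q * w q :=
      Finset.sum_nonneg fun q _ => mul_nonneg (hc q) (Real.exp_pos _).le
    rw [Finsupp.linearCombination_apply, Finsupp.sum]
    simp only [smul_eq_mul]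
    refine ENNReal.toReal_le_of_le_ofReal hsum0 ((min_le_left W 1).trans ?_)
    let g : Q → ℕ × Set Y × ℝ≥0∞ := fun q => (q.1.1, q.1.2, ENNReal.ofReal (c q))
    have hg : InjOn g (c.support : Set Q) := fun q _ q' _ h =>
      Subtype.ext (Prod.ext (congrArg (fun p => p.1) h) (congrArg (fun p => p.2.1) h))
    refine (iInf₂_le (g '' (c.support : Set Q)) (c.support.finite_toSet.image g).countable).trans ?_
    refine (iInf₂_le ?_ ?_).trans (le_of_eq ?_)
    · rintro _ ⟨q, hq, rfl⟩
      exact ⟨q.2.1, q.2.2.1, ENNReal.ofReal_pos.2 ((hc q).lt_of_ne' (Finsupp.mem_support_iff.1 hq)),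
        ENNReal.ofReal_ne_top, q.2.2.2⟩
    · intro x _
      rw [tsum_image (fun p : ℕ × Set Y × ℝ≥0∞ => p.2.1.indicator (fun _ => p.2.2) x) hg,
        Finset.tsum_subtype' c.support
          (fun q => (g q).2.1.indicator (fun _ => (g q).2.2) x)]
      have h := hx x
      rw [Finsupp.linearCombination_apply, Finsupp.sum] at h
      have h' := ENNReal.ofReal_le_ofReal h
      rw [ENNReal.ofReal_one, ENNReal.ofReal_sum_of_nonneg fun q _ =>
        smul_nonneg (hc q) (indicator_nonneg (fun _ _ => zero_le_one) x)] at h'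
      refine h'.trans (Finset.sum_le_sum fun q _ => ?_)
      by_cases hq : x ∈ q.1.2 <;> simp [g, hq]
    · rw [tsum_image (fun p : ℕ × Set Y × ℝ≥0∞ => p.2.2 * pterm S f (a 0) s p.1 p.2.1) hg,
        Finset.tsum_subtype' c.support
          (fun q => (g q).2.2 * pterm S f (a 0) s (g q).1 (g q).2.1),
        ENNReal.ofReal_sum_of_nonneg fun q _ => mul_nonneg (hc q) (Real.exp_pos _).le]
      exact Finset.sum_congr rfl fun q _ => (ENNReal.ofReal_mul (hc q)).symm
  obtain ⟨ν, hν, hle⟩ := exists_measure_le_of_fractionalCover (fun q : Q => q.1.2) w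
    (fun q => (Real.exp_pos _).le) hcover hδ hcost
  exact ⟨_, N, ν, hδ, hν, fun n hn A hA hJ => hle ⟨(n, A), hn, hA.isOpen.measurableSet, hJ⟩ hA⟩

end LocalPressure

/-! ### Entropy of a measure satisfying a Frostman estimate -/

section EntropyLowerBound

lemma cw_zero [NeZero k] (a : Fin k → ℝ) : cw a 0 = a 0 := by
  have : Finset.Iic (0 : Fin k) = {0} := by
    ext i
    simp
  rw [cw, this, Finset.sum_singleton]

lemma cw_sub_eq (a : Fin k → ℝ) (i : Fin k) : cw a i - a i = ∑ j ∈ Finset.Iio i, a j := by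
  rw [cw, ← Finset.Iio_insert, Finset.sum_insert (by simp)]
  ring

lemma cw_sub_nonneg {a : Fin k → ℝ} (ha : ∀ i, 0 ≤ a i) (i : Fin k) : 0 ≤ cw a i - a i :=
  cw_sub_eq a i ▸ Finset.sum_nonneg fun j _ => ha j

lemma exists_cw_block (a : Fin k → ℝ) {x : ℝ} {l : ℕ} (i : Fin k) (hl : l < ⌈cw a i * x⌉₊) :
    ∃ j ≤ i, ⌈(cw a j - a j) * x⌉₊ ≤ l ∧ l < ⌈cw a j * x⌉₊ := by
  obtain ⟨j, hj, hmin⟩ := exists_minimal_le_of_wellFoundedLT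
    (fun j => l < ⌈cw a j * x⌉₊) i hl
  refine ⟨j, hj, ?_, hmin.prop⟩
  rw [cw_sub_eq]
  rcases Nat.eq_zero_or_pos j.1 with h0 | h0
  · have : Finset.Iio j = ∅ := by
      ext m
      simp [Fin.le_def, h0]
    simp [this]
  · let m : Fin k := ⟨j.1 - 1, by omega⟩
    have hm : m < j := Fin.lt_def.2 (by simp only [m]; omega)
    have : Finset.Iio j = Finset.Iic m := by
      ext q
      simp only [Finset.mem_Iio, Finset.mem_Iic, Fin.lt_def, Fin.le_def, m]
      omega
    rw [this]
    exact not_lt.1 fun h => hmin.not_prop_of_lt hm h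

variable {Y : Type*} {S : Y → Y} {a : Fin k → ℝ} {𝒱 : Fin k → Set (Set Y)}

lemma abs_sub_le_wfJoin {f : Y → ℝ} {B : ℝ} (hB : ∀ x, |f x| ≤ B) {V : Fin k → Set Y}
    (hV : ∀ i, V i ∈ 𝒱 i) {x y : Y} (hx : ∀ i, x ∈ V i) (hy : ∀ i, y ∈ V i) :
    |f x - f y| ≤ wfJoin f 𝒱 := by
  refine le_csSup ⟨B + B, ?_⟩ ⟨V, hV, x, mem_iInter.2 hx, y, mem_iInter.2 hy, rfl⟩
  rintro _ ⟨_, _, x, _, y, _, rfl⟩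
  exact (abs_sub _ _).trans (add_le_add (hB x) (hB y))

lemma wfJoin_nonneg (f : Y → ℝ) (𝒱 : Fin k → Set (Set Y)) : 0 ≤ wfJoin f 𝒱 := by
  refine Real.sSup_nonneg ?_
  rintro _ ⟨_, _, x, _, y, _, rfl⟩
  exact abs_nonneg _

variable {ι : Fin k → Type*} {φ : ∀ i, Y → ι i}

/-- The `i`-th block of the joint itinerary: times `⌈(a₁+…+a_{i-1})n⌉, …, ⌈(a₁+…+a_i)n⌉ - 1`. -/
noncomputable def blockItin (S : Y → Y) (a : Fin k → ℝ) (φ : ∀ i, Y → ι i) (n : ℕ) (x : Y)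
    (i : Fin k) :
    Fin (⌈cw a i * (n : ℝ)⌉₊ - ⌈(cw a i - a i) * (n : ℝ)⌉₊) → ι i :=
  itin S (φ i) ⌈(cw a i - a i) * (n : ℝ)⌉₊ (⌈cw a i * (n : ℝ)⌉₊ - ⌈(cw a i - a i) * (n : ℝ)⌉₊) x

lemma eq_of_blockItin_eq {n : ℕ} {x y : Y} (h : blockItin S a φ n y = blockItin S a φ n x)
    {i : Fin k} {l : ℕ} (h1 : ⌈(cw a i - a i) * (n : ℝ)⌉₊ ≤ l) (h2 : l < ⌈cw a i * (n : ℝ)⌉₊) :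
    φ i (S^[l] y) = φ i (S^[l] x) := by
  have h3 := congrFun (congrFun h i) ⟨l - ⌈(cw a i - a i) * (n : ℝ)⌉₊, by omega⟩
  simpa only [blockItin, itin, Nat.add_sub_cancel' h1] using h3

lemma exists_jointFiber_superset (hφ : ∀ i t, ∃ A ∈ joinFrom 𝒱 i, φ i ⁻¹' {t} ⊆ A)
    (n : ℕ) (x : Y) :
    ∃ J ∈ jointFiber S a 𝒱 n, blockItin S a φ n ⁻¹' {blockItin S a φ n x} ⊆ J := by
  choose A hA hsub using hφ
  choose W hW hAW using hA
  have hblock : ∀ (i : Fin k) (l : ℕ), ∃ j, l < ⌈cw a i * (n : ℝ)⌉₊ →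
      j ≤ i ∧ ⌈(cw a j - a j) * (n : ℝ)⌉₊ ≤ l ∧ l < ⌈cw a j * (n : ℝ)⌉₊ := by
    intro i l
    by_cases hl : l < ⌈cw a i * (n : ℝ)⌉₊
    · obtain ⟨j, hj⟩ := exists_cw_block a i hl
      exact ⟨j, fun _ => hj⟩
    · exact ⟨i, fun h => absurd h hl⟩
  choose j hj using hblock
  refine ⟨_, ⟨fun i l => W (j i l) (φ (j i l) (S^[l] x)) i,
    fun i l hl => hW _ _ _ (hj i l hl).1, rfl⟩, fun y hy => ?_⟩
  simp only [mem_iInter, mem_preimage, Finset.mem_range]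
  intro i l hl
  have h1 : S^[l] y ∈ A (j i l) (φ (j i l) (S^[l] x)) :=
    hsub _ _ (eq_of_blockItin_eq hy (hj i l hl).2.1 (hj i l hl).2.2)
  rw [hAW] at h1
  exact mem_iInter₂.1 h1 i (Finset.mem_Ici.2 (hj i l hl).1)

lemma birk_le_of_blockItin_eq [NeZero k] (hφ : ∀ i t, ∃ A ∈ joinFrom 𝒱 i, φ i ⁻¹' {t} ⊆ A)
    {f : Y → ℝ} {B : ℝ} (hB : ∀ x, |f x| ≤ B) {n : ℕ} {x y : Y}
    (h : blockItin S a φ n y = blockItin S a φ n x) :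
    birk S f ⌈a 0 * (n : ℝ)⌉₊ y
      ≤ ∑ l ∈ Finset.range ⌈a 0 * (n : ℝ)⌉₊, (f (S^[l] x) + wfJoin f 𝒱) := by
  refine Finset.sum_le_sum fun l hl => ?_
  have h1 := eq_of_blockItin_eq h (i := 0) (l := l) (by simp [cw_zero])
    (by simpa [cw_zero] using hl)
  obtain ⟨_, ⟨V, hV, rfl⟩, hsub⟩ := hφ 0 (φ 0 (S^[l] x))
  have h2 := abs_sub_le_wfJoin hB (V := V) (fun i => hV i (Fin.zero_le i)) (x := S^[l] y)
    (y := S^[l] x) (fun i => mem_iInter₂.1 (hsub h1) i (Finset.mem_Ici.2 (Fin.zero_le i)))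
    (fun i => mem_iInter₂.1 (hsub rfl) i (Finset.mem_Ici.2 (Fin.zero_le i)))
  linarith [le_abs_self (f (S^[l] y) - f (S^[l] x))]

lemma isClopen_blockItin_fiber [TopologicalSpace Y] (hS : Continuous S)
    (hφ : ∀ i t, IsClopen (φ i ⁻¹' {t}))
    (n : ℕ) (c : ∀ i, Fin (⌈cw a i * (n : ℝ)⌉₊ - ⌈(cw a i - a i) * (n : ℝ)⌉₊) → ι i) :
    IsClopen (blockItin S a φ n ⁻¹' {c}) := by
  have : blockItin S a φ n ⁻¹' {c}
      = ⋂ i, ⋂ l : Fin (⌈cw a i * (n : ℝ)⌉₊ - ⌈(cw a i - a i) * (n : ℝ)⌉₊),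
        (S^[⌈(cw a i - a i) * (n : ℝ)⌉₊ + (l : ℕ)]) ⁻¹' (φ i ⁻¹' {c i l}) := by
    ext x
    simp only [mem_preimage, mem_singleton_iff, mem_iInter, funext_iff]
    rfl
  rw [this]
  exact isClopen_iInter_of_finite fun i => isClopen_iInter_of_finite fun l =>
    (hφ i _).preimage (hS.iterate _)

variable [TopologicalSpace Y] [MeasurableSpace Y] [BorelSpace Y] [∀ i, Fintype (ι i)]
  [∀ i, MeasurableSpace (ι i)] [∀ i, MeasurableSingletonClass (ι i)]

lemma log_add_le_sum_labelEnt [NeZero k] [CompactSpace Y] (hS : Continuous S) (ha1 : 0 < a 0)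
    {f : Y → ℝ} (hf : Continuous f) {B : ℝ} (hB : ∀ x, |f x| ≤ B)
    (hφm : ∀ i, Measurable (φ i))
    (hφc : ∀ i t, IsClopen (φ i ⁻¹' {t}))
    (hφ : ∀ i t, ∃ A ∈ joinFrom 𝒱 i, φ i ⁻¹' {t} ⊆ A)
    {ν : Measure Y} [IsProbabilityMeasure ν] {s δ : ℝ} (hδ : 0 < δ) {n : ℕ}
    (hν : ∀ A, IsClopen A → (∃ J ∈ jointFiber S a 𝒱 n, A ⊆ J) → ν.real A ≤ δ⁻¹ *
      Real.exp (-(s * n) + (1 / a 0) * sSup (birk S f ⌈a 0 * (n : ℝ)⌉₊ '' A))) :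
    Real.log δ + (s * n - (1 / a 0) *
        ∑ j ∈ Finset.range ⌈a 0 * (n : ℝ)⌉₊, ((∫ x, f (S^[j] x) ∂ν) + wfJoin f 𝒱))
      ≤ ∑ i, labelEnt ν (itin S (φ i) ⌈(cw a i - a i) * (n : ℝ)⌉₊
          (⌈cw a i * (n : ℝ)⌉₊ - ⌈(cw a i - a i) * (n : ℝ)⌉₊)) := by
  classical
  have hm : ∀ i, Measurable fun x => blockItin S a φ n x i := fun i =>
    measurable_itin hS.measurable (hφm i) _ _
  refine le_trans ?_ (labelEnt_pi_le ν hm)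
  change _ ≤ labelEnt ν (blockItin S a φ n)
  have hmb : Measurable (blockItin S a φ n) := measurable_pi_lambda _ hm
  rw [labelEnt_eq_integral ν hmb]
  let G : Y → ℝ := fun x => ∑ j ∈ Finset.range ⌈a 0 * (n : ℝ)⌉₊, (f (S^[j] x) + wfJoin f 𝒱)
  have hint : ∀ j, Integrable (fun x => f (S^[j] x)) ν := fun j =>
    (hf.comp (hS.iterate j)).integrable_of_hasCompactSupport (HasCompactSupport.of_compactSpace _)
  have hint' : ∀ j, Integrable (fun x => f (S^[j] x) + wfJoin f 𝒱) ν := fun j =>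
    (hint j).add (integrable_const _)
  have hG : Integrable G ν := integrable_finsetSum _ fun j _ => hint' j
  have hGint : ∫ x, G x ∂ν
      = ∑ j ∈ Finset.range ⌈a 0 * (n : ℝ)⌉₊, ((∫ x, f (S^[j] x) ∂ν) + wfJoin f 𝒱) := by
    rw [integral_finsetSum _ fun j _ => hint' j]
    refine Finset.sum_congr rfl fun j _ => ?_
    rw [integral_add (hint j) (integrable_const _)]
    simp
  have hGs : Integrable (fun x => s * n - (1 / a 0) * G x) ν :=
    (integrable_const _).sub (hG.const_mul _)
  have hG' : Integrable (fun x => Real.log δ + (s * n - (1 / a 0) * G x)) ν :=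
    (integrable_const _).add hGs
  have hG'int : ∫ x, (Real.log δ + (s * n - (1 / a 0) * G x)) ∂ν
      = Real.log δ + (s * n - (1 / a 0) * ∫ x, G x ∂ν) := by
    rw [integral_add (integrable_const _) hGs,
      integral_sub (integrable_const _) (hG.const_mul _)]
    simp [integral_const_mul]
  rw [← hGint, ← hG'int]
  refine integral_mono_ae hG' (integrable_comp_label ν hmb
    fun t => -Real.log (ν.real (blockItin S a φ n ⁻¹' {t}))) ?_
  filter_upwards [ae_fiber_pos ν (blockItin S a φ n)] with x hx
  have h1 := hν _ (isClopen_blockItin_fiber hS hφc n _) (exists_jointFiber_superset hφ n x)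
  have h2 := Real.log_le_log hx h1
  rw [Real.log_mul (inv_pos.2 hδ).ne' (Real.exp_pos _).ne', Real.log_inv, Real.log_exp] at h2
  have h3 : sSup (birk S f ⌈a 0 * (n : ℝ)⌉₊ '' (blockItin S a φ n ⁻¹' {blockItin S a φ n x}))
      ≤ G x := by
    refine csSup_le ⟨_, x, rfl, rfl⟩ ?_
    rintro _ ⟨y, hy, rfl⟩
    exact birk_le_of_blockItin_eq hφ hB hy
  have h4 := mul_le_mul_of_nonneg_left h3 (one_div_pos.2 ha1).le
  linarith

lemma sum_range_sub_add {b : ℕ → ℝ} {m n : ℕ} (h : m ≤ n) :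
    ∑ j ∈ Finset.range (n - m), b (m + j)
      = ∑ j ∈ Finset.range n, b j - ∑ j ∈ Finset.range m, b j := by
  rw [← Finset.sum_Ico_eq_sum_range, Finset.sum_Ico_eq_sub _ h]

/-- The block entropies of a Frostman measure, compared with entropies of itineraries of the
fixed length `l`. -/
lemma exists_le_sum_labelEnt [NeZero k] [CompactSpace Y] [∀ i, Nonempty (ι i)]
    (hS : Continuous S) (ha1 : 0 < a 0) (ha : ∀ i, 0 ≤ a i)
    {f : Y → ℝ} (hf : Continuous f) {B : ℝ} (hB : ∀ x, |f x| ≤ B)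
    (hφm : ∀ i, Measurable (φ i))
    (hφc : ∀ i t, IsClopen (φ i ⁻¹' {t}))
    (hφ : ∀ i t, ∃ A ∈ joinFrom 𝒱 i, φ i ⁻¹' {t} ⊆ A)
    {ν : Measure Y} [IsProbabilityMeasure ν] {s δ : ℝ} (hδ : 0 < δ) {N : ℕ}
    (hν : ∀ n, N ≤ n → ∀ A, IsClopen A → (∃ J ∈ jointFiber S a 𝒱 n, A ⊆ J) → ν.real A ≤ δ⁻¹ *
      Real.exp (-(s * n) + (1 / a 0) * sSup (birk S f ⌈a 0 * (n : ℝ)⌉₊ '' A))) (l : ℕ) :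
    ∃ C, ∀ n : ℕ, l * (s * n - (1 / a 0) *
        ∑ j ∈ Finset.range ⌈a 0 * (n : ℝ)⌉₊, ((∫ x, f (S^[j] x) ∂ν) + wfJoin f 𝒱))
      ≤ ∑ i, (∑ j ∈ Finset.range ⌈cw a i * (n : ℝ)⌉₊, labelEnt ν (itin S (φ i) j l)
        - ∑ j ∈ Finset.range ⌈(cw a i - a i) * (n : ℝ)⌉₊, labelEnt ν (itin S (φ i) j l)) + C := by
  let D : ℕ → ℝ := fun n => l * (s * n - (1 / a 0) *
      ∑ j ∈ Finset.range ⌈a 0 * (n : ℝ)⌉₊, ((∫ x, f (S^[j] x) ∂ν) + wfJoin f 𝒱))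
    - ∑ i, (∑ j ∈ Finset.range ⌈cw a i * (n : ℝ)⌉₊, labelEnt ν (itin S (φ i) j l)
      - ∑ j ∈ Finset.range ⌈(cw a i - a i) * (n : ℝ)⌉₊, labelEnt ν (itin S (φ i) j l))
  let C₀ : ℝ := ∑ i, 3 * (l : ℝ) ^ 2 * Real.log (Fintype.card (ι i)) - l * Real.log δ
  have hlarge : ∀ n, N ≤ n → D n ≤ C₀ := by
    intro n hn
    have h1 := mul_le_mul_of_nonneg_left
      (log_add_le_sum_labelEnt hS ha1 hf hB hφm hφc hφ hδ (hν n hn)) (Nat.cast_nonneg (α := ℝ) l)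
    have h2 : ∀ i, (l : ℝ) * labelEnt ν (itin S (φ i) ⌈(cw a i - a i) * (n : ℝ)⌉₊
          (⌈cw a i * (n : ℝ)⌉₊ - ⌈(cw a i - a i) * (n : ℝ)⌉₊))
        ≤ (∑ j ∈ Finset.range ⌈cw a i * (n : ℝ)⌉₊, labelEnt ν (itin S (φ i) j l)
          - ∑ j ∈ Finset.range ⌈(cw a i - a i) * (n : ℝ)⌉₊, labelEnt ν (itin S (φ i) j l))
          + 3 * (l : ℝ) ^ 2 * Real.log (Fintype.card (ι i)) := by
      intro i
      have hle : ⌈(cw a i - a i) * (n : ℝ)⌉₊ ≤ ⌈cw a i * (n : ℝ)⌉₊ :=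
        Nat.ceil_le_ceil (mul_le_mul_of_nonneg_right (by linarith [ha i]) n.cast_nonneg)
      rw [← sum_range_sub_add (b := fun j => labelEnt ν (itin S (φ i) j l)) hle]
      exact mul_labelEnt_itin_le ν hS.measurable (hφm i) _ l _
    have h3 := Finset.sum_le_sum fun i (_ : i ∈ Finset.univ) => h2 i
    rw [← Finset.mul_sum, Finset.sum_add_distrib] at h3
    simp only [D, C₀]
    linarith
  refine ⟨|C₀| + ∑ n ∈ Finset.range N, |D n|, fun n => ?_⟩
  suffices D n ≤ |C₀| + ∑ n ∈ Finset.range N, |D n| by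
    simp only [D] at this ⊢
    linarith
  rcases lt_or_ge n N with hn | hn
  · have h := Finset.single_le_sum (f := fun n => |D n|) (fun _ _ => abs_nonneg _)
      (Finset.mem_range.2 hn)
    linarith [le_abs_self (D n), abs_nonneg C₀]
  · have h : 0 ≤ ∑ n ∈ Finset.range N, |D n| := Finset.sum_nonneg fun _ _ => abs_nonneg _
    linarith [le_abs_self C₀, hlarge n hn]

end EntropyLowerBound

section LogAverageInequality

lemma sum_weight_mul_succ (R : ℕ) :
    ∑ n ∈ Finset.range R, 1 / (((n : ℝ) + 1) * (n + 2)) * ((n + 1 : ℕ) : ℝ)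
      = ∑ j ∈ Finset.range R, 1 / ((j : ℝ) + 1) - 1 + 1 / ((R : ℝ) + 1) := by
  induction R with
  | zero => simp
  | succ R ih =>
    rw [Finset.sum_range_succ, ih, Finset.sum_range_succ]
    push_cast
    field_simp
    ring

/-- Logarithmic averaging of a family of inequalities between partial sums. -/
lemma exists_logAverage_le [NeZero k] {a : Fin k → ℝ} (ha1 : 0 < a 0) (ha : ∀ i, 0 ≤ a i)
    {F : ℕ → ℝ} {b : Fin k → ℕ → ℝ} {B : ℝ} (hF : ∀ j, |F j| ≤ B)
    (hb : ∀ i j, |b i j| ≤ B) {l s C : ℝ} (hl : 0 ≤ l)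
    (h : ∀ n : ℕ, l * (s * n - (1 / a 0) * ∑ j ∈ Finset.range ⌈a 0 * (n : ℝ)⌉₊, F j)
      ≤ ∑ i, (∑ j ∈ Finset.range ⌈cw a i * (n : ℝ)⌉₊, b i j
        - ∑ j ∈ Finset.range ⌈(cw a i - a i) * (n : ℝ)⌉₊, b i j) + C) :
    ∃ C', ∀ R, l * (s * ∑ j ∈ Finset.range R, 1 / ((j : ℝ) + 1)
        - ∑ j ∈ Finset.range R, F j / ((j : ℝ) + 1))
      ≤ ∑ i, a i * ∑ j ∈ Finset.range R, b i j / ((j : ℝ) + 1) + C' := by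
  obtain ⟨C₁, hC₁⟩ := exists_abs_logAverage_sub_le ha1.le
  choose C₂ hC₂ using fun i => exists_abs_logAverage_sub_le (cw_nonneg ha i)
  choose C₃ hC₃ using fun i => exists_abs_logAverage_sub_le (cw_sub_nonneg ha i)
  refine ⟨|C| + |l * s| + l * (1 / a 0) * (C₁ * B) + ∑ i, (C₂ i + C₃ i) * B, fun R => ?_⟩
  let Z : ℝ := ∑ j ∈ Finset.range R, 1 / ((j : ℝ) + 1)
  let av : (ℕ → ℝ) → ℝ → ℝ := fun b t => ∑ n ∈ Finset.range R, 1 / (((n : ℝ) + 1) * (n + 2)) *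
    ∑ j ∈ Finset.range ⌈t * ((n + 1 : ℕ) : ℝ)⌉₊, b j
  let L : (ℕ → ℝ) → ℝ := fun b => ∑ j ∈ Finset.range R, b j / ((j : ℝ) + 1)
  have hω : ∀ n : ℕ, 0 ≤ 1 / (((n : ℝ) + 1) * (n + 2)) := fun n => by positivity
  have hsum := Finset.sum_le_sum fun n (_ : n ∈ Finset.range R) =>
    mul_le_mul_of_nonneg_left (h (n + 1)) (hω n)
  have hleft : ∑ n ∈ Finset.range R, 1 / (((n : ℝ) + 1) * (n + 2)) *
        (l * (s * ((n + 1 : ℕ) : ℝ)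
          - (1 / a 0) * ∑ j ∈ Finset.range ⌈a 0 * ((n + 1 : ℕ) : ℝ)⌉₊, F j))
      = l * s * (Z - 1 + 1 / ((R : ℝ) + 1)) - l * (1 / a 0) * av F (a 0) := by
    simp only [Z, av]
    rw [← sum_weight_mul_succ, Finset.mul_sum, Finset.mul_sum, ← Finset.sum_sub_distrib]
    exact Finset.sum_congr rfl fun n _ => by ring
  have hright : ∑ n ∈ Finset.range R, 1 / (((n : ℝ) + 1) * (n + 2)) *
        (∑ i, (∑ j ∈ Finset.range ⌈cw a i * ((n + 1 : ℕ) : ℝ)⌉₊, b i j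
          - ∑ j ∈ Finset.range ⌈(cw a i - a i) * ((n + 1 : ℕ) : ℝ)⌉₊, b i j) + C)
      = ∑ i, (av (b i) (cw a i) - av (b i) (cw a i - a i))
        + C * ∑ n ∈ Finset.range R, 1 / (((n : ℝ) + 1) * (n + 2)) := by
    simp only [av, ← Finset.sum_sub_distrib, ← mul_sub]
    rw [Finset.sum_comm, Finset.mul_sum, ← Finset.sum_add_distrib]
    refine Finset.sum_congr rfl fun n _ => ?_
    rw [mul_add, Finset.mul_sum]
    ring
  rw [hleft, hright] at hsum
  have h1 := (abs_le.1 (hC₁ B F hF R)).2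
  have h2 : ∑ i, (av (b i) (cw a i) - av (b i) (cw a i - a i))
      ≤ ∑ i, a i * L (b i) + ∑ i, (C₂ i + C₃ i) * B := by
    rw [← Finset.sum_add_distrib]
    refine Finset.sum_le_sum fun i _ => ?_
    have h3 := (abs_le.1 (hC₂ i B (b i) (hb i) R)).2
    have h4 := (abs_le.1 (hC₃ i B (b i) (hb i) R)).1
    simp only [av, L]
    linarith
  have h5 : C * ∑ n ∈ Finset.range R, 1 / (((n : ℝ) + 1) * (n + 2)) ≤ |C| := by
    have h6 : 0 ≤ ∑ n ∈ Finset.range R, 1 / (((n : ℝ) + 1) * (n + 2)) :=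
      Finset.sum_nonneg fun n _ => hω n
    calc _ ≤ |C| * ∑ n ∈ Finset.range R, 1 / (((n : ℝ) + 1) * (n + 2)) :=
          mul_le_mul_of_nonneg_right (le_abs_self C) h6
      _ ≤ |C| * 1 := mul_le_mul_of_nonneg_left (sum_inv_mul_le R) (abs_nonneg C)
      _ = |C| := mul_one _
  have h7 : l * s * (1 - 1 / ((R : ℝ) + 1)) ≤ |l * s| := by
    have h8 : 0 ≤ 1 / ((R : ℝ) + 1) := by positivity
    have h9 : 1 / ((R : ℝ) + 1) ≤ 1 := by
      rw [div_le_one (by positivity)]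
      linarith [R.cast_nonneg (α := ℝ)]
    calc _ ≤ |l * s| * (1 - 1 / ((R : ℝ) + 1)) :=
          mul_le_mul_of_nonneg_right (le_abs_self _) (by linarith)
      _ ≤ |l * s| * 1 := mul_le_mul_of_nonneg_left (by linarith) (abs_nonneg _)
      _ = _ := mul_one _
  have h10 : l * (1 / a 0) * (av F (a 0)) ≤ l * L F + l * (1 / a 0) * (C₁ * B) := by
    have h11 := mul_le_mul_of_nonneg_left h1 (mul_nonneg hl (one_div_pos.2 ha1).le)
    have h12 : l * (1 / a 0) * (a 0 * L F) = l * L F := by field_simp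
    simp only [av, L] at h12 ⊢
    linarith
  simp only [Z, L] at *
  linarith

end LogAverageInequality

/-! ### Invariant limits of logarithmic averages -/

section LogMean

/-- The logarithmic mean of the first `R + 1` terms of a sequence. -/
noncomputable def logMean (b : ℕ → ℝ) (R : ℕ) : ℝ :=
  (∑ j ∈ Finset.range (R + 1), b j / ((j : ℝ) + 1)) / ∑ j ∈ Finset.range (R + 1), 1 / ((j : ℝ) + 1)

lemma sum_inv_succ_pos (R : ℕ) : 0 < ∑ j ∈ Finset.range (R + 1), 1 / ((j : ℝ) + 1) :=
  Finset.sum_pos (fun j _ => by positivity) ⟨0, by simp⟩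

lemma tendsto_div_sum_inv_succ (C : ℝ) :
    Tendsto (fun R : ℕ => C / ∑ j ∈ Finset.range (R + 1), 1 / ((j : ℝ) + 1)) atTop (𝓝 0) :=
  (Real.tendsto_sum_range_one_div_nat_succ_atTop.comp (tendsto_add_atTop_nat 1)).const_div_atTop C

lemma logMean_add (b c : ℕ → ℝ) (R : ℕ) :
    logMean (fun j => b j + c j) R = logMean b R + logMean c R := by
  simp only [logMean, add_div, Finset.sum_add_distrib]

lemma logMean_mul_left (r : ℝ) (b : ℕ → ℝ) (R : ℕ) :
    logMean (fun j => r * b j) R = r * logMean b R := by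
  simp only [logMean, mul_div_assoc]
  rw [← mul_div_assoc, Finset.mul_sum]

lemma logMean_const (r : ℝ) (R : ℕ) : logMean (fun _ => r) R = r := by
  have h := logMean_mul_left r (fun _ => 1) R
  simp only [mul_one] at h
  rw [h, logMean, div_self (sum_inv_succ_pos R).ne', mul_one]

lemma logMean_mono {b c : ℕ → ℝ} (h : ∀ j, b j ≤ c j) (R : ℕ) : logMean b R ≤ logMean c R :=
  div_le_div_of_nonneg_right (Finset.sum_le_sum fun j _ =>
    div_le_div_of_nonneg_right (h j) (by positivity)) (sum_inv_succ_pos R).le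

lemma logMean_finset_sum {κ : Type*} (s : Finset κ) (b : κ → ℕ → ℝ) (R : ℕ) :
    logMean (fun j => ∑ t ∈ s, b t j) R = ∑ t ∈ s, logMean (b t) R := by
  simp only [logMean, Finset.sum_div]
  rw [Finset.sum_comm]

lemma logMean_negMulLog_le {b : ℕ → ℝ} (hb : ∀ j, 0 ≤ b j) (R : ℕ) :
    logMean (fun j => Real.negMulLog (b j)) R ≤ Real.negMulLog (logMean b R) := by
  have h := Real.concaveOn_negMulLog.le_map_sum (t := Finset.range (R + 1))
    (w := fun j : ℕ => 1 / ((j : ℝ) + 1) / ∑ j ∈ Finset.range (R + 1), 1 / ((j : ℝ) + 1)) (p := b)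
    (fun j _ => div_nonneg (by positivity) (sum_inv_succ_pos R).le)
    (by rw [← Finset.sum_div, div_self (sum_inv_succ_pos R).ne']) (fun j _ => hb j)
  have hmean : ∀ c : ℕ → ℝ, logMean c R = ∑ j ∈ Finset.range (R + 1),
      (1 / ((j : ℝ) + 1) / ∑ j ∈ Finset.range (R + 1), 1 / ((j : ℝ) + 1)) • c j := by
    intro c
    rw [logMean, Finset.sum_div]
    exact Finset.sum_congr rfl fun j _ => by rw [smul_eq_mul]; ring
  rw [hmean, hmean]
  exact h

lemma tendsto_logMean_sub_succ {b : ℕ → ℝ} {B : ℝ} (hb : ∀ j, |b j| ≤ B) :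
    Tendsto (fun R => logMean b R - logMean (fun j => b (j + 1)) R) atTop (𝓝 0) := by
  refine squeeze_zero_norm (fun R => ?_) (tendsto_div_sum_inv_succ (3 * B))
  rw [Real.norm_eq_abs, logMean, logMean, ← sub_div, ← Finset.sum_sub_distrib, abs_div,
    abs_of_pos (sum_inv_succ_pos R)]
  refine div_le_div_of_nonneg_right ?_ (sum_inv_succ_pos R).le
  simpa only [sub_div] using abs_sum_succ_sub_div_le hb (R + 1)

/-- The logarithmic means of the push-forwards of a measure have an invariant limit. -/
lemma exists_invariant_limit {Y : Type*} [MetricSpace Y] [CompactSpace Y] [MeasurableSpace Y]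
    [BorelSpace Y] {S : Y → Y} (hS : Continuous S) (ν : Measure Y) [IsProbabilityMeasure ν] :
    ∃ μ : Measure Y, IsProbabilityMeasure μ ∧ μ.map S = μ ∧ ∀ g : C(Y, ℝ),
      Tendsto (logMean fun j => ∫ x, g (S^[j] x) ∂ν) (hyperfilter ℕ) (𝓝 (∫ x, g x ∂μ)) := by
  have hint : ∀ (g : C(Y, ℝ)) j, Integrable (fun x => g (S^[j] x)) ν := fun g j =>
    (g.continuous.comp (hS.iterate j)).integrable_of_hasCompactSupport
      (HasCompactSupport.of_compactSpace _)
  have hbd : ∀ (g : C(Y, ℝ)) j, |∫ x, g (S^[j] x) ∂ν| ≤ ‖g‖ := by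
    intro g j
    have h := norm_integral_le_of_norm_le_const (μ := ν) (f := fun x => g (S^[j] x)) (C := ‖g‖)
      (Eventually.of_forall fun x => g.norm_coe_le_norm _)
    simpa using h
  have hex : ∀ g : C(Y, ℝ), ∃ r, Tendsto (logMean fun j => ∫ x, g (S^[j] x) ∂ν)
      (hyperfilter ℕ) (𝓝 r) := by
    intro g
    have hmem : ∀ R, (logMean fun j => ∫ x, g (S^[j] x) ∂ν) R ∈ Icc (-‖g‖) ‖g‖ := by
      intro R
      constructor
      · exact (logMean_const (-‖g‖) R).symm.le.trans
          (logMean_mono (fun j => (abs_le.1 (hbd g j)).1) R)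
      · exact (logMean_mono (fun j => (abs_le.1 (hbd g j)).2) R).trans (logMean_const ‖g‖ R).le
    obtain ⟨r, -, hr⟩ := (isCompact_Icc (a := -‖g‖) (b := ‖g‖)).ultrafilter_le_nhds
      ((hyperfilter ℕ).map (logMean fun j => ∫ x, g (S^[j] x) ∂ν))
      (tendsto_principal.2 (Eventually.of_forall hmem))
    exact ⟨r, hr⟩
  choose L hL using hex
  have hadd : ∀ g h, L (g + h) = L g + L h := by
    intro g h
    refine tendsto_nhds_unique (hL (g + h)) (((hL g).add (hL h)).congr fun R => ?_)
    rw [← logMean_add]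
    refine congrArg (fun b => logMean b R) (funext fun j => ?_)
    exact (integral_add (hint g j) (hint h j)).symm
  have hsmul : ∀ (r : ℝ) g, L (r • g) = r • L g := by
    intro r g
    refine tendsto_nhds_unique (hL (r • g)) (((hL g).const_mul r).congr fun R => ?_)
    rw [← logMean_mul_left]
    refine congrArg (fun b => logMean b R) (funext fun j => ?_)
    exact (integral_const_mul r _).symm
  obtain ⟨μ, hμ, hμL⟩ := exists_measure_of_nonneg_functional
    { toFun := L, map_add' := hadd, map_smul' := hsmul } fun g hg => by
      refine ge_of_tendsto' (hL g) fun R => ?_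
      rw [← logMean_const 0 R]
      exact logMean_mono (fun j => integral_nonneg fun x => hg _) R
  have hlim : ∀ g : C(Y, ℝ), Tendsto (logMean fun j => ∫ x, g (S^[j] x) ∂ν)
      (hyperfilter ℕ) (𝓝 (∫ x, g x ∂μ)) := fun g => (hμL g).symm ▸ hL g
  refine ⟨μ, ?_, ?_, hlim⟩
  · have h1 := tendsto_nhds_unique (hlim 1) (tendsto_const_nhds (x := (1 : ℝ)) |>.congr fun R => by
      simp [logMean_const])
    refine ⟨(ENNReal.toReal_eq_one_iff _).1 ?_⟩
    simpa [measureReal_def] using h1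
  · have : IsFiniteMeasure (μ.map S) := by infer_instance
    refine ext_of_forall_integral_eq_of_IsFiniteMeasure fun g => ?_
    rw [integral_map hS.measurable.aemeasurable g.continuous.aestronglyMeasurable]
    let g₀ : C(Y, ℝ) := g.toContinuousMap
    let g₁ : C(Y, ℝ) := g₀.comp ⟨S, hS⟩
    have h0 := ((hlim g₀).sub (hlim g₁)).sub
      ((tendsto_logMean_sub_succ (hbd g₀)).mono_left Nat.hyperfilter_le_atTop)
    have h1 := tendsto_nhds_unique h0 (tendsto_const_nhds (x := (0 : ℝ)) |>.congr fun R => by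
      have : (fun j => ∫ x, g₁ (S^[j] x) ∂ν) = fun j => ∫ x, g₀ (S^[j + 1] x) ∂ν := by
        simp only [Function.iterate_succ_apply']
        rfl
      rw [this, sub_self])
    rw [sub_zero] at h1
    exact (sub_eq_zero.1 h1).symm

end LogMean

/-! ### The invariant measure -/

section InvariantMeasure

lemma itin_eq_comp_iterate {Y ι : Type*} {S : Y → Y} (φ : Y → ι) (j l : ℕ) :
    itin S φ j l = fun x => itin S φ 0 l (S^[j] x) := by
  ext x h
  simp only [itin, zero_add]
  rw [add_comm, Function.iterate_add_apply]

variable [NeZero k] {Y : Type*} [MetricSpace Y] [CompactSpace Y] [MeasurableSpace Y]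
  [BorelSpace Y] {S : Y → Y} {a : Fin k → ℝ} {𝒱 : Fin k → Set (Set Y)}

lemma exists_invariant_measure_le_entropy (hS : Continuous S) (ha1 : 0 < a 0) (ha : ∀ i, 0 ≤ a i)
    (h𝒱 : ∀ i, IsOpenCover (𝒱 i)) {f : Y → ℝ} (hf : Continuous f) {s : ℝ}
    (hs : (s : EReal) < PWLoc S a 𝒱 univ f) :
    ∃ μ : Measure Y, IsProbabilityMeasure μ ∧ μ.map S = μ ∧
      ∀ (ι : Fin k → Type) [∀ i, Fintype (ι i)] (φ : ∀ i, Y → ι i),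
        (∀ i t, IsClopen (φ i ⁻¹' {t})) → (∀ i t, ∃ A ∈ joinFrom 𝒱 i, φ i ⁻¹' {t} ⊆ A) →
        ∀ l : ℕ, l * (s - wfJoin f 𝒱 - ∫ x, f x ∂μ)
          ≤ ∑ i, a i * labelEnt μ (itin S (φ i) 0 l) := by
  obtain ⟨δ, N, ν, hδ, hν, hle⟩ := exists_measure_of_lt_PWLoc hS h𝒱 hs
  obtain ⟨μ, hμ, hinv, hlim⟩ := exists_invariant_limit hS ν
  refine ⟨μ, hμ, hinv, fun ι _ φ hφc hφ l => ?_⟩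
  let f₀ : C(Y, ℝ) := ⟨f, hf⟩
  have hB : ∀ x, |f x| ≤ ‖f₀‖ := fun x => f₀.norm_coe_le_norm x
  have hY : Nonempty Y := nonempty_of_isProbabilityMeasure μ
  have hne : ∀ i, Nonempty (ι i) := fun i => hY.map (φ i)
  let _ : ∀ i, MeasurableSpace (ι i) := fun _ => ⊤
  have hφm : ∀ i, Measurable (φ i) := fun i =>
    measurable_to_countable' fun t => (hφc i t).isOpen.measurableSet
  obtain ⟨C, hC⟩ := exists_le_sum_labelEnt hS ha1 ha hf hB hφm hφc hφ hδ hle l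
  let F : ℕ → ℝ := fun j => (∫ x, f (S^[j] x) ∂ν) + wfJoin f 𝒱
  let b : Fin k → ℕ → ℝ := fun i j => labelEnt ν (itin S (φ i) j l)
  let B : ℝ := ‖f₀‖ + wfJoin f 𝒱 + ∑ i, l * Real.log (Fintype.card (ι i))
  have hlog : ∀ i, 0 ≤ l * Real.log (Fintype.card (ι i)) := fun i =>
    mul_nonneg l.cast_nonneg (Real.log_natCast_nonneg _)
  have hF : ∀ j, |F j| ≤ B := by
    intro j
    have h1 : |∫ x, f (S^[j] x) ∂ν| ≤ ‖f₀‖ := by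
      have h := norm_integral_le_of_norm_le_const (μ := ν) (f := fun x => f (S^[j] x)) (C := ‖f₀‖)
        (Eventually.of_forall fun x => hB _)
      simpa using h
    have h2 := Finset.sum_nonneg fun i (_ : i ∈ Finset.univ) => hlog i
    refine (abs_add_le _ _).trans ?_
    rw [abs_of_nonneg (wfJoin_nonneg f 𝒱)]
    simp only [B]
    linarith
  have hb : ∀ i j, |b i j| ≤ B := by
    intro i j
    rw [abs_of_nonneg (labelEnt_nonneg ν _)]
    have h1 := labelEnt_itin_le ν hS.measurable (hφm i) j l
    have h2 := Finset.single_le_sum (fun i _ => hlog i) (Finset.mem_univ i)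
    simp only [B]
    linarith [norm_nonneg f₀, wfJoin_nonneg f 𝒱]
  obtain ⟨C', hC'⟩ := exists_logAverage_le ha1 ha hF hb l.cast_nonneg hC
  have hmean : ∀ R, l * (s - (logMean (fun j => ∫ x, f₀ (S^[j] x) ∂ν) R + wfJoin f 𝒱))
      ≤ ∑ i, a i * ∑ t, Real.negMulLog
          (logMean (fun j => ν.real (S^[j] ⁻¹' (itin S (φ i) 0 l ⁻¹' {t}))) R)
        + C' / ∑ j ∈ Finset.range (R + 1), 1 / ((j : ℝ) + 1) := by
    intro R
    have hZ := sum_inv_succ_pos R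
    have h1 := div_le_div_of_nonneg_right (hC' (R + 1)) hZ.le
    rw [mul_div_assoc, sub_div, mul_div_assoc, div_self hZ.ne', mul_one, add_div,
      Finset.sum_div (Finset.univ : Finset (Fin k))] at h1
    have h2 : logMean F R = logMean (fun j => ∫ x, f₀ (S^[j] x) ∂ν) R + wfJoin f 𝒱 := by
      rw [← logMean_const (wfJoin f 𝒱) R, ← logMean_add]
      rfl
    rw [← h2]
    refine h1.trans (add_le_add_left (Finset.sum_le_sum fun i _ => ?_) _)
    rw [mul_div_assoc]
    refine mul_le_mul_of_nonneg_left ?_ (ha i)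
    change logMean (b i) R ≤ _
    have h3 : b i = fun j => ∑ t, Real.negMulLog
        (ν.real (S^[j] ⁻¹' (itin S (φ i) 0 l ⁻¹' {t}))) := by
      funext j
      simp only [b, itin_eq_comp_iterate (φ i) j l]
      rfl
    rw [h3, logMean_finset_sum]
    exact Finset.sum_le_sum fun t _ => logMean_negMulLog_le (fun j => measureReal_nonneg) R
  have hclopen : ∀ i t, IsClopen (itin S (φ i) 0 l ⁻¹' {t}) := by
    intro i t
    have : itin S (φ i) 0 l ⁻¹' {t}
        = ⋂ h : Fin l, (S^[0 + (h : ℕ)]) ⁻¹' (φ i ⁻¹' {t h}) := by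
      ext x
      simp only [mem_preimage, mem_singleton_iff, mem_iInter, funext_iff]
      rfl
    rw [this]
    exact isClopen_iInter_of_finite fun h => (hφc i _).preimage (hS.iterate _)
  have hlimE : ∀ E : Set Y, IsClopen E →
      Tendsto (logMean fun j => ν.real (S^[j] ⁻¹' E)) (hyperfilter ℕ) (𝓝 (μ.real E)) := by
    intro E hE
    have h := hlim ⟨E.indicator 1, hE.continuous_indicator continuous_const⟩
    simp only [ContinuousMap.coe_mk] at h
    rw [integral_indicator_one hE.isOpen.measurableSet] at h
    have h2 : (fun j => ∫ x, E.indicator (1 : Y → ℝ) (S^[j] x) ∂ν)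
        = fun j => ν.real (S^[j] ⁻¹' E) := by
      funext j
      exact integral_indicator_one (hE.preimage (hS.iterate j)).isOpen.measurableSet
    rwa [h2] at h
  have hT1 := ((tendsto_const_nhds (x := s)).sub ((hlim f₀).add
    (tendsto_const_nhds (x := wfJoin f 𝒱)))).const_mul (l : ℝ)
  have hT2 := (tendsto_finsetSum Finset.univ fun i _ => (tendsto_finsetSum Finset.univ
    fun t _ => (Real.continuous_negMulLog.tendsto _).comp
      (hlimE _ (hclopen i t))).const_mul (a i)).add
    ((tendsto_div_sum_inv_succ C').mono_left Nat.hyperfilter_le_atTop)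
  have hfin := le_of_tendsto_of_tendsto' hT1 hT2 hmean
  rw [add_zero] at hfin
  refine le_trans (le_of_eq ?_) hfin
  simp only [f₀, ContinuousMap.coe_mk]
  ring

end InvariantMeasure

/-! ### Partitions and labels -/

section Partition

lemma exists_label_of_isPart {Y ι : Type*} [MeasurableSpace Y] {β : ι → Set Y} (hβ : IsPart β) :
    ∃ φ : Y → ι, ∀ t, φ ⁻¹' {t} = β t := by
  have h : ∀ x, ∃ t, x ∈ β t := fun x => mem_iUnion.1 (hβ.2.2 ▸ mem_univ x)
  choose φ hφ using h
  refine ⟨φ, fun t => Subset.antisymm ?_ fun x hx => ?_⟩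
  · rintro x rfl
    exact hφ x
  · by_contra hne
    exact disjoint_left.1 (hβ.2.1 _ _ hne) (hφ x) hx

lemma entH_dynJoin_eq_labelEnt {Y ι : Type*} [MeasurableSpace Y] [Fintype ι] (μ : Measure Y)
    (S : Y → Y) {β : ι → Set Y} {φ : Y → ι} (hφ : ∀ t, φ ⁻¹' {t} = β t) (l : ℕ) :
    entH μ (dynJoin S β l) = labelEnt μ (itin S φ 0 l) := by
  refine Finset.sum_congr rfl fun c _ => ?_
  have : dynJoin S β l c = itin S φ 0 l ⁻¹' {c} := by
    ext x
    simp only [dynJoin, ← hφ, itin, zero_add, mem_iInter, mem_preimage, mem_singleton_iff,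
      funext_iff]
  rw [this, measureReal_def]

end Partition

lemma ereal_coe_sum {κ : Type*} (s : Finset κ) (g : κ → ℝ) :
    ((∑ i ∈ s, g i : ℝ) : EReal) = ∑ i ∈ s, (g i : EReal) := by
  classical
  induction s using Finset.induction_on with
  | empty => simp
  | insert i s hi ih => rw [Finset.sum_insert hi, Finset.sum_insert hi, EReal.coe_add, ih]

lemma exists_PWLoc_eq_coe [NeZero k] {Y : Type*} [TopologicalSpace Y] [CompactSpace Y]
    [MeasurableSpace Y] [BorelSpace Y] {S : Y → Y} {a : Fin k → ℝ} {𝒱 : Fin k → Set (Set Y)}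
    (hS : Continuous S) (h𝒱 : ∀ i, IsOpenCover (𝒱 i)) (ha1 : 0 < a 0) (ha : ∀ i, 0 ≤ a i)
    {f : Y → ℝ} (hf : Continuous f) (hpos : (0 : EReal) < PWLoc S a 𝒱 univ f) :
    ∃ h : ℝ, PWLoc S a 𝒱 univ f = h := by
  have hB : ∀ x, |f x| ≤ ‖(⟨f, hf⟩ : C(Y, ℝ))‖ :=
    fun x => (⟨f, hf⟩ : C(Y, ℝ)).norm_coe_le_norm x
  obtain ⟨s, hs⟩ := exists_wLoc_eq_zero hS h𝒱 ha1 ha hB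
  have htop : PWLoc S a 𝒱 univ f ≠ ⊤ :=
    ne_top_of_le_ne_top (EReal.coe_ne_top s) (sInf_le ⟨s, hs, rfl⟩)
  exact ⟨_, (EReal.coe_toReal htop ((EReal.bot_lt_coe 0).trans hpos).ne').symm⟩

/-- (the claim `M(l) ≠ ∅`) Assume `T₁` is invertible, `X₁` is
zero-dimensional, and `h = P_W^𝐚(T₁, X₁, {𝒰_i}, f) > 0`. Then for every `l ≥ 1` there is
`μ ∈ M(X₁,T₁)` such that for every choice of clopen partitions
`β_i ∈ (⋁_{j=i}^k τ_{j-1}^{-1}𝒰_j)^*`, one has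
`∑_i a_i H_μ(⋁_{h'<l} T₁^{-h'} β_i) ≥ l(h − 2 w_f(⋁ τ_{i-1}^{-1}𝒰_i) − ∫ f dμ) − 1 − k (∑_i a_i) log 2`. -/
theorem claim_Ml_nonempty
    {k : ℕ} [NeZero k]
    (X : Fin k → Type) [∀ i, MetricSpace (X i)] [∀ i, CompactSpace (X i)]
    [∀ i, MeasurableSpace (X i)] [∀ i, BorelSpace (X i)]
    (T : ∀ i, X i → X i) (hT : ∀ i, Continuous (T i))
    (τ : ∀ i, X 0 → X i) (hτ0 : τ 0 = id)
    (hτc : ∀ i, Continuous (τ i)) (hτs : ∀ i, Function.Surjective (τ i))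
    (hτe : ∀ i, τ i ∘ T 0 = T i ∘ τ i)
    (hchain : ∀ i j : Fin k, i ≤ j → ∃ p : X i → X j,
        Continuous p ∧ p ∘ T i = T j ∘ p ∧ p ∘ τ i = τ j)
    (a : Fin k → ℝ) (ha1 : 0 < a 0) (ha : ∀ i, 0 ≤ a i)
    (hbij : Function.Bijective (T 0)) (hzdim : TotallyDisconnectedSpace (X 0))
    (𝒰 : ∀ i, Set (Set (X i))) (h𝒰 : ∀ i, IsOpenCover (𝒰 i))
    (f : X 0 → ℝ) (hf : Continuous f)
    (hpos : (0 : EReal) < PWLoc (T 0) a (fun i => pullCov (τ i) (𝒰 i)) Set.univ f) :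
    ∀ l : ℕ, 0 < l →
      ∃ μ : Measure (X 0), IsProbabilityMeasure μ ∧ μ.map (T 0) = μ ∧
        ∀ (d : Fin k → ℕ) (V : ∀ i, Fin (d i) → Set (X 0)) (β : ∀ i, Fin (d i) → Set (X 0)),
          (∀ i, Set.range (V i) = joinFrom (fun j => pullCov (τ j) (𝒰 j)) i) →
          (∀ i, IsPart (β i)) →
          (∀ i t, IsClopen (β i t)) →
          (∀ i t, β i t ⊆ V i t) →
          ((l : ℝ) : EReal) *
              (PWLoc (T 0) a (fun i => pullCov (τ i) (𝒰 i)) Set.univ f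
                - ((2 * wfJoin f (fun i => pullCov (τ i) (𝒰 i)) : ℝ) : EReal)
                - ((∫ x, f x ∂μ : ℝ) : EReal))
            - ((1 : ℝ) : EReal)
            - (((k : ℝ) * (∑ i : Fin k, a i) * Real.log 2 : ℝ) : EReal)
          ≤ ∑ i : Fin k, ((a i : ℝ) : EReal) *
              ((entH μ (dynJoin (T 0) (β i) l) : ℝ) : EReal) := by
  intro l hl
  have hl0 : (0 : ℝ) < l := Nat.cast_pos.2 hl
  have h𝒱 : ∀ i, IsOpenCover (pullCov (τ i) (𝒰 i)) := fun i => (h𝒰 i).pullCov (hτc i)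
  obtain ⟨h, hh⟩ := exists_PWLoc_eq_coe (hT 0) h𝒱 ha1 ha hf hpos
  have hs : ((h - 1 / l : ℝ) : EReal)
      < PWLoc (T 0) a (fun i => pullCov (τ i) (𝒰 i)) Set.univ f := by
    rw [hh, EReal.coe_lt_coe_iff]
    exact sub_lt_self h (one_div_pos.2 hl0)
  obtain ⟨μ, hμ, hinv, hent⟩ := exists_invariant_measure_le_entropy (hT 0) ha1 ha h𝒱 hf hs
  refine ⟨μ, hμ, hinv, fun d V β hV hβ hβc hβV => ?_⟩
  choose φ hφ using fun i => exists_label_of_isPart (hβ i)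
  have hmain := hent (fun i => Fin (d i)) φ (fun i t => hφ i t ▸ hβc i t)
    (fun i t => ⟨V i t, hV i ▸ mem_range_self t, hφ i t ▸ hβV i t⟩) l
  simp only [← entH_dynJoin_eq_labelEnt μ (T 0) (hφ _) l] at hmain
  simp only [hh, ← EReal.coe_mul, ← ereal_coe_sum, ← EReal.coe_sub, EReal.coe_le_coe_iff]
  refine le_trans ?_ hmain
  have hw := mul_nonneg hl0.le (wfJoin_nonneg f fun i => pullCov (τ i) (𝒰 i))
  have hlog : 0 ≤ (k : ℝ) * (∑ i, a i) * Real.log 2 := mul_nonneg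
    (mul_nonneg k.cast_nonneg (Finset.sum_nonneg fun i _ => ha i)) (Real.log_nonneg one_le_two)
  have h1 : (l : ℝ) * (1 / l) = 1 := mul_one_div_cancel hl0.ne'
  linarith

end WTP
end

section
/- For any μ ∈ M(X_1,T_1): Σ_{i=1}^k a_i h_{τ_{i−1}μ}(T_i) = sup_{{U_i}} limsup_{N→∞} (1/N) H_μ( ⋁_{i=1}^k (τ_{i−1}^{−1}U_i)_0^{⌈(a_1+…+a_i)N⌉−1} ) = sup_{{U_i}} liminf_{N→∞} (1/N) H_μ( ⋁_{i=1}^k (τ_{i−1}^{−1}U_i)_0^{⌈(a_1+…+a_i)N⌉−1} ), where the suprema are taken over all tuples of open covers U_i of X_i, i=1,…,k. -/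
open MeasureTheory Set Filter Topology
open scoped ENNReal symmDiff

namespace WTP

variable {k : ℕ}

/-! ### Entropy of finite-valued functions -/

/-- the fibres of `f` are measurable. -/
def FibMeas {X A : Type*} [MeasurableSpace X] (f : X → A) : Prop :=
  ∀ a, MeasurableSet (f ⁻¹' {a})

section FibMeas

variable {X A B : Type*} [MeasurableSpace X] {f : X → A} {g : X → B}

lemma FibMeas.preimage [Finite A] (hf : FibMeas f) (s : Set A) : MeasurableSet (f ⁻¹' s) := by
  have : f ⁻¹' s = ⋃ a ∈ s, f ⁻¹' {a} := by
    ext x; simp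
  rw [this]
  exact MeasurableSet.biUnion s.toFinite.countable fun a _ => hf a

lemma FibMeas.comp_left [Finite A] (hf : FibMeas f) (φ : A → B) : FibMeas (fun x => φ (f x)) :=
  fun b => hf.preimage (φ ⁻¹' {b})

lemma FibMeas.comp_right {Y : Type*} [MeasurableSpace Y] (hf : FibMeas f) {π : Y → X}
    (hπ : Measurable π) : FibMeas (fun y => f (π y)) :=
  fun a => hπ (hf a)

lemma FibMeas.prodMk (hf : FibMeas f) (hg : FibMeas g) : FibMeas (fun x => (f x, g x)) := by
  rintro ⟨a, b⟩
  have : (fun x => (f x, g x)) ⁻¹' {(a, b)} = f ⁻¹' {a} ∩ g ⁻¹' {b} := by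
    ext x; simp
  rw [this]
  exact (hf a).inter (hg b)

lemma FibMeas.pi {J : Type*} [Finite J] {ι : J → Type*} {ξ : ∀ j, X → ι j}
    (hξ : ∀ j, FibMeas (ξ j)) : FibMeas (fun x j => ξ j x) := by
  intro c
  have : (fun x j => ξ j x) ⁻¹' {c} = ⋂ j, ξ j ⁻¹' {c j} := by
    ext x; simp [funext_iff]
  rw [this]
  exact MeasurableSet.iInter fun j => hξ j _

end FibMeas

/-- the entropy of the partition of `X` into the fibres of `f`. -/
noncomputable def fnEnt {X A : Type*} [MeasurableSpace X] [Fintype A] (μ : Measure X)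
    (f : X → A) : ℝ :=
  entH μ (fun a => f ⁻¹' {a})

lemma negMulLog_sum_le {A : Type*} (s : Finset A) (p : A → ℝ) (hp : ∀ a, 0 ≤ p a) :
    Real.negMulLog (∑ a ∈ s, p a) ≤ ∑ a ∈ s, Real.negMulLog (p a) := by
  have h1 : Real.negMulLog (∑ a ∈ s, p a) = ∑ a ∈ s, -(p a) * Real.log (∑ b ∈ s, p b) := by
    rw [Real.negMulLog, ← Finset.sum_neg_distrib, Finset.sum_mul]
  rw [h1]
  refine Finset.sum_le_sum fun a ha => ?_
  rw [Real.negMulLog]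
  rcases (hp a).eq_or_lt with h | h
  · simp [← h]
  · have : Real.log (p a) ≤ Real.log (∑ b ∈ s, p b) :=
      Real.log_le_log h (Finset.single_le_sum (fun i _ => hp i) ha)
    nlinarith

lemma mul_log_submodular_aux {x y z w : ℝ} (hx : 0 ≤ x) (hxy : x ≤ y) (hxz : x ≤ z)
    (hyw : y ≤ w) :
    Real.negMulLog x ≤ -(x * Real.log y) - x * Real.log z + x * Real.log w
      + (y * z / w - x) := by
  rcases hx.eq_or_lt with h | h
  · subst h
    have : 0 ≤ y * z / w := div_nonneg (mul_nonneg hxy hxz) (hxy.trans hyw)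
    simpa using this
  · have hy : 0 < y := h.trans_le hxy
    have hz : 0 < z := h.trans_le hxz
    have hw : 0 < w := hy.trans_le hyw
    have h1 := Real.log_le_sub_one_of_pos (show 0 < y * z / (w * x) by positivity)
    rw [Real.log_div (by positivity) (by positivity), Real.log_mul hy.ne' hz.ne',
      Real.log_mul hw.ne' h.ne'] at h1
    have h2 := mul_le_mul_of_nonneg_left h1 hx
    have h3 : x * (y * z / (w * x) - 1) = y * z / w - x := by
      field_simp
    rw [h3] at h2
    rw [Real.negMulLog]
    linarith

lemma sum_negMulLog_submodular {A B C : Type*} [Fintype A] [Fintype B] [Fintype C]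
    (p : A → B → C → ℝ) (hp : ∀ a b c, 0 ≤ p a b c) :
    (∑ a, ∑ b, ∑ c, Real.negMulLog (p a b c)) + ∑ c, Real.negMulLog (∑ a, ∑ b, p a b c)
      ≤ (∑ a, ∑ c, Real.negMulLog (∑ b, p a b c))
        + ∑ b, ∑ c, Real.negMulLog (∑ a, p a b c) := by
  have key : ∀ a b c, Real.negMulLog (p a b c) ≤
      -(p a b c * Real.log (∑ b', p a b' c)) - p a b c * Real.log (∑ a', p a' b c)
      + p a b c * Real.log (∑ a', ∑ b', p a' b' c)
      + ((∑ b', p a b' c) * (∑ a', p a' b c) / (∑ a', ∑ b', p a' b' c) - p a b c) := by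
    intro a b c
    refine mul_log_submodular_aux (hp _ _ _) ?_ ?_ ?_
    · exact Finset.single_le_sum (f := fun b' => p a b' c) (fun i _ => hp _ _ _)
        (Finset.mem_univ b)
    · exact Finset.single_le_sum (f := fun a' => p a' b c) (fun i _ => hp _ _ _)
        (Finset.mem_univ a)
    · exact Finset.single_le_sum (f := fun a' => ∑ b', p a' b' c)
        (fun i _ => Finset.sum_nonneg fun _ _ => hp _ _ _) (Finset.mem_univ a)
  have h1 := Finset.sum_le_sum fun a (_ : a ∈ Finset.univ) =>
    Finset.sum_le_sum fun b (_ : b ∈ Finset.univ) =>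
    Finset.sum_le_sum fun c (_ : c ∈ Finset.univ) => key a b c
  have e1 : ∑ a, ∑ c, Real.negMulLog (∑ b, p a b c)
      = ∑ a, ∑ b, ∑ c, -(p a b c * Real.log (∑ b', p a b' c)) := by
    refine Finset.sum_congr rfl fun a _ => ?_
    rw [Finset.sum_comm]
    refine Finset.sum_congr rfl fun c _ => ?_
    rw [Finset.sum_neg_distrib, ← Finset.sum_mul, Real.negMulLog]
    ring
  have e2 : ∑ b, ∑ c, Real.negMulLog (∑ a, p a b c)
      = ∑ a, ∑ b, ∑ c, -(p a b c * Real.log (∑ a', p a' b c)) := by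
    rw [Finset.sum_comm (s := (Finset.univ : Finset A))]
    refine Finset.sum_congr rfl fun b _ => ?_
    rw [Finset.sum_comm]
    refine Finset.sum_congr rfl fun c _ => ?_
    rw [Finset.sum_neg_distrib, ← Finset.sum_mul, Real.negMulLog]
    ring
  have e3 : ∑ c, Real.negMulLog (∑ a, ∑ b, p a b c)
      = -∑ a, ∑ b, ∑ c, p a b c * Real.log (∑ a', ∑ b', p a' b' c) := by
    have : ∑ a, ∑ b, ∑ c, p a b c * Real.log (∑ a', ∑ b', p a' b' c)
        = ∑ c, ∑ a, ∑ b, p a b c * Real.log (∑ a', ∑ b', p a' b' c) := by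
      rw [Finset.sum_comm (s := (Finset.univ : Finset C))]
      refine Finset.sum_congr rfl fun a _ => ?_
      rw [Finset.sum_comm]
    rw [this, ← Finset.sum_neg_distrib]
    refine Finset.sum_congr rfl fun c _ => ?_
    simp_rw [← Finset.sum_mul]
    rw [Real.negMulLog]
    ring
  have e4 : ∑ a, ∑ b, ∑ c, ((∑ b', p a b' c) * (∑ a', p a' b c) / (∑ a', ∑ b', p a' b' c)
      - p a b c) = 0 := by
    have : ∀ c, ∑ a, ∑ b, ((∑ b', p a b' c) * (∑ a', p a' b c) / (∑ a', ∑ b', p a' b' c)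
      - p a b c) = 0 := by
      intro c
      have hW : ∑ b, ∑ a, p a b c = ∑ a, ∑ b, p a b c := Finset.sum_comm
      simp_rw [Finset.sum_sub_distrib, mul_div_assoc, ← Finset.mul_sum, ← Finset.sum_div]
      rw [← Finset.sum_mul, hW]
      by_cases h0 : ∑ a, ∑ b, p a b c = 0
      · simp [h0]
      · field_simp
        simp
    calc _ = ∑ c, ∑ a, ∑ b, ((∑ b', p a b' c) * (∑ a', p a' b c) /
            (∑ a', ∑ b', p a' b' c) - p a b c) := by
          rw [Finset.sum_comm (s := (Finset.univ : Finset C))]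
          refine Finset.sum_congr rfl fun a _ => ?_
          rw [Finset.sum_comm]
      _ = 0 := Finset.sum_eq_zero fun c _ => this c
  simp only [Finset.sum_add_distrib, Finset.sum_sub_distrib] at h1 e4
  simp only [Finset.sum_neg_distrib] at h1 e1 e2
  linarith

lemma real_fiber_comp {X A B : Type*} [MeasurableSpace X] [Fintype A] {μ : Measure X} {f : X → A}
    [IsFiniteMeasure μ] [DecidableEq B] (hf : FibMeas f) (φ : A → B) (b : B) :
    μ.real ((fun x => φ (f x)) ⁻¹' {b}) = ∑ a with φ a = b, μ.real (f ⁻¹' {a}) := by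
  rw [sum_measureReal_preimage_singleton _ (fun a _ => hf a)]
  congr 1
  ext x; simp

section FnEnt

variable {X A B C D : Type*} [MeasurableSpace X] [Fintype A] [Fintype B] [Fintype C] [Fintype D]
  {μ : Measure X} {f : X → A} {g : X → B} {h : X → C} {u : X → D}

lemma fnEnt_eq_sum : fnEnt μ f = ∑ a, Real.negMulLog (μ.real (f ⁻¹' {a})) := rfl

lemma entH_nonneg [IsProbabilityMeasure μ] (β : A → Set X) : 0 ≤ entH μ β :=
  Finset.sum_nonneg fun a _ =>
    Real.negMulLog_nonneg measureReal_nonneg (measureReal_le_one (μ := μ) (s := β a))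

lemma fnEnt_comp_le [IsFiniteMeasure μ] (hf : FibMeas f) (φ : A → B) :
    fnEnt μ (fun x => φ (f x)) ≤ fnEnt μ f := by
  classical
  rw [fnEnt_eq_sum, fnEnt_eq_sum,
    ← Finset.sum_fiberwise (s := (Finset.univ : Finset A)) (g := φ)]
  refine Finset.sum_le_sum fun b _ => ?_
  rw [real_fiber_comp hf]
  exact negMulLog_sum_le _ _ fun a => measureReal_nonneg

lemma fnEnt_mono [IsFiniteMeasure μ] (hf : FibMeas f) (hgf : ∀ x y, f x = f y → g x = g y) :
    fnEnt μ g ≤ fnEnt μ f := by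
  rcases isEmpty_or_nonempty X with hX | ⟨⟨x₀⟩⟩
  · have h0 : μ = 0 := Measure.eq_zero_of_isEmpty μ
    simp [fnEnt_eq_sum, h0]
  · have : Nonempty B := ⟨g x₀⟩
    have hfac : Function.FactorsThrough g f := fun x y hxy => hgf x y hxy
    have : g = fun x => (Function.extend f g fun _ => g x₀) (f x) := by
      ext x
      rw [hfac.extend_apply]
    rw [this]
    exact fnEnt_comp_le hf _

lemma fnEnt_congr [IsFiniteMeasure μ] (hf : FibMeas f) (hg : FibMeas g)
    (hgf : ∀ x y, f x = f y ↔ g x = g y) : fnEnt μ f = fnEnt μ g :=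
  le_antisymm (fnEnt_mono hg fun x y => (hgf x y).2) (fnEnt_mono hf fun x y => (hgf x y).1)

lemma fnEnt_prod_submodular [IsFiniteMeasure μ] (hf : FibMeas f) (hg : FibMeas g)
    (hh : FibMeas h) :
    fnEnt μ (fun x => (f x, g x, h x)) + fnEnt μ h
      ≤ fnEnt μ (fun x => (f x, h x)) + fnEnt μ (fun x => (g x, h x)) := by
  classical
  have hfgh := hf.prodMk (hg.prodMk hh)
  have key := sum_negMulLog_submodular
    (fun a b c => μ.real ((fun x => (f x, g x, h x)) ⁻¹' {(a, b, c)}))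
    (fun _ _ _ => measureReal_nonneg)
  have e1 : ∀ c, μ.real (h ⁻¹' {c})
      = ∑ a, ∑ b, μ.real ((fun x => (f x, g x, h x)) ⁻¹' {(a, b, c)}) := by
    intro c
    have := real_fiber_comp (μ := μ) hfgh (fun p => p.2.2) c
    rw [Finset.sum_filter] at this
    simpa [Fintype.sum_prod_type] using this
  have e2 : ∀ a c, μ.real ((fun x => (f x, h x)) ⁻¹' {(a, c)})
      = ∑ b, μ.real ((fun x => (f x, g x, h x)) ⁻¹' {(a, b, c)}) := by
    intro a c
    have := real_fiber_comp (μ := μ) hfgh (fun p => (p.1, p.2.2)) (a, c)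
    rw [Finset.sum_filter] at this
    simpa [Fintype.sum_prod_type, ite_and] using this
  have e3 : ∀ b c, μ.real ((fun x => (g x, h x)) ⁻¹' {(b, c)})
      = ∑ a, μ.real ((fun x => (f x, g x, h x)) ⁻¹' {(a, b, c)}) := by
    intro b c
    have := real_fiber_comp (μ := μ) hfgh (fun p => p.2) (b, c)
    rw [Finset.sum_filter] at this
    simpa [Fintype.sum_prod_type, ite_and] using this
  simp only [fnEnt_eq_sum, Fintype.sum_prod_type, e1, e2, e3]
  exact key

/-- Submodularity of entropy: if `h` is determined by `f` and by `g`, and `u` is determined by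
the pair `(f, g)`, then `H(u) + H(h) ≤ H(f) + H(g)`. -/
lemma fnEnt_submodular [IsFiniteMeasure μ] (hf : FibMeas f) (hg : FibMeas g) (hh : FibMeas h)
    (hfh : ∀ x y, f x = f y → h x = h y) (hgh : ∀ x y, g x = g y → h x = h y)
    (hu : ∀ x y, f x = f y → g x = g y → u x = u y) :
    fnEnt μ u + fnEnt μ h ≤ fnEnt μ f + fnEnt μ g := by
  have h1 := fnEnt_prod_submodular (μ := μ) hf hg hh
  have h2 : fnEnt μ u ≤ fnEnt μ (fun x => (f x, g x, h x)) :=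
    fnEnt_mono (hf.prodMk (hg.prodMk hh)) fun x y hxy => by
      simp only [Prod.mk.injEq] at hxy
      exact hu x y hxy.1 hxy.2.1
  have h3 : fnEnt μ (fun x => (f x, h x)) ≤ fnEnt μ f :=
    fnEnt_mono hf fun x y hxy => by simp [hxy, hfh x y hxy]
  have h4 : fnEnt μ (fun x => (g x, h x)) ≤ fnEnt μ g :=
    fnEnt_mono hg fun x y hxy => by simp [hxy, hgh x y hxy]
  linarith

end FnEnt

/-- Finite-valued functions that agree off a set of small measure have small conditional
entropy. -/
lemma exists_condEnt_le_of_close (A : Type*) [Fintype A] {ε : ℝ} (hε : 0 < ε) :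
    ∃ δ > 0, ∀ {X : Type} [MeasurableSpace X] (μ : Measure X) [IsProbabilityMeasure μ]
      (f g : X → A), FibMeas f → FibMeas g → μ.real {x | f x ≠ g x} < δ →
      fnEnt μ (fun x => (f x, g x)) ≤ fnEnt μ g + ε := by
  classical
  set n : ℝ := (Fintype.card A : ℝ) with hn
  have hη : 0 < ε / (n * n + 1) := by positivity
  have huc : UniformContinuousOn Real.negMulLog (Icc 0 1) :=
    isCompact_Icc.uniformContinuousOn_of_continuous Real.continuous_negMulLog.continuousOn
  obtain ⟨δ, hδ, H⟩ := Metric.uniformContinuousOn_iff.1 huc _ hη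
  refine ⟨δ, hδ, fun {X} _ μ _ f g hf hg hfg => ?_⟩
  have hmem : ∀ s : Set X, μ.real s ∈ Icc (0 : ℝ) 1 := fun s =>
    ⟨measureReal_nonneg, measureReal_le_one⟩
  have bound : ∀ a b, Real.negMulLog (μ.real ((fun x => (f x, g x)) ⁻¹' {(a, b)}))
      ≤ (if a = b then Real.negMulLog (μ.real (g ⁻¹' {b})) else 0) + ε / (n * n + 1) := by
    intro a b
    split_ifs with hab
    · subst hab
      have hsub : (fun x => (f x, g x)) ⁻¹' {(a, a)} ⊆ g ⁻¹' {a} := by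
        intro x hx
        simp only [mem_preimage, mem_singleton_iff, Prod.mk.injEq] at hx
        exact hx.2
      have h1 : μ.real (g ⁻¹' {a}) - μ.real ((fun x => (f x, g x)) ⁻¹' {(a, a)}) < δ := by
        rw [← measureReal_sdiff hsub ((hf.prodMk hg) _)]
        refine lt_of_le_of_lt (measureReal_mono ?_) hfg
        rintro x ⟨hx1, hx2⟩ heq
        simp only [mem_preimage, mem_singleton_iff, Prod.mk.injEq] at hx1 hx2
        exact hx2 ⟨heq.trans hx1, hx1⟩
      have h2 := H _ (hmem (g ⁻¹' {a})) _ (hmem ((fun x => (f x, g x)) ⁻¹' {(a, a)})) (by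
        rw [Real.dist_eq, abs_of_nonneg (sub_nonneg.2 (measureReal_mono hsub))]
        exact h1)
      rw [Real.dist_eq] at h2
      linarith [(abs_lt.1 h2).1]
    · have h1 : μ.real ((fun x => (f x, g x)) ⁻¹' {(a, b)}) < δ := by
        refine lt_of_le_of_lt (measureReal_mono ?_) hfg
        intro x hx heq
        simp only [mem_preimage, mem_singleton_iff, Prod.mk.injEq] at hx
        exact hab (hx.1.symm.trans (heq.trans hx.2))
      have h2 := H _ (hmem ((fun x => (f x, g x)) ⁻¹' {(a, b)})) 0 (by simp) (by
        rw [Real.dist_eq, sub_zero, abs_of_nonneg measureReal_nonneg]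
        exact h1)
      rw [Real.dist_eq, Real.negMulLog_zero, sub_zero] at h2
      linarith [(abs_lt.1 h2).2]
  calc fnEnt μ (fun x => (f x, g x))
      ≤ ∑ a, ∑ b, ((if a = b then Real.negMulLog (μ.real (g ⁻¹' {b})) else 0)
          + ε / (n * n + 1)) := by
        rw [fnEnt_eq_sum, Fintype.sum_prod_type]
        exact Finset.sum_le_sum fun a _ => Finset.sum_le_sum fun b _ => bound a b
    _ = fnEnt μ g + n * n * (ε / (n * n + 1)) := by
        simp [Finset.sum_add_distrib, fnEnt_eq_sum, hn, mul_assoc]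
    _ ≤ fnEnt μ g + ε := by
        have : n * n * (ε / (n * n + 1)) ≤ ε := by
          rw [mul_div_assoc', div_le_iff₀ (by positivity)]
          nlinarith
        linarith


/-! ### Shift-invariant submodular functions on finite sets of pairs -/

/-- a monotone submodular function on finite subsets of `Fin k × ℕ`, invariant under shifts of
the second coordinate. -/
structure IsShiftEntropy {k : ℕ} (H : Finset (Fin k × ℕ) → ℝ) : Prop where
  empty : H ∅ = 0
  mono : ∀ {S S'}, S ⊆ S' → H S ≤ H S'
  submodular : ∀ S S', H (S ∪ S') + H (S ∩ S') ≤ H S + H S'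
  shift : ∀ t S, H (S.image fun p => (p.1, p.2 + t)) = H S

/-- the pairs `(j, l)` with `i ≤ j` and `s ≤ l < t`. -/
def block {k : ℕ} (i : Fin k) (s t : ℕ) : Finset (Fin k × ℕ) :=
  Finset.Ici i ×ˢ Finset.Ico s t

/-- the pairs `(j, l)` with `t ≤ l < c (j + 1)`. -/
def region (k : ℕ) (c : ℕ → ℕ) (t : ℕ) : Finset (Fin k × ℕ) :=
  Finset.univ.biUnion fun j : Fin k => {j} ×ˢ Finset.Ico t (c (j + 1))

lemma mem_block {k : ℕ} {i : Fin k} {s t : ℕ} {p : Fin k × ℕ} :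
    p ∈ block i s t ↔ i ≤ p.1 ∧ s ≤ p.2 ∧ p.2 < t := by
  simp [block]

lemma mem_region {k : ℕ} {c : ℕ → ℕ} {t : ℕ} {p : Fin k × ℕ} :
    p ∈ region k c t ↔ t ≤ p.2 ∧ p.2 < c (p.1 + 1) := by
  obtain ⟨j, l⟩ := p
  simp [region]

lemma image_block {k : ℕ} (i : Fin k) (s t u : ℕ) :
    (block i s t).image (fun p => (p.1, p.2 + u)) = block i (s + u) (t + u) := by
  ext ⟨j, l⟩
  simp only [Finset.mem_image, mem_block, Prod.mk.injEq, Prod.exists]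
  constructor
  · rintro ⟨j', l', h, rfl, rfl⟩
    exact ⟨h.1, by omega, by omega⟩
  · rintro ⟨h1, h2, h3⟩
    exact ⟨j, l - u, ⟨h1, by omega, by omega⟩, rfl, by omega⟩

lemma card_region_le {k : ℕ} {c : ℕ → ℕ} (hc : Monotone c) :
    (region k c 0).card ≤ k * c k := by
  have : region k c 0 ⊆ Finset.univ ×ˢ Finset.range (c k) := by
    intro p hp
    rw [mem_region] at hp
    simpa using hp.2.trans_le (hc (by omega))
  simpa using Finset.card_le_card this

namespace IsShiftEntropy

variable {k : ℕ} {H : Finset (Fin k × ℕ) → ℝ}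

lemma nonneg (h : IsShiftEntropy H) (S : Finset (Fin k × ℕ)) : 0 ≤ H S :=
  h.empty ▸ h.mono (Finset.empty_subset S)

lemma union_le (h : IsShiftEntropy H) (S S' : Finset (Fin k × ℕ)) :
    H (S ∪ S') ≤ H S + H S' := by
  linarith [h.submodular S S', h.nonneg (S ∩ S')]

lemma biUnion_le (h : IsShiftEntropy H) {J : Type*} [DecidableEq J] (s : Finset J)
    (S : J → Finset (Fin k × ℕ)) : H (s.biUnion S) ≤ ∑ j ∈ s, H (S j) := by
  induction s using Finset.induction_on with
  | empty => simp [h.empty]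
  | insert j s hj ih =>
    rw [Finset.biUnion_insert, Finset.sum_insert hj]
    linarith [h.union_le (S j) (s.biUnion S)]

lemma block_eq (h : IsShiftEntropy H) (i : Fin k) {s t : ℕ} (hst : s ≤ t) :
    H (block i s t) = H (block i 0 (t - s)) := by
  rw [← h.shift s (block i 0 (t - s)), image_block]
  congr 2 <;> omega

lemma block_subadditive (h : IsShiftEntropy H) (i : Fin k) :
    Subadditive fun m => H (block i 0 m) := by
  intro m n
  have h1 : block i 0 (m + n) ⊆ block i 0 m ∪ block i m (m + n) := by
    intro p
    simp only [Finset.mem_union, mem_block]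
    omega
  have h2 := h.block_eq i (Nat.le_add_right m n)
  rw [Nat.add_sub_cancel_left] at h2
  linarith [h.mono h1, h.union_le (block i 0 m) (block i m (m + n))]

lemma block_bddBelow (h : IsShiftEntropy H) (i : Fin k) :
    BddBelow (range fun m : ℕ => H (block i 0 m) / m) := by
  refine ⟨0, ?_⟩
  rintro _ ⟨m, rfl⟩
  exact div_nonneg (h.nonneg _) m.cast_nonneg

/-- the growth rate of the entropy of the blocks of index `i`. -/
noncomputable def rate (h : IsShiftEntropy H) (i : Fin k) : ℝ := (h.block_subadditive i).lim

lemma tendsto_rate (h : IsShiftEntropy H) (i : Fin k) :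
    Tendsto (fun m : ℕ => H (block i 0 m) / m) atTop (𝓝 (h.rate i)) :=
  (h.block_subadditive i).tendsto_lim (h.block_bddBelow i)

lemma rate_mul_le (h : IsShiftEntropy H) (i : Fin k) (m : ℕ) :
    h.rate i * m ≤ H (block i 0 m) := by
  rcases Nat.eq_zero_or_pos m with rfl | hm
  · simpa using h.nonneg _
  · rw [← le_div_iff₀ (by exact_mod_cast hm)]
    exact (h.block_subadditive i).lim_le_div (h.block_bddBelow i) hm.ne'

lemma block_concave (h : IsShiftEntropy H) (i : Fin k) (m : ℕ) :
    H (block i 0 (m + 2)) - H (block i 0 (m + 1)) ≤ H (block i 0 (m + 1)) - H (block i 0 m) := by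
  have h1 : block i 0 (m + 1) ∪ block i 1 (m + 2) = block i 0 (m + 2) := by
    ext p
    simp only [Finset.mem_union, mem_block]
    omega
  have h2 : block i 0 (m + 1) ∩ block i 1 (m + 2) = block i 1 (m + 1) := by
    ext p
    simp only [Finset.mem_inter, mem_block]
    omega
  have h3 := h.submodular (block i 0 (m + 1)) (block i 1 (m + 2))
  rw [h1, h2, h.block_eq i (show 1 ≤ m + 1 by omega),
    h.block_eq i (show 1 ≤ m + 2 by omega)] at h3
  simp only [Nat.add_sub_cancel, show m + 2 - 1 = m + 1 by omega] at h3
  linarith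

lemma rate_le_sub (h : IsShiftEntropy H) (i : Fin k) (m : ℕ) :
    h.rate i ≤ H (block i 0 (m + 1)) - H (block i 0 m) := by
  set d := H (block i 0 (m + 1)) - H (block i 0 m) with hd
  have hanti : Antitone fun n => H (block i 0 (n + 1)) - H (block i 0 n) :=
    antitone_nat_of_succ_le fun n => h.block_concave i n
  have hlin : ∀ n : ℕ, H (block i 0 (m + n)) ≤ H (block i 0 m) + n * d := by
    intro n
    induction n with
    | zero => simp
    | succ n ih =>
      have := hanti (Nat.le_add_right m n)
      simp only at this
      push_cast
      rw [← add_assoc]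
      linarith
  by_contra! hlt
  obtain ⟨n, hn⟩ := exists_nat_gt ((H (block i 0 m) - h.rate i * m) / (h.rate i - d))
  rw [div_lt_iff₀ (by linarith)] at hn
  have h1 := h.rate_mul_le i (m + n)
  push_cast at h1
  linarith [hlin n]

lemma region_le (h : IsShiftEntropy H) {c : ℕ → ℕ} (hc : Monotone c) (hc0 : c 0 = 0) :
    H (region k c 0) ≤ ∑ i : Fin k, H (block i 0 (c (i + 1) - c i)) := by
  have h1 : region k c 0 ⊆ Finset.univ.biUnion fun i : Fin k => block i (c i) (c (i + 1)) := by
    rintro ⟨j, l⟩ hp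
    rw [mem_region] at hp
    have hex : ∃ i : ℕ, l < c (i + 1) := ⟨j, hp.2⟩
    have hle : Nat.find hex ≤ j := Nat.find_min' hex hp.2
    refine Finset.mem_biUnion.2 ⟨⟨Nat.find hex, by omega⟩, Finset.mem_univ _, ?_⟩
    rw [mem_block]
    refine ⟨hle, ?_, Nat.find_spec hex⟩
    rcases Nat.eq_zero_or_pos (Nat.find hex) with h0 | h0
    · simp [h0, hc0]
    · have := Nat.find_min hex (Nat.sub_lt h0 one_pos)
      rw [show Nat.find hex - 1 + 1 = Nat.find hex by omega] at this
      simpa using this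
  refine (h.mono h1).trans ((h.biUnion_le _ _).trans ?_)
  exact Finset.sum_le_sum fun i _ => (h.block_eq i (hc (by omega))).le

lemma rate_add_region_succ_le (h : IsShiftEntropy H) {c : ℕ → ℕ} (hc : Monotone c) (i : Fin k)
    {t : ℕ} (h1 : c i ≤ t) (h2 : t < c (i + 1)) :
    h.rate i + H (region k c (t + 1)) ≤ H (region k c t) := by
  have hM : t < c k := h2.trans_le (hc (by omega))
  have hmem : ∀ p : Fin k × ℕ, t < c (p.1 + 1) → i ≤ p.1 := by
    intro p hp
    by_contra! hlt
    have : c (p.1 + 1) ≤ c i := hc (by simpa [Nat.succ_le_iff] using hlt)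
    omega
  have hck : ∀ p : Fin k × ℕ, c (p.1 + 1) ≤ c k := fun p => hc (by omega)
  have hge : ∀ p : Fin k × ℕ, i ≤ p.1 → c (i + 1) ≤ c (p.1 + 1) := fun p hp =>
    hc (by simpa using hp)
  have e1 : region k c t ∪ block i (t + 1) (c k) = block i t (c k) := by
    ext p
    have := hmem p
    have := hck p
    have := hge p
    simp only [Finset.mem_union, mem_block, mem_region]
    constructor
    · rintro (h | h)
      · exact ⟨hmem p (by omega), by omega, by omega⟩
      · exact ⟨h.1, by omega, by omega⟩
    · rintro ⟨h3, h4, h5⟩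
      rcases h4.eq_or_lt with h6 | h6
      · exact Or.inl ⟨h4, by have := hge p h3; omega⟩
      · exact Or.inr ⟨h3, h6, h5⟩
  have e2 : region k c t ∩ block i (t + 1) (c k) = region k c (t + 1) := by
    ext p
    have := hck p
    simp only [Finset.mem_inter, mem_block, mem_region]
    constructor
    · rintro ⟨h3, h4⟩
      omega
    · rintro ⟨h3, h4⟩
      exact ⟨⟨by omega, h4⟩, hmem p (by omega), h3, by omega⟩
  have h3 := h.submodular (region k c t) (block i (t + 1) (c k))
  rw [e1, e2, h.block_eq i hM.le, h.block_eq i (show t + 1 ≤ c k from hM)] at h3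
  have h4 := h.rate_le_sub i (c k - (t + 1))
  rw [show c k - (t + 1) + 1 = c k - t by omega] at h4
  linarith

lemma sum_rate_le_region (h : IsShiftEntropy H) {c : ℕ → ℕ} (hc : Monotone c) (hc0 : c 0 = 0) :
    ∑ i : Fin k, h.rate i * ((c (i + 1) - c i : ℕ) : ℝ) ≤ H (region k c 0) := by
  have step : ∀ i : Fin k, h.rate i * ((c (i + 1) - c i : ℕ) : ℝ) + H (region k c (c (i + 1)))
      ≤ H (region k c (c i)) := by
    intro i
    have aux : ∀ m, c i + m ≤ c (i + 1) →
        h.rate i * m + H (region k c (c i + m)) ≤ H (region k c (c i)) := by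
      intro m
      induction m with
      | zero => simp
      | succ m ih =>
        intro hm
        have h1 := ih (by omega)
        have h2 := h.rate_add_region_succ_le hc i (Nat.le_add_right (c i) m) (by omega)
        rw [← add_assoc]
        push_cast
        linarith
    have h1 : c i ≤ c (i + 1) := hc (by omega)
    have := aux (c (i + 1) - c i) (by omega)
    rwa [Nat.add_sub_cancel' h1] at this
  have tele : ∑ i : Fin k, (H (region k c (c i)) - H (region k c (c (i + 1))))
      = H (region k c (c 0)) - H (region k c (c k)) := by
    rw [Fin.sum_univ_eq_sum_range
      (fun i => H (region k c (c i)) - H (region k c (c (i + 1)))) k, Finset.sum_range_sub']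
  rw [hc0] at tele
  have := Finset.sum_le_sum fun i (_ : i ∈ Finset.univ) =>
    (le_sub_iff_add_le.2 (step i))
  linarith [h.nonneg (region k c (c k))]

end IsShiftEntropy

/-! ### Asymptotics of the cut-off times -/

/-- the cut-off time `⌈(a₁ + … + a_s) N⌉`. -/
noncomputable def cut {k : ℕ} (a : Fin k → ℝ) (N s : ℕ) : ℕ :=
  ⌈(∑ j : Fin k with j.val < s, a j) * (N : ℝ)⌉₊

section Cut

variable {k : ℕ} {a : Fin k → ℝ}

lemma cut_zero (a : Fin k → ℝ) (N : ℕ) : cut a N 0 = 0 := by simp [cut]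

lemma cut_succ (a : Fin k → ℝ) (N : ℕ) (i : Fin k) :
    cut a N (i + 1) = ⌈cw a i * (N : ℝ)⌉₊ := by
  rw [cut, cw]
  congr 3
  ext j
  simp

lemma cut_mono (ha : ∀ i, 0 ≤ a i) (N : ℕ) : Monotone (cut a N) := by
  intro s t hst
  refine Nat.ceil_mono (mul_le_mul_of_nonneg_right ?_ N.cast_nonneg)
  refine Finset.sum_le_sum_of_subset_of_nonneg ?_ fun i _ _ => ha i
  intro j
  simp only [Finset.mem_filter, Finset.mem_univ, true_and]
  omega

lemma tendsto_cut_div (ha : ∀ i, 0 ≤ a i) (s : ℕ) :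
    Tendsto (fun N : ℕ => (cut a N s : ℝ) / N) atTop
      (𝓝 (∑ j : Fin k with j.val < s, a j)) :=
  (tendsto_nat_ceil_mul_div_atTop (Finset.sum_nonneg fun i _ => ha i)).comp
    tendsto_natCast_atTop_atTop

lemma tendsto_cut_sub_div (ha : ∀ i, 0 ≤ a i) (i : Fin k) :
    Tendsto (fun N : ℕ => ((cut a N (i + 1) - cut a N i : ℕ) : ℝ) / N) atTop (𝓝 (a i)) := by
  have h := (tendsto_cut_div ha (i + 1)).sub (tendsto_cut_div ha i)
  have e : (∑ j : Fin k with j.val < i.val + 1, a j) - ∑ j : Fin k with j.val < i.val, a j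
      = a i := by
    have : (Finset.univ.filter fun j : Fin k => j.val < i.val + 1)
        = insert i (Finset.univ.filter fun j : Fin k => j.val < i.val) := by
      ext j
      simp only [Finset.mem_filter, Finset.mem_univ, true_and, Finset.mem_insert, Fin.ext_iff]
      omega
    rw [this, Finset.sum_insert (by simp)]
    ring
  rw [e] at h
  refine h.congr fun N => ?_
  rw [Nat.cast_sub (cut_mono ha N (Nat.le_succ _)), sub_div]

lemma IsShiftEntropy.tendsto_block_cut {H : Finset (Fin k × ℕ) → ℝ} (h : IsShiftEntropy H)
    (ha : ∀ i, 0 ≤ a i) (i : Fin k) :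
    Tendsto (fun N : ℕ => H (block i 0 (cut a N (i + 1) - cut a N i)) / N) atTop
      (𝓝 (a i * h.rate i)) := by
  set m : ℕ → ℕ := fun N => cut a N (i + 1) - cut a N i with hm
  have hm1 : Tendsto (fun N : ℕ => (m N : ℝ) / N) atTop (𝓝 (a i)) := tendsto_cut_sub_div ha i
  have hfac : ∀ N : ℕ, (m N : ℝ) / N * (H (block i 0 (m N)) / m N) = H (block i 0 (m N)) / N := by
    intro N
    rcases Nat.eq_zero_or_pos (m N) with h0 | h0
    · have : block i 0 (m N) = ∅ := by
        ext p
        rw [mem_block, h0]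
        simp
      simp [this, h.empty]
    · have : (m N : ℝ) ≠ 0 := by exact_mod_cast h0.ne'
      field_simp
  refine Tendsto.congr hfac ?_
  rcases (ha i).eq_or_lt with h0 | h0
  · rw [← h0, zero_mul]
    rw [← h0] at hm1
    refine hm1.zero_mul_isBoundedUnder_le ?_
    obtain ⟨C, hC⟩ := (h.tendsto_rate i).bddAbove_range
    refine isBoundedUnder_of ⟨C, fun N => ?_⟩
    simp only [Function.comp_apply]
    rw [Real.norm_of_nonneg (div_nonneg (h.nonneg _) (Nat.cast_nonneg _))]
    exact hC ⟨m N, rfl⟩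
  · refine hm1.mul ((h.tendsto_rate i).comp ?_)
    have h1 : Tendsto (fun N : ℕ => (m N : ℝ) / N * N) atTop atTop :=
      hm1.pos_mul_atTop h0 tendsto_natCast_atTop_atTop
    rw [← tendsto_natCast_atTop_iff (R := ℝ)]
    refine h1.congr' ?_
    filter_upwards [eventually_ne_atTop 0] with N hN
    have : (N : ℝ) ≠ 0 := by exact_mod_cast hN
    field_simp

end Cut


/-! ### Joint entropy of a process -/

/-- the entropy of the joint distribution of the variables `ξ p`, `p ∈ S`. -/
noncomputable def jointEnt {X J : Type*} [MeasurableSpace X] [DecidableEq J] {ι : J → Type*}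
    [∀ j, Fintype (ι j)] (μ : Measure X) (ξ : ∀ j, X → ι j) (S : Finset J) : ℝ :=
  fnEnt μ (fun x (j : S) => ξ j x)

section JointEnt

variable {X J : Type*} [MeasurableSpace X] [DecidableEq J] {ι : J → Type*}
    [∀ j, Fintype (ι j)] {μ : Measure X} {ξ : ∀ j, X → ι j}

lemma jointEnt_mono [IsFiniteMeasure μ] (hξ : ∀ j, FibMeas (ξ j)) {S S' : Finset J}
    (h : S ⊆ S') : jointEnt μ ξ S ≤ jointEnt μ ξ S' := by
  refine fnEnt_mono (FibMeas.pi fun j : S' => hξ j) fun x y hxy => ?_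
  ext j
  exact congrFun hxy ⟨j, h j.2⟩

lemma jointEnt_submodular [IsFiniteMeasure μ] (hξ : ∀ j, FibMeas (ξ j)) (S S' : Finset J) :
    jointEnt μ ξ (S ∪ S') + jointEnt μ ξ (S ∩ S') ≤ jointEnt μ ξ S + jointEnt μ ξ S' := by
  refine fnEnt_submodular (FibMeas.pi fun j : S => hξ j) (FibMeas.pi fun j : S' => hξ j)
    (FibMeas.pi fun j : (S ∩ S' : Finset J) => hξ j) ?_ ?_ ?_
  · intro x y hxy
    ext j
    exact congrFun hxy ⟨j, (Finset.mem_inter.1 j.2).1⟩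
  · intro x y hxy
    ext j
    exact congrFun hxy ⟨j, (Finset.mem_inter.1 j.2).2⟩
  · intro x y h1 h2
    ext j
    rcases Finset.mem_union.1 j.2 with h | h
    · exact congrFun h1 ⟨j, h⟩
    · exact congrFun h2 ⟨j, h⟩

/-- If every variable `ξ j`, `j ∈ S`, has conditional entropy at most `ε` given `g`, then so does
their join, up to the factor `#S`. -/
lemma fnEnt_joint_prod_le [IsFiniteMeasure μ] (hξ : ∀ j, FibMeas (ξ j)) {A : Type*} [Fintype A]
    {g : X → A} (hg : FibMeas g) {ε : ℝ} (S : Finset J)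
    (h : ∀ j ∈ S, fnEnt μ (fun x => (ξ j x, g x)) ≤ fnEnt μ g + ε) :
    fnEnt μ (fun x => ((fun j : S => ξ j x), g x)) ≤ fnEnt μ g + S.card * ε := by
  induction S using Finset.induction_on with
  | empty =>
    simp only [Finset.card_empty, Nat.cast_zero, zero_mul, add_zero]
    refine fnEnt_mono hg fun x y hxy => Prod.ext ?_ hxy
    ext j
    exact absurd j.2 (Finset.notMem_empty _)
  | insert j S hj ih =>
    have h1 := ih fun i hi => h i (Finset.mem_insert_of_mem hi)
    have h2 := h j (Finset.mem_insert_self _ _)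
    have h3 := fnEnt_submodular (μ := μ) (h := g)
      (u := fun x => ((fun i : (insert j S : Finset J) => ξ i x), g x))
      ((FibMeas.pi fun i : S => hξ i).prodMk hg) ((hξ j).prodMk hg) hg
      (fun x y hxy => (Prod.ext_iff.1 hxy).2) (fun x y hxy => (Prod.ext_iff.1 hxy).2) (by
        intro x y hx hy
        refine Prod.ext ?_ (Prod.ext_iff.1 hx).2
        ext ⟨i, hi⟩
        rcases Finset.mem_insert.1 hi with rfl | hi
        · exact (Prod.ext_iff.1 hy).1
        · exact congrFun (Prod.ext_iff.1 hx).1 ⟨i, hi⟩)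
    rw [Finset.card_insert_of_notMem hj]
    push_cast
    linarith

end JointEnt

lemma fnEnt_comp_measurePreserving {X Y A : Type*} [MeasurableSpace X] [MeasurableSpace Y]
    [Fintype A] {μ : Measure X} {ν : Measure Y} {π : X → Y} (hπ : MeasurePreserving π μ ν)
    {f : Y → A} (hf : FibMeas f) : fnEnt μ (fun x => f (π x)) = fnEnt ν f := by
  rw [fnEnt_eq_sum, fnEnt_eq_sum]
  refine Finset.sum_congr rfl fun a _ => ?_
  rw [← hπ.measureReal_preimage (hf a).nullMeasurableSet]
  rfl

lemma isShiftEntropy_jointEnt {k : ℕ} {X : Type*} [MeasurableSpace X] {ι : Fin k → Type*}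
    [∀ i, Fintype (ι i)] {μ : Measure X} [IsProbabilityMeasure μ] {T : X → X}
    (hT : MeasurePreserving T μ μ) {γ : ∀ i, X → ι i} (hγ : ∀ i, FibMeas (γ i)) :
    IsShiftEntropy (jointEnt μ fun (p : Fin k × ℕ) x => γ p.1 (T^[p.2] x)) := by
  have hξ : ∀ p : Fin k × ℕ, FibMeas fun x => γ p.1 (T^[p.2] x) := fun p =>
    (hγ p.1).comp_right (hT.measurable.iterate p.2)
  refine ⟨?_, jointEnt_mono hξ, jointEnt_submodular hξ, ?_⟩
  · rw [jointEnt, fnEnt_eq_sum]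
    refine Finset.sum_eq_zero fun c _ => ?_
    have : (fun x (p : (∅ : Finset (Fin k × ℕ))) => γ p.1.1 (T^[p.1.2] x)) ⁻¹' {c} = univ := by
      ext x
      simp only [mem_preimage, mem_singleton_iff, mem_univ, iff_true]
      ext p
      exact absurd p.2 (Finset.notMem_empty _)
    rw [this]
    simp
  · intro t S
    rw [jointEnt, jointEnt, ← fnEnt_comp_measurePreserving (hT.iterate t)
      (FibMeas.pi fun p : S => hξ p)]
    refine fnEnt_congr (FibMeas.pi fun p : (S.image _ : Finset (Fin k × ℕ)) => hξ p)
      (FibMeas.pi fun p : S => (hξ p).comp_right (hT.iterate t).measurable) fun x y => ?_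
    simp only [funext_iff, Subtype.forall, Finset.forall_mem_image, ← Function.iterate_add_apply]

/-! ### Partitions and finite-valued functions -/

lemma isPart_fibers {X A : Type*} [MeasurableSpace X] {f : X → A} (hf : FibMeas f) :
    IsPart fun a => f ⁻¹' {a} := by
  refine ⟨hf, fun a b hab => ?_, by ext x; simp⟩
  rw [Set.disjoint_left]
  rintro x rfl h
  exact hab h

lemma IsPart.exists_fun {X A : Type*} [MeasurableSpace X] {β : A → Set X} (hβ : IsPart β) :
    ∃ f : X → A, FibMeas f ∧ β = fun a => f ⁻¹' {a} := by
  have hex : ∀ x, ∃ a, x ∈ β a := fun x => by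
    simpa using (hβ.2.2 ▸ mem_univ x : x ∈ ⋃ i, β i)
  choose f hf using hex
  have hβf : β = fun a => f ⁻¹' {a} := by
    ext a x
    simp only [mem_preimage, mem_singleton_iff]
    constructor
    · intro hx
      by_contra hne
      exact (Set.disjoint_left.1 (hβ.2.1 _ _ hne)) (hf x) hx
    · rintro rfl
      exact hf x
  exact ⟨f, fun a => congrFun hβf a ▸ hβ.1 a, hβf⟩

lemma entH_dynJoin {X Y A : Type*} [MeasurableSpace X] [MeasurableSpace Y] [Fintype A]
    {μ : Measure X} {π : X → Y} (hπ : Measurable π) {T : X → X} {S : Y → Y} (hS : Measurable S)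
    (hTS : π ∘ T = S ∘ π) {f : Y → A} (hf : FibMeas f) (n : ℕ) :
    entH (μ.map π) (dynJoin S (fun a => f ⁻¹' {a}) n)
      = fnEnt μ (fun x (l : Fin n) => f (π (T^[l] x))) := by
  have hsemi : Function.Semiconj π T S := fun x => congrFun hTS x
  refine Finset.sum_congr rfl fun c _ => ?_
  have hm : MeasurableSet (dynJoin S (fun a => f ⁻¹' {a}) n c) :=
    MeasurableSet.iInter fun l => (hS.iterate l) (hf _)
  rw [Measure.map_apply hπ hm]
  congr 3
  ext x
  simp [dynJoin, funext_iff, (hsemi.iterate_right _).eq]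

lemma covH_bddBelow {X : Type*} [MeasurableSpace X] (μ : Measure X) [IsProbabilityMeasure μ]
    (𝒰 : Set (Set X)) :
    BddBelow {h : ℝ | ∃ (m : ℕ) (β : Fin m → Set X), IsPart β ∧
      (∀ i, ∃ U ∈ 𝒰, β i ⊆ U) ∧ h = entH μ β} := by
  refine ⟨0, ?_⟩
  rintro _ ⟨m, β, -, -, rfl⟩
  exact entH_nonneg β

lemma fnEnt_mem_covH {X A : Type*} [MeasurableSpace X] [Fintype A] {μ : Measure X}
    {𝒰 : Set (Set X)} {f : X → A} (hf : FibMeas f) (hU : ∀ a, ∃ U ∈ 𝒰, f ⁻¹' {a} ⊆ U) :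
    fnEnt μ f ∈ {h : ℝ | ∃ (m : ℕ) (β : Fin m → Set X), IsPart β ∧
      (∀ i, ∃ U ∈ 𝒰, β i ⊆ U) ∧ h = entH μ β} := by
  set e := Fintype.equivFin A
  have he : ∀ i, (fun x => e (f x)) ⁻¹' {i} = f ⁻¹' {e.symm i} := by
    intro i
    ext x
    simp [Equiv.eq_symm_apply]
  refine ⟨Fintype.card A, fun i => (fun x => e (f x)) ⁻¹' {i}, isPart_fibers (hf.comp_left e),
    fun i => ?_, ?_⟩
  · simpa only [he] using hU _
  · rw [entH, fnEnt_eq_sum]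
    simp_rw [he]
    exact (e.symm.sum_comp fun a => Real.negMulLog (μ (f ⁻¹' {a})).toReal).symm

lemma exists_fun_refining {Y : Type*} [TopologicalSpace Y] [MeasurableSpace Y]
    [OpensMeasurableSpace Y] {𝒰 : Set (Set Y)} (h : IsOpenCover 𝒰) :
    ∃ (m : ℕ) (f : Y → Fin m) (U : Fin m → Set Y), FibMeas f ∧ (∀ i, U i ∈ 𝒰) ∧
      ∀ y, y ∈ U (f y) := by
  obtain ⟨m, U, -, hU⟩ := h.1.fin_param
  have hmem : ∀ i, U i ∈ 𝒰 := fun i => hU ▸ mem_range_self i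
  have hex : ∀ y, ∃ i, y ∈ U i ∧ ∀ j < i, y ∉ U j := by
    intro y
    obtain ⟨V, hV, hy⟩ := (h.2.2 ▸ mem_univ y : y ∈ ⋃₀ 𝒰)
    obtain ⟨i, rfl⟩ := (hU ▸ hV : V ∈ range U)
    obtain ⟨i, hi, hmin⟩ := wellFounded_lt.has_min {i | y ∈ U i} ⟨i, hy⟩
    exact ⟨i, hi, fun j hj hyj => hmin j hyj hj⟩
  choose f hf using hex
  refine ⟨m, f, U, fun i => ?_, hmem, fun y => (hf y).1⟩
  have : f ⁻¹' {i} = U i \ ⋃ j ∈ Iio i, U j := by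
    ext y
    simp only [mem_preimage, mem_singleton_iff, Set.mem_sdiff, mem_iUnion, mem_Iio, not_exists]
    constructor
    · rintro rfl
      exact hf y
    · rintro ⟨h1, h2⟩
      rcases lt_trichotomy (f y) i with h3 | h3 | h3
      · exact absurd (hf y).1 (h2 _ h3)
      · exact h3
      · exact absurd h1 ((hf y).2 _ h3)
  rw [this]
  exact (h.2.1 _ (hmem i)).measurableSet.diff
    (MeasurableSet.biUnion (to_countable _) fun j _ => (h.2.1 _ (hmem j)).measurableSet)

/-- For every finite partition there is an open cover such that any partition refining the
cover almost determines the given partition. -/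
lemma exists_openCover_condEnt_le {Y : Type} [MetricSpace Y] [MeasurableSpace Y] [BorelSpace Y]
    (ν : Measure Y) [IsProbabilityMeasure ν] {A : Type*} [Fintype A] {α : Y → A}
    (hα : FibMeas α) {ε : ℝ} (hε : 0 < ε) :
    ∃ 𝒰 : Set (Set Y), IsOpenCover 𝒰 ∧ ∀ {X : Type} {B : Type} [MeasurableSpace X] [Fintype B]
      (μ : Measure X) [IsProbabilityMeasure μ] (π : X → Y) (g : X → B),
      MeasurePreserving π μ ν → FibMeas g → (∀ b, ∃ U ∈ 𝒰, g ⁻¹' {b} ⊆ π ⁻¹' U) →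
      fnEnt μ (fun x => (α (π x), g x)) ≤ fnEnt μ g + ε := by
  classical
  obtain ⟨δ, hδ, H⟩ := exists_condEnt_le_of_close A hε
  set n : ℝ := (Fintype.card A : ℝ) with hn
  have hη : ENNReal.ofReal (δ / (n + 1)) ≠ 0 := by
    rw [Ne, ENNReal.ofReal_eq_zero, not_le]
    positivity
  have hK : ∀ a, ∃ F, F ⊆ α ⁻¹' {a} ∧ IsClosed F ∧
      ν (α ⁻¹' {a} \ F) < ENNReal.ofReal (δ / (n + 1)) := fun a =>
    (hα a).exists_isClosed_sdiff_lt (measure_ne_top _ _) hη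
  choose K hKα hKc hKν using hK
  have hKν' : ∀ a, ν.real (α ⁻¹' {a} \ K a) ≤ δ / (n + 1) := fun a =>
    ENNReal.toReal_le_of_le_ofReal (by positivity) (hKν a).le
  have hbad : ν.real {y | y ∉ K (α y)} < δ := by
    have hsub : {y | y ∉ K (α y)} ⊆ ⋃ a, (α ⁻¹' {a} \ K a) := by
      intro y hy
      exact mem_iUnion.2 ⟨α y, rfl, hy⟩
    calc ν.real {y | y ∉ K (α y)} ≤ ν.real (⋃ a, (α ⁻¹' {a} \ K a)) := measureReal_mono hsub
      _ ≤ ∑ a, ν.real (α ⁻¹' {a} \ K a) := measureReal_iUnion_fintype_le _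
      _ ≤ ∑ a : A, δ / (n + 1) := Finset.sum_le_sum fun a _ => hKν' a
      _ = n * (δ / (n + 1)) := by simp [hn]
      _ < δ := by
        rw [mul_div_assoc', div_lt_iff₀ (by positivity)]
        nlinarith
  refine ⟨range fun a => ⋂ b ∈ {b | b ≠ a}, (K b)ᶜ, ⟨finite_range _, ?_, ?_⟩, ?_⟩
  · rintro _ ⟨a, rfl⟩
    exact (toFinite _).isOpen_biInter fun b _ => (hKc b).isOpen_compl
  · refine eq_univ_of_forall fun y => mem_sUnion.2 ⟨_, mem_range_self (α y), ?_⟩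
    simp only [mem_ofPred_eq, mem_iInter, mem_compl_iff]
    intro b hb hy
    exact hb (hKα b hy).symm
  · intro X B _ _ μ _ π g hπ hg hgU
    have hφ : ∀ b, ∃ a, g ⁻¹' {b} ⊆ π ⁻¹' ⋂ c ∈ {c | c ≠ a}, (K c)ᶜ := by
      intro b
      obtain ⟨_, ⟨a, rfl⟩, ha⟩ := hgU b
      exact ⟨a, ha⟩
    choose φ hφ using hφ
    have hclose : μ.real {x | α (π x) ≠ φ (g x)} < δ := by
      have hmeas : MeasurableSet {y | y ∉ K (α y)} := by
        have : {y | y ∉ K (α y)} = ⋃ a, (α ⁻¹' {a} \ K a) := by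
          ext y; simp
        rw [this]
        exact MeasurableSet.iUnion fun a => (hα a).diff (hKc a).measurableSet
      refine lt_of_le_of_lt ?_ hbad
      rw [← hπ.measureReal_preimage hmeas.nullMeasurableSet]
      refine measureReal_mono fun x hx hxK => ?_
      have h1 := hφ (g x) (show x ∈ g ⁻¹' {g x} from rfl)
      simp only [mem_preimage, mem_iInter] at h1
      exact h1 _ hx hxK
    have hαπ := hα.comp_right hπ.measurable
    have hφg := hg.comp_left φ
    have h1 := H μ _ _ hαπ hφg hclose
    have h2 := fnEnt_submodular (μ := μ) (h := fun x => φ (g x))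
      (u := fun x => (α (π x), g x)) (hαπ.prodMk hφg) hg hφg
      (fun x y hxy => (Prod.ext_iff.1 hxy).2) (fun x y hxy => by rw [hxy])
      (fun x y hx hy => Prod.ext (Prod.ext_iff.1 hx).1 hy)
    linarith

/-! ### Suprema in the extended reals -/

lemma sum_mul_iSup_le {J : Type*} [Fintype J] {P : J → Type*} [∀ j, Nonempty (P j)]
    {a : J → ℝ} (ha : ∀ j, 0 ≤ a j) {f : ∀ j, P j → EReal} (hf : ∀ j p, 0 ≤ f j p) {B : EReal}
    (hB : ∀ p : ∀ j, P j, ∑ j, (a j : EReal) * f j (p j) ≤ B) :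
    ∑ j, (a j : EReal) * ⨆ p, f j p ≤ B := by
  classical
  have key : ∀ (s : Finset J) (p : ∀ j, P j),
      ∑ j ∈ s, (a j : EReal) * (⨆ q, f j q) + ∑ j ∈ sᶜ, (a j : EReal) * f j (p j) ≤ B := by
    intro s
    induction s using Finset.induction_on with
    | empty => simpa using hB
    | insert i s hi ih =>
      intro p
      have hnn : ∀ j q, 0 ≤ (a j : EReal) * f j q := fun j q =>
        EReal.mul_nonneg (EReal.coe_nonneg.2 (ha j)) (hf j q)
      have hnn' : ∀ j, 0 ≤ (a j : EReal) * ⨆ q, f j q := fun j =>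
        EReal.mul_nonneg (EReal.coe_nonneg.2 (ha j))
          ((hf j (Classical.arbitrary _)).trans (le_iSup (f j) _))
      have hcompl : sᶜ = insert i (insert i s)ᶜ := by
        ext j
        simp only [Finset.mem_compl, Finset.mem_insert]
        by_cases hj : j = i <;> simp [hj, hi]
      rw [Finset.sum_insert hi, add_assoc]
      set R := ∑ j ∈ s, (a j : EReal) * (⨆ q, f j q)
        + ∑ j ∈ (insert i s)ᶜ, (a j : EReal) * f j (p j) with hR
      have hR0 : 0 ≤ R := add_nonneg (Finset.sum_nonneg fun j _ => hnn' j)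
        (Finset.sum_nonneg fun j _ => hnn j _)
      have hq : ∀ q, (a i : EReal) * f i q + R ≤ B := by
        intro q
        have h1 := ih (Function.update p i q)
        rw [hcompl, Finset.sum_insert (by simp), Function.update_self] at h1
        have h2 : ∑ j ∈ (insert i s)ᶜ, (a j : EReal) * f j (Function.update p i q j)
            = ∑ j ∈ (insert i s)ᶜ, (a j : EReal) * f j (p j) := by
          refine Finset.sum_congr rfl fun j hj => ?_
          have hji : j ≠ i := by
            rintro rfl
            simp at hj
          rw [Function.update_of_ne hji]
        rw [h2] at h1
        rwa [hR, add_left_comm]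
      have hRB : R ≤ B := le_trans (le_add_of_nonneg_left (hnn i (p i))) (hq (p i))
      rcases (ha i).eq_or_lt with h0 | h0
      · simpa [← h0] using hRB
      · have ha0 : (0 : EReal) < (a i : EReal) := by exact_mod_cast h0
        have hbot : R ≠ ⊥ := fun h => by simp [h] at hR0
        rcases eq_or_ne R ⊤ with htop | htop
        · rw [htop, top_le_iff] at hRB
          rw [hRB]
          exact le_top
        · rw [← EReal.le_sub_iff_add_le (Or.inl hbot) (Or.inl htop), mul_comm,
            ← EReal.le_div_iff_mul_le ha0 (EReal.coe_ne_top _)]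
          refine iSup_le fun q => ?_
          rw [EReal.le_div_iff_mul_le ha0 (EReal.coe_ne_top _), mul_comm,
            EReal.le_sub_iff_add_le (Or.inl hbot) (Or.inl htop)]
          exact hq q
  simpa using key Finset.univ fun j => Classical.arbitrary _


lemma EReal_coe_sum {J : Type*} (s : Finset J) (f : J → ℝ) :
    ((∑ j ∈ s, f j : ℝ) : EReal) = ∑ j ∈ s, (f j : EReal) := by
  classical
  induction s using Finset.induction_on with
  | empty => simp
  | insert j s hj ih => rw [Finset.sum_insert hj, Finset.sum_insert hj, EReal.coe_add, ih]

lemma hPart_nonneg {X A : Type*} [MeasurableSpace X] [Fintype A] (μ : Measure X)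
    [IsProbabilityMeasure μ] (T : X → X) (β : A → Set X) : 0 ≤ hPart μ T β := by
  refine le_liminf_of_le (by isBoundedDefault) (Eventually.of_forall fun n => ?_)
  exact EReal.coe_nonneg.2 (div_nonneg (entH_nonneg _) n.cast_nonneg)

/-! ### Entropy of the factors and entropy of the joint process -/

section Factors

variable {k : ℕ} {X : Fin k → Type} [∀ i, MeasurableSpace (X i)] {Z : Type} [MeasurableSpace Z]
  {μ : Measure Z} [IsProbabilityMeasure μ] {T₀ : Z → Z} {T : ∀ i, X i → X i} {τ : ∀ i, Z → X i}
  {ι : Fin k → Type} [∀ i, Fintype (ι i)] {α : ∀ i, X i → ι i}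

lemma hPart_le_rate (hT₀ : Measurable T₀) (hT : ∀ i, Measurable (T i))
    (hτ : ∀ i, Measurable (τ i)) (hτe : ∀ i, τ i ∘ T₀ = T i ∘ τ i) (hα : ∀ i, FibMeas (α i))
    (h : IsShiftEntropy (jointEnt μ fun (p : Fin k × ℕ) z => α p.1 (τ p.1 (T₀^[p.2] z))))
    (i : Fin k) :
    hPart (μ.map (τ i)) (T i) (fun a => α i ⁻¹' {a}) ≤ (h.rate i : EReal) := by
  have hlim := (continuous_coe_real_ereal.tendsto _).comp (h.tendsto_rate i)
  rw [← hlim.liminf_eq]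
  refine liminf_le_liminf (Eventually.of_forall fun n => ?_)
  refine EReal.coe_le_coe_iff.2 (div_le_div_of_nonneg_right ?_ n.cast_nonneg)
  rw [entH_dynJoin (hτ i) (hT i) (hτe i) (hα i)]
  refine fnEnt_mono (FibMeas.pi fun p : block i 0 n =>
    (hα p.1.1).comp_right ((hτ p.1.1).comp (hT₀.iterate p.1.2))) fun x y hxy => ?_
  ext l
  exact congrFun hxy ⟨(i, l), mem_block.2 ⟨le_rfl, Nat.zero_le _, l.2⟩⟩

lemma rate_le_hKS (hT₀ : Measurable T₀) (hT : ∀ i, Measurable (T i))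
    (hτ : ∀ i, Measurable (τ i)) (hτe : ∀ i, τ i ∘ T₀ = T i ∘ τ i)
    (hchain : ∀ i j : Fin k, i ≤ j → ∃ p : X i → X j, Measurable p ∧ p ∘ τ i = τ j)
    (hα : ∀ i, FibMeas (α i))
    (h : IsShiftEntropy (jointEnt μ fun (p : Fin k × ℕ) z => α p.1 (τ p.1 (T₀^[p.2] z))))
    (i : Fin k) : (h.rate i : EReal) ≤ hKS (μ.map (τ i)) (T i) := by
  classical
  choose p hpm hp using hchain
  let F : X i → ∀ j : {j : Fin k // i ≤ j}, ι j := fun y j => α j (p i j j.2 y)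
  have hF : FibMeas F := FibMeas.pi fun j : {j : Fin k // i ≤ j} =>
    (hα j).comp_right (hpm i j j.2)
  have hFτ : ∀ z, F (τ i z) = fun j : {j : Fin k // i ≤ j} => α j (τ j z) := by
    intro z
    ext j
    exact congrArg (α j) (congrFun (hp i j j.2) z)
  let e := Fintype.equivFin (∀ j : {j : Fin k // i ≤ j}, ι j)
  have heF : FibMeas fun y => e (F y) := hF.comp_left e
  refine le_iSup_of_le (f := fun p : (Σ m : ℕ, {β : Fin m → Set (X i) // IsPart β}) =>
    hPart (μ.map (τ i)) (T i) p.2.1) ⟨_, _, isPart_fibers heF⟩ ?_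
  have hlim := (continuous_coe_real_ereal.tendsto _).comp (h.tendsto_rate i)
  rw [← hlim.liminf_eq]
  refine liminf_le_liminf (Eventually.of_forall fun n => ?_)
  refine EReal.coe_le_coe_iff.2 (div_le_div_of_nonneg_right ?_ n.cast_nonneg)
  rw [entH_dynJoin (hτ i) (hT i) (hτe i) heF]
  refine fnEnt_mono (FibMeas.pi fun l : Fin n =>
    heF.comp_right ((hτ i).comp (hT₀.iterate l))) fun x y hxy => ?_
  ext ⟨⟨j, l⟩, hjl⟩
  rw [mem_block] at hjl
  have h1 := e.injective (congrFun hxy ⟨l, hjl.2.2⟩)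
  simp only [hFτ] at h1
  exact congrFun h1 ⟨j, hjl.1⟩

variable {a : Fin k → ℝ} {𝒰 : ∀ i, Set (Set (X i))}

lemma jointEnt_mem_covH (hT₀ : Measurable T₀) (hτ : ∀ i, Measurable (τ i))
    (hα : ∀ i, FibMeas (α i)) {U : ∀ i, ι i → Set (X i)} (hU : ∀ i c, U i c ∈ 𝒰 i)
    (hαU : ∀ i y, y ∈ U i (α i y)) (N : ℕ) :
    jointEnt μ (fun (p : Fin k × ℕ) z => α p.1 (τ p.1 (T₀^[p.2] z))) (region k (cut a N) 0)
      ∈ {h : ℝ | ∃ (m : ℕ) (β : Fin m → Set Z), IsPart β ∧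
        (∀ i, ∃ V ∈ jointFiber T₀ a (fun i => pullCov (τ i) (𝒰 i)) N, β i ⊆ V)
          ∧ h = entH μ β} := by
  classical
  refine fnEnt_mem_covH (FibMeas.pi fun p : region k (cut a N) 0 =>
    (hα p.1.1).comp_right ((hτ p.1.1).comp (hT₀.iterate p.1.2))) fun c => ?_
  let V : Fin k → ℕ → Set Z := fun i l =>
    if h : (i, l) ∈ region k (cut a N) 0 then τ i ⁻¹' U i (c ⟨(i, l), h⟩) else ∅
  have hV : ∀ (i : Fin k) (l : ℕ) (hl : l < ⌈cw a i * (N : ℝ)⌉₊),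
      ∃ h : (i, l) ∈ region k (cut a N) 0, V i l = τ i ⁻¹' U i (c ⟨(i, l), h⟩) := by
    intro i l hl
    have h : (i, l) ∈ region k (cut a N) 0 :=
      mem_region.2 ⟨Nat.zero_le _, by rwa [cut_succ]⟩
    exact ⟨h, dif_pos h⟩
  refine ⟨_, ⟨V, fun i l hl => ?_, rfl⟩, ?_⟩
  · obtain ⟨h, hVe⟩ := hV i l hl
    rw [hVe]
    exact mem_image_of_mem _ (hU _ _)
  · rintro x rfl
    simp only [mem_iInter, Finset.mem_range]
    intro i l hl
    obtain ⟨h, hVe⟩ := hV i l hl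
    rw [hVe]
    exact hαU _ _

lemma jointEnt_le_covH_add (hT₀ : MeasurePreserving T₀ μ μ) (hτ : ∀ i, Measurable (τ i))
    (hα : ∀ i, FibMeas (α i)) {ε : ℝ}
    (hcov : ∀ i, ∀ {B : Type} [Fintype B] (π : Z → X i) (g : Z → B),
      MeasurePreserving π μ (μ.map (τ i)) → FibMeas g →
      (∀ b, ∃ U ∈ 𝒰 i, g ⁻¹' {b} ⊆ π ⁻¹' U) →
      fnEnt μ (fun x => (α i (π x), g x)) ≤ fnEnt μ g + ε) (N : ℕ)
    (hne : {h : ℝ | ∃ (m : ℕ) (β : Fin m → Set Z), IsPart β ∧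
        (∀ i, ∃ V ∈ jointFiber T₀ a (fun i => pullCov (τ i) (𝒰 i)) N, β i ⊆ V)
          ∧ h = entH μ β}.Nonempty) :
    jointEnt μ (fun (p : Fin k × ℕ) z => α p.1 (τ p.1 (T₀^[p.2] z))) (region k (cut a N) 0)
      ≤ covH μ (jointFiber T₀ a (fun i => pullCov (τ i) (𝒰 i)) N)
        + (region k (cut a N) 0).card * ε := by
  rw [← sub_le_iff_le_add]
  refine le_csInf hne ?_
  rintro _ ⟨m, β, hβ, hβV, rfl⟩
  obtain ⟨g, hg, rfl⟩ := hβ.exists_fun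
  rw [sub_le_iff_le_add]
  have hξ : ∀ p : Fin k × ℕ, FibMeas fun z => α p.1 (τ p.1 (T₀^[p.2] z)) := fun p =>
    (hα p.1).comp_right ((hτ p.1).comp (hT₀.measurable.iterate p.2))
  refine le_trans (fnEnt_mono ((FibMeas.pi fun p : region k (cut a N) 0 => hξ p).prodMk hg)
    fun x y hxy => (Prod.ext_iff.1 hxy).1)
    (fnEnt_joint_prod_le hξ hg (ε := ε) (region k (cut a N) 0) ?_)
  rintro ⟨i, l⟩ hp
  rw [mem_region, cut_succ] at hp
  refine hcov i (fun z => τ i (T₀^[l] z)) g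
    ((hτ i).measurePreserving μ |>.comp (hT₀.iterate l)) hg fun b => ?_
  obtain ⟨_, ⟨V, hV, rfl⟩, hb⟩ := hβV b
  obtain ⟨U, hU, hUV⟩ := hV i l hp.2
  refine ⟨U, hU, fun x hx => ?_⟩
  have := hb hx
  simp only [mem_iInter, Finset.mem_range] at this
  have h1 := this i l hp.2
  rw [← hUV] at h1
  exact h1

end Factors


/-- For any `μ ∈ M(X₁,T₁)`, the weighted sum of measure-theoretic entropies
equals the supremum over all tuples of open covers of both the `limsup` and the `liminf` of
`(1/N) H_μ(⋁_{i=1}^k (τ_{i-1}^{-1}𝒰_i)_0^{⌈(a_1+…+a_i)N⌉-1})`. -/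
theorem weighted_entropy_eq_sup_cover_entropy
    {k : ℕ} [NeZero k]
    (X : Fin k → Type) [∀ i, MetricSpace (X i)] [∀ i, CompactSpace (X i)]
    [∀ i, MeasurableSpace (X i)] [∀ i, BorelSpace (X i)]
    (T : ∀ i, X i → X i) (hT : ∀ i, Continuous (T i))
    (τ : ∀ i, X 0 → X i) (hτ0 : τ 0 = id)
    (hτc : ∀ i, Continuous (τ i)) (hτs : ∀ i, Function.Surjective (τ i))
    (hτe : ∀ i, τ i ∘ T 0 = T i ∘ τ i)
    (hchain : ∀ i j : Fin k, i ≤ j → ∃ p : X i → X j,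
        Continuous p ∧ p ∘ T i = T j ∘ p ∧ p ∘ τ i = τ j)
    (a : Fin k → ℝ) (ha1 : 0 < a 0) (ha : ∀ i, 0 ≤ a i)
    (μ : Measure (X 0)) [IsProbabilityMeasure μ] (hμ : μ.map (T 0) = μ) :
    ((∑ i : Fin k, ((a i : ℝ) : EReal) * hKS (μ.map (τ i)) (T i))
        = ⨆ 𝒰 : {𝒰 : ∀ i, Set (Set (X i)) // ∀ i, IsOpenCover (𝒰 i)},
            Filter.limsup
              (fun N : ℕ =>
                ((covH μ (jointFiber (T 0) a (fun i => pullCov (τ i) (𝒰.1 i)) N) / N : ℝ) :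
                  EReal))
              Filter.atTop)
    ∧ ((∑ i : Fin k, ((a i : ℝ) : EReal) * hKS (μ.map (τ i)) (T i))
        = ⨆ 𝒰 : {𝒰 : ∀ i, Set (Set (X i)) // ∀ i, IsOpenCover (𝒰 i)},
            Filter.liminf
              (fun N : ℕ =>
                ((covH μ (jointFiber (T 0) a (fun i => pullCov (τ i) (𝒰.1 i)) N) / N : ℝ) :
                  EReal))
              Filter.atTop) := by
  have hTm : ∀ i, Measurable (T i) := fun i => (hT i).measurable
  have hτm : ∀ i, Measurable (τ i) := fun i => (hτc i).measurable
  have hT₀ : MeasurePreserving (T 0) μ μ := ⟨hTm 0, hμ⟩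
  have hprob : ∀ i, IsProbabilityMeasure (μ.map (τ i)) := fun i =>
    Measure.isProbabilityMeasure_map (hτm i).aemeasurable
  have hshift : ∀ {ι : Fin k → Type} [∀ i, Fintype (ι i)] {α : ∀ i, X i → ι i}
      (_ : ∀ i, FibMeas (α i)), IsShiftEntropy
        (jointEnt μ fun (p : Fin k × ℕ) z => α p.1 (τ p.1 ((T 0)^[p.2] z))) := fun {ι _ α} hα =>
    isShiftEntropy_jointEnt hT₀ (γ := fun i z => α i (τ i z)) fun i => (hα i).comp_right (hτm i)
  have hcut_mono : ∀ N, Monotone (cut a N) := cut_mono ha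
  have upper : (⨆ 𝒰 : {𝒰 : ∀ i, Set (Set (X i)) // ∀ i, IsOpenCover (𝒰 i)},
      Filter.limsup (fun N : ℕ =>
        ((covH μ (jointFiber (T 0) a (fun i => pullCov (τ i) (𝒰.1 i)) N) / N : ℝ) : EReal))
        Filter.atTop) ≤ ∑ i : Fin k, ((a i : ℝ) : EReal) * hKS (μ.map (τ i)) (T i) := by
    refine iSup_le fun 𝒰 => ?_
    choose m α U hα hU hαU using fun i => exists_fun_refining (𝒰.2 i)
    have h := hshift hα
    have hlim : Tendsto (fun N : ℕ =>
        ((∑ i : Fin k, jointEnt μ (fun (p : Fin k × ℕ) z => α p.1 (τ p.1 ((T 0)^[p.2] z)))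
          (block i 0 (cut a N (i + 1) - cut a N i)) / N : ℝ) : EReal)) atTop
        (𝓝 ((∑ i : Fin k, a i * h.rate i : ℝ) : EReal)) :=
      (continuous_coe_real_ereal.tendsto _).comp
        (tendsto_finsetSum _ fun i _ => h.tendsto_block_cut ha i)
    calc _ ≤ ((∑ i : Fin k, a i * h.rate i : ℝ) : EReal) := by
          rw [← hlim.limsup_eq]
          refine limsup_le_limsup (Eventually.of_forall fun N => ?_)
          refine EReal.coe_le_coe_iff.2 ?_
          rw [← Finset.sum_div]
          refine div_le_div_of_nonneg_right ?_ N.cast_nonneg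
          exact (csInf_le (covH_bddBelow _ _)
            (jointEnt_mem_covH (hTm 0) hτm hα hU hαU N)).trans
            (h.region_le (hcut_mono N) (cut_zero a N))
      _ ≤ _ := by
          rw [EReal_coe_sum]
          refine Finset.sum_le_sum fun i _ => ?_
          rw [EReal.coe_mul]
          refine mul_le_mul_of_nonneg_left ?_ (EReal.coe_nonneg.2 (ha i))
          refine rate_le_hKS (hTm 0) hTm hτm hτe (fun i j hij => ?_) hα h i
          obtain ⟨p, hp, -, hpτ⟩ := hchain i j hij
          exact ⟨p, hp.measurable, hpτ⟩
  have lower : (∑ i : Fin k, ((a i : ℝ) : EReal) * hKS (μ.map (τ i)) (T i)) ≤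
      ⨆ 𝒰 : {𝒰 : ∀ i, Set (Set (X i)) // ∀ i, IsOpenCover (𝒰 i)},
      Filter.liminf (fun N : ℕ =>
        ((covH μ (jointFiber (T 0) a (fun i => pullCov (τ i) (𝒰.1 i)) N) / N : ℝ) : EReal))
        Filter.atTop := by
    have hne : ∀ i, Nonempty (Σ m : ℕ, {β : Fin m → Set (X i) // IsPart β}) := fun i =>
      ⟨1, _, isPart_fibers (f := fun _ : X i => (0 : Fin 1)) fun _ => measurable_const trivial⟩
    refine sum_mul_iSup_le ha (fun i p => hPart_nonneg _ _ _) fun p => ?_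
    choose α hα hαβ using fun i => (p i).2.2.exists_fun
    have h := hshift hα
    calc _ ≤ ((∑ i : Fin k, a i * h.rate i : ℝ) : EReal) := by
          rw [EReal_coe_sum]
          refine Finset.sum_le_sum fun i _ => ?_
          rw [EReal.coe_mul, hαβ i]
          exact mul_le_mul_of_nonneg_left (hPart_le_rate (hTm 0) hTm hτm hτe hα h i)
            (EReal.coe_nonneg.2 (ha i))
      _ ≤ _ := ?_
    rw [← EReal.ge_of_forall_gt_iff_ge]
    intro z hz
    rw [EReal.coe_lt_coe_iff] at hz
    set S : ℝ := ∑ i : Fin k, a i * h.rate i with hS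
    set A : ℝ := ∑ j : Fin k with j.val < k, a j with hA
    have hA0 : 0 ≤ A := Finset.sum_nonneg fun i _ => ha i
    have hε : 0 < (S - z) / (k * A + 1) := div_pos (by linarith) (by positivity)
    set ε : ℝ := (S - z) / (k * A + 1) with hεdef
    choose 𝒰 h𝒰 hcov using fun i => exists_openCover_condEnt_le (μ.map (τ i)) (hα i) hε
    refine le_iSup_of_le (f := fun 𝒰 : {𝒰 : ∀ i, Set (Set (X i)) // ∀ i, IsOpenCover (𝒰 i)} =>
      Filter.liminf (fun N : ℕ =>
        ((covH μ (jointFiber (T 0) a (fun i => pullCov (τ i) (𝒰.1 i)) N) / N : ℝ) : EReal))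
        Filter.atTop) ⟨𝒰, h𝒰⟩ ?_
    choose m α' U hα' hU hαU using fun i => exists_fun_refining (h𝒰 i)
    have hlim : Tendsto (fun N : ℕ =>
        ((∑ i : Fin k, h.rate i * (((cut a N (i + 1) - cut a N i : ℕ) : ℝ) / N)
          - k * (cut a N k / N) * ε : ℝ) : EReal)) atTop
        (𝓝 ((∑ i : Fin k, h.rate i * a i - k * A * ε : ℝ) : EReal)) :=
      (continuous_coe_real_ereal.tendsto _).comp
        ((tendsto_finsetSum _ fun i _ => (tendsto_cut_sub_div ha i).const_mul _).sub
          (((tendsto_cut_div ha k).const_mul _).mul_const _))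
    calc (z : EReal) ≤ ((∑ i : Fin k, h.rate i * a i - k * A * ε : ℝ) : EReal) := by
          refine EReal.coe_le_coe_iff.2 ?_
          have h1 : ∑ i : Fin k, h.rate i * a i = S := by simp only [hS, mul_comm]
          have h2 : (k * A + 1) * ε = S - z := by
            rw [hεdef]
            field_simp
          rw [h1]
          linarith
      _ ≤ _ := by
          rw [← hlim.liminf_eq]
          refine liminf_le_liminf (Eventually.of_forall fun N => ?_)
          refine EReal.coe_le_coe_iff.2 ?_
          have h1 := h.sum_rate_le_region (hcut_mono N) (cut_zero a N)
          have h2 := jointEnt_le_covH_add (𝒰 := 𝒰) (a := a) hT₀ hτm hα (ε := ε)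
            (fun i {_} _ π g hπ hg hgU => hcov i μ π g hπ hg hgU) N
            ⟨_, jointEnt_mem_covH (hTm 0) hτm hα' hU hαU N⟩
          have h3 : ((region k (cut a N) 0).card : ℝ) ≤ k * cut a N k := by
            exact_mod_cast card_region_le (hcut_mono N)
          have h4 := mul_le_mul_of_nonneg_right h3 hε.le
          have h5 : (∑ i : Fin k, h.rate i * ((cut a N (i + 1) - cut a N i : ℕ) : ℝ))
              - k * cut a N k * ε
              ≤ covH μ (jointFiber (T 0) a (fun i => pullCov (τ i) (𝒰 i)) N) := by linarith
          refine le_trans (le_of_eq ?_) (div_le_div_of_nonneg_right h5 N.cast_nonneg)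
          rw [sub_div, Finset.sum_div]
          simp only [mul_div_assoc]
          ring
  have mid : (⨆ 𝒰 : {𝒰 : ∀ i, Set (Set (X i)) // ∀ i, IsOpenCover (𝒰 i)},
      Filter.liminf (fun N : ℕ =>
        ((covH μ (jointFiber (T 0) a (fun i => pullCov (τ i) (𝒰.1 i)) N) / N : ℝ) : EReal))
        Filter.atTop) ≤ ⨆ 𝒰 : {𝒰 : ∀ i, Set (Set (X i)) // ∀ i, IsOpenCover (𝒰 i)},
      Filter.limsup (fun N : ℕ =>
        ((covH μ (jointFiber (T 0) a (fun i => pullCov (τ i) (𝒰.1 i)) N) / N : ℝ) : EReal))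
        Filter.atTop := iSup_mono fun 𝒰 => liminf_le_limsup
  exact ⟨le_antisymm (lower.trans mid) upper, le_antisymm lower (mid.trans upper)⟩

end WTP
end
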